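/- Let m, n ≥ 0 be integers, let p, q ∈ ℂ with 0 < |p| < 1 and 0 < |q| < 1, let ω ∈ ℂ with ω² = pq, and let t_0, ..., t_{2m+2n+3} ∈ ℂ satisfy |ω| < |t_r| < 1 for every r and ∏_{r=0}^{2m+2n+3} t_r = (pq)^{m+1}. For integers k, N ≥ 0 and nonzero parameters s_0, ..., s_{2k+2N+3}, define I^{(k)}_{BC_N}(s_0,...,s_{2k+2N+3};p,q) := ((p;p)_∞ (q;q)_∞)^N/(2^N · N!) · (1/(2π)^N) ∫_{[0,2π]^N} ∏_{i=1}^{N} ∏_{r=0}^{2k+2N+3} Γ(s_r z_i^{±1};p,q) / ( ∏_{1≤i<j≤N} Γ(z_i^{±1} z_j^{±1};p,q) · ∏_{i=1}^{N} Γ(z_i^{±2};p,q) ) dθ_1⋯dθ_N, where z_i = e^{iθ_i}. Then I^{(m)}_{BC_n}(t_0,...,t_{2m+2n+3};p,q) = ∏_{0≤r<s≤2m+2n+3} Γ(t_r t_s;p,q) · I^{(n)}_{BC_m}(ω/t_0, ω/t_1, ..., ω/t_{2m+2n+3};p,q). -/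

import Mathlib

open scoped BigOperators Real
open MeasureTheory

/-- The elliptic Gamma function `Γ(x;p,q)`. -/
noncomputable def ellGamma (x p q : ℂ) : ℂ :=
  ∏' jk : ℕ × ℕ, ((1 - p ^ (jk.1 + 1) * q ^ (jk.2 + 1) / x) / (1 - p ^ jk.1 * q ^ jk.2 * x))

/-- `(p;p)_∞`. -/
noncomputable def qPoch (p : ℂ) : ℂ := ∏' k : ℕ, (1 - p ^ (k + 1))

/-- `n`-fold contour integral over the unit torus, i.e.
`(1/2π)^n ∫_{[0,2π]^n} f(e^{iθ₁},…,e^{iθₙ}) dθ`. -/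
noncomputable def torusInt (n : ℕ) (f : (Fin n → ℂ) → ℂ) : ℂ :=
  ((1 / (2 * Real.pi) : ℝ) : ℂ) ^ n *
    ∫ θ in Set.univ.pi fun _ : Fin n => Set.Icc (0 : ℝ) (2 * Real.pi),
      f fun i => Complex.exp (Complex.I * (θ i))

/-- The `BC_N` elliptic hypergeometric integral `I^{(k)}_{BC_N}` with `d` parameters
(for `d = 2k+2N+4`), with contours on the unit torus. -/
noncomputable def I_BC (N d : ℕ) (s : Fin d → ℂ) (p q : ℂ) : ℂ :=
  (qPoch p * qPoch q) ^ N / ((2 ^ N * N.factorial : ℕ) : ℂ) *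
    torusInt N fun z =>
      (∏ i, ∏ r, ellGamma (s r * z i) p q * ellGamma (s r / z i) p q) /
        ((∏ i, ∏ j, if i < j then
            ellGamma (z i * z j) p q * ellGamma (z i / z j) p q *
              ellGamma (z j / z i) p q * ellGamma (1 / (z i * z j)) p q
          else 1) *
          ∏ i, ellGamma (z i ^ 2) p q * ellGamma (1 / z i ^ 2) p q)

namespace EllipticBC

/-- The double product `∏ (1 - p^j q^k x)`. -/
noncomputable def Ef (p q x : ℂ) : ℂ := ∏' jk : ℕ × ℕ, (1 - p ^ jk.1 * q ^ jk.2 * x)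

/-- The product `∏ (1 - p^k x)`. -/
noncomputable def Qf (p x : ℂ) : ℂ := ∏' k : ℕ, (1 - p ^ k * x)

/-- The multiplicative theta function. -/
noncomputable def th (p x : ℂ) : ℂ := Qf p x * Qf p (p / x)

theorem summable_pow_mul_pow {a b : ℝ} (ha0 : 0 ≤ a) (ha : a < 1) (hb0 : 0 ≤ b) (hb : b < 1)
    (c : ℝ) : Summable fun jk : ℕ × ℕ => a ^ jk.1 * b ^ jk.2 * c :=
  ((summable_geometric_of_lt_one ha0 ha).mul_of_nonneg (summable_geometric_of_lt_one hb0 hb)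
    (fun _ => by positivity) (fun _ => by positivity)).mul_right c

section
variable {p q : ℂ}

theorem summable_norm_Ef (hp : ‖p‖ < 1) (hq : ‖q‖ < 1) (x : ℂ) :
    Summable fun jk : ℕ × ℕ => ‖-(p ^ jk.1 * q ^ jk.2 * x)‖ := by
  simpa using summable_pow_mul_pow (norm_nonneg p) hp (norm_nonneg q) hq ‖x‖

theorem multipliable_Ef (hp : ‖p‖ < 1) (hq : ‖q‖ < 1) (x : ℂ) :
    Multipliable fun jk : ℕ × ℕ => (1 - p ^ jk.1 * q ^ jk.2 * x) := by
  simpa [sub_eq_add_neg] using multipliable_one_add_of_summable (summable_norm_Ef hp hq x)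

theorem multipliable_Qf (hp : ‖p‖ < 1) (x : ℂ) :
    Multipliable fun k : ℕ => (1 - p ^ k * x) := by
  have : Summable fun k : ℕ => ‖-(p ^ k * x)‖ := by
    simpa using (summable_geometric_of_lt_one (norm_nonneg p) hp).mul_right ‖x‖
  simpa [sub_eq_add_neg] using multipliable_one_add_of_summable this

theorem Ef_ne_zero (hp : ‖p‖ < 1) (hq : ‖q‖ < 1) {x : ℂ}
    (h : ∀ j k : ℕ, p ^ j * q ^ k * x ≠ 1) : Ef p q x ≠ 0 := by
  have := tprod_one_add_ne_zero_of_summable (f := fun jk : ℕ × ℕ => -(p ^ jk.1 * q ^ jk.2 * x))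
    (fun jk => by
      have := h jk.1 jk.2
      rw [← sub_eq_add_neg, sub_ne_zero]; exact this.symm) (summable_norm_Ef hp hq x)
  simpa [Ef, sub_eq_add_neg] using this

theorem norm_pow_mul_pow_le (hp : ‖p‖ < 1) (hq : ‖q‖ < 1) (j k : ℕ) (x : ℂ) :
    ‖p ^ j * q ^ k * x‖ ≤ ‖x‖ := by
  rw [norm_mul, norm_mul, norm_pow, norm_pow]
  have h1 := pow_le_one₀ (n := j) (norm_nonneg p) hp.le
  have h2 := pow_le_one₀ (n := k) (norm_nonneg q) hq.le
  calc _ ≤ 1 * 1 * ‖x‖ := by gcongr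
    _ = _ := by ring

theorem Ef_ne_zero_of_norm_lt (hp : ‖p‖ < 1) (hq : ‖q‖ < 1) {x : ℂ} (hx : ‖x‖ < 1) :
    Ef p q x ≠ 0 :=
  Ef_ne_zero hp hq fun j k h => by
    have := norm_pow_mul_pow_le hp hq j k x
    rw [h, norm_one] at this
    linarith

theorem Ef_zero_right (p q : ℂ) : Ef p q 0 = 1 := by simp [Ef]

theorem Qf_zero_right (p : ℂ) : Qf p 0 = 1 := by simp [Qf]

theorem Ef_comm (p q x : ℂ) : Ef p q x = Ef q p x := by
  unfold Ef
  rw [← (Equiv.prodComm ℕ ℕ).tprod_eq]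
  simp [mul_comm]

theorem Qf_shift (hp : ‖p‖ < 1) (x : ℂ) : Qf p x = (1 - x) * Qf p (p * x) := by
  unfold Qf
  rw [tprod_eq_zero_mul']
  · simp [pow_succ, mul_assoc]
  · have := multipliable_Qf hp (p * x)
    simpa [pow_succ, mul_assoc] using this

theorem Ef_shift_right (hp : ‖p‖ < 1) (hq : ‖q‖ < 1) (x : ℂ) :
    Ef p q x = Qf p x * Ef p q (q * x) := by
  have h0 : ∀ y, HasProd (fun k : ℕ => Qf p (q ^ k * y)) (Ef p q y) := by
    intro y
    rw [Ef_comm]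
    refine (multipliable_Ef hq hp y).hasProd.prod_fiberwise fun k => ?_
    exact ((multipliable_Qf hp (q ^ k * y)).hasProd).congr_fun fun j => by ring
  rw [← (h0 x).tprod_eq, ← (h0 (q * x)).tprod_eq, tprod_eq_zero_mul']
  · simp [pow_succ, mul_assoc]
  · simpa [pow_succ, mul_assoc] using (h0 (q * x)).multipliable

theorem Ef_shift_left (hp : ‖p‖ < 1) (hq : ‖q‖ < 1) (x : ℂ) :
    Ef p q x = Qf q x * Ef p q (p * x) := by
  rw [Ef_comm, Ef_shift_right hq hp, Ef_comm q]

theorem Qf_eq_Ef (hp : ‖p‖ < 1) (x : ℂ) : Qf p x = Ef p 0 x := by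
  rw [Ef_shift_right hp (by simp)]
  simp [Ef_zero_right]

theorem Qf_ne_zero (hp : ‖p‖ < 1) {x : ℂ} (h : ∀ j : ℕ, p ^ j * x ≠ 1) : Qf p x ≠ 0 := by
  rw [Qf_eq_Ef hp]
  refine Ef_ne_zero hp (by simp) fun j k => ?_
  rcases k with _ | k
  · simpa using h j
  · simp

theorem Qf_ne_zero_of_norm_lt (hp : ‖p‖ < 1) {x : ℂ} (hx : ‖x‖ < 1) : Qf p x ≠ 0 := by
  rw [Qf_eq_Ef hp]
  exact Ef_ne_zero_of_norm_lt hp (by simp) hx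

theorem Qf_one (p : ℂ) : Qf p 1 = 0 := by
  unfold Qf
  exact tprod_of_exists_eq_zero ⟨0, by simp⟩

theorem th_one (p : ℂ) : th p 1 = 0 := by simp [th, Qf_one]

theorem th_inv (hp : ‖p‖ < 1) {x : ℂ} (hx : x ≠ 0) : th p x⁻¹ = -x⁻¹ * th p x := by
  unfold th
  rw [Qf_shift hp x⁻¹, Qf_shift hp x, div_inv_eq_mul, div_eq_mul_inv]
  field_simp
  ring

theorem th_div_self (hp0 : p ≠ 0) (x : ℂ) : th p (p / x) = th p x := by
  unfold th
  rw [div_div_cancel₀ hp0, mul_comm]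

theorem th_mul_self (hp : ‖p‖ < 1) (hp0 : p ≠ 0) {x : ℂ} (hx : x ≠ 0) :
    th p (p * x) = -x⁻¹ * th p x := by
  rw [← th_inv hp hx, ← th_div_self hp0 x⁻¹, div_inv_eq_mul]

theorem qPoch_eq (p : ℂ) : qPoch p = Qf p p := by
  simp [qPoch, Qf, pow_succ]

theorem ellGamma_eq (hp : ‖p‖ < 1) (hq : ‖q‖ < 1) (x : ℂ) :
    ellGamma x p q = Ef p q (p * q / x) / Ef p q x := by
  by_cases h : ∀ j k : ℕ, p ^ j * q ^ k * x ≠ 1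
  · unfold ellGamma Ef
    rw [← Multipliable.tprod_div₀ (multipliable_Ef hp hq _) (multipliable_Ef hp hq x)]
    · congr 1; ext jk; congr 2; ring
    · exact Ef_ne_zero hp hq h
  · push Not at h
    obtain ⟨j, k, h⟩ := h
    have h1 : Ef p q x = 0 := tprod_of_exists_eq_zero ⟨(j, k), by simp [h]⟩
    have h2 : ellGamma x p q = 0 := tprod_of_exists_eq_zero ⟨(j, k), by simp [h]⟩
    rw [h1, h2, div_zero]

theorem ellGamma_shift (hp : ‖p‖ < 1) (hq : ‖q‖ < 1) (hq0 : q ≠ 0) {x : ℂ}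
    (h : Ef p q x ≠ 0) : ellGamma (q * x) p q = th p x * ellGamma x p q := by
  rw [ellGamma_eq hp hq, ellGamma_eq hp hq]
  have e1 : p * q / (q * x) = p / x := by rw [mul_comm p q, mul_div_mul_left _ _ hq0]
  have e2 := Ef_shift_right hp hq (p / x)
  have e3 := Ef_shift_right hp hq x
  have e4 : q * (p / x) = p * q / x := by ring
  rw [e4] at e2
  rw [e1, e2]
  have : Ef p q (q * x) ≠ 0 := fun h0 => h (by rw [e3, h0, mul_zero])
  have h3 : Qf p x ≠ 0 := fun h0 => h (by rw [e3, h0, zero_mul])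
  rw [th, e3]
  field_simp

theorem ellGamma_mul_reflect (hp : ‖p‖ < 1) (hq : ‖q‖ < 1) (hpq : p * q ≠ 0) {x : ℂ}
    (h1 : Ef p q x ≠ 0) (h2 : Ef p q (p * q / x) ≠ 0) :
    ellGamma x p q * ellGamma (p * q / x) p q = 1 := by
  rw [ellGamma_eq hp hq, ellGamma_eq hp hq, div_div_cancel₀ hpq]
  field_simp

theorem ellGamma_mul_inv (hp : ‖p‖ < 1) (hq : ‖q‖ < 1) {x : ℂ} (hx : ‖x‖ = 1) :
    (ellGamma x p q * ellGamma (1 / x) p q)⁻¹ = th p x * th q (1 / x) := by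
  have hx0 : x ≠ 0 := by intro h; simp [h] at hx
  have hpq : ‖p * q‖ < 1 := by
    rw [norm_mul]; exact mul_lt_one_of_nonneg_of_lt_one_left (norm_nonneg _) hp hq.le
  rw [ellGamma_eq hp hq, ellGamma_eq hp hq]
  have n1 : Ef p q (p * q * x) ≠ 0 := Ef_ne_zero_of_norm_lt hp hq (by rw [norm_mul, hx, mul_one]; exact hpq)
  have n2 : Ef p q (p * q / x) ≠ 0 := Ef_ne_zero_of_norm_lt hp hq (by rw [norm_div, hx, div_one]; exact hpq)
  have e1 : Ef p q x = Qf p x * (Qf q (q * x) * Ef p q (p * q * x)) := by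
    rw [Ef_shift_right hp hq x, Ef_shift_left hp hq (q * x), mul_assoc p]
  have e2 : Ef p q (1 / x) = Qf q (1 / x) * (Qf p (p / x) * Ef p q (p * q / x)) := by
    rw [Ef_shift_left hp hq (1 / x), Ef_shift_right hp hq (p * (1 / x))]
    congr 3 <;> ring
  have e3 : p * q / (1 / x) = p * q * x := by field_simp
  rw [e1, e2, e3, th, th]
  have e4 : q / (1 / x) = q * x := by field_simp
  rw [e4]
  rw [div_mul_div_comm, inv_div]
  rw [div_eq_iff (mul_ne_zero n2 n1)]
  ring

end

theorem hasProd_Ef_comp {X : Type*} [TopologicalSpace X] [LocallyCompactSpace X] {q : ℂ} {ρ R : ℝ}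
    (hρ0 : 0 ≤ ρ) (hρ : ρ < 1) (hq : ‖q‖ < 1) (P Y : X → ℂ) {K : Set X} (hK : IsOpen K)
    (hP : ContinuousOn P K) (hY : ContinuousOn Y K)
    (hPK : ∀ x ∈ K, ‖P x‖ ≤ ρ) (hYK : ∀ x ∈ K, ‖Y x‖ ≤ R) :
    TendstoLocallyUniformlyOn (fun (s : Finset (ℕ × ℕ)) x =>
      ∏ jk ∈ s, (1 - P x ^ jk.1 * q ^ jk.2 * Y x)) (fun x => Ef (P x) q (Y x)) Filter.atTop K := by
  have := Summable.hasProdLocallyUniformlyOn_one_add (K := K)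
    (f := fun (jk : ℕ × ℕ) x => -(P x ^ jk.1 * q ^ jk.2 * Y x))
    (u := fun jk => ρ ^ jk.1 * ‖q‖ ^ jk.2 * R) hK
    (summable_pow_mul_pow hρ0 hρ (norm_nonneg q) hq R)
    (Filter.Eventually.of_forall fun jk x hx => by
      rw [norm_neg, norm_mul, norm_mul, norm_pow, norm_pow]
      have := hPK x hx
      have := hYK x hx
      gcongr)
    (fun jk => by fun_prop)
  simpa [HasProdLocallyUniformlyOn, Ef, sub_eq_add_neg] using this

theorem continuousOn_Ef_joint {q : ℂ} (hq : ‖q‖ < 1) :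
    ContinuousOn (fun y : ℂ × ℂ => Ef y.1 q y.2) {y | ‖y.1‖ < 1} := by
  intro y hy
  obtain ⟨ρ, h1, h2⟩ := exists_between (show ‖y.1‖ < 1 from hy)
  have hρ0 : 0 ≤ ρ := (norm_nonneg _).trans h1.le
  let K : Set (ℂ × ℂ) := {z | ‖z.1‖ < ρ ∧ ‖z.2‖ < ‖y.2‖ + 1}
  have hK : IsOpen K := by
    have e1 : IsOpen {z : ℂ × ℂ | ‖z.1‖ < ρ} := isOpen_lt (by fun_prop) (by fun_prop)
    have e2 : IsOpen {z : ℂ × ℂ | ‖z.2‖ < ‖y.2‖ + 1} := isOpen_lt (by fun_prop) (by fun_prop)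
    exact e1.inter e2
  have := (hasProd_Ef_comp (X := ℂ × ℂ) (R := ‖y.2‖ + 1) hρ0 h2 hq Prod.fst Prod.snd hK
    continuousOn_fst continuousOn_snd (fun x hx => hx.1.le) (fun x hx => hx.2.le)).continuousOn
    (Filter.Frequently.of_forall fun s => by fun_prop)
  exact (this.continuousAt (hK.mem_nhds ⟨h1, by simp⟩)).continuousWithinAt

theorem continuousOn_Ef {X : Type*} [TopologicalSpace X] {q : ℂ} (hq : ‖q‖ < 1) {P Y : X → ℂ}
    {K : Set X} (hP : ContinuousOn P K) (hY : ContinuousOn Y K) (h : ∀ x ∈ K, ‖P x‖ < 1) :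
    ContinuousOn (fun x => Ef (P x) q (Y x)) K :=
  (continuousOn_Ef_joint hq).comp' (f := fun x => (P x, Y x)) (hP.prodMk hY) fun x hx => h x hx

theorem differentiableOn_Ef {q : ℂ} (hq : ‖q‖ < 1) {P Y : ℂ → ℂ}
    {U : Set ℂ} (hU : IsOpen U) (hP : DifferentiableOn ℂ P U) (hY : DifferentiableOn ℂ Y U)
    (h : ∀ x ∈ U, ‖P x‖ < 1) :
    DifferentiableOn ℂ (fun x => Ef (P x) q (Y x)) U := by
  intro y hy
  obtain ⟨ρ, h1, h2⟩ := exists_between (h y hy)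
  have hρ0 : 0 ≤ ρ := (norm_nonneg _).trans h1.le
  let K : Set ℂ := U ∩ {z | ‖P z‖ < ρ ∧ ‖Y z‖ < ‖Y y‖ + 1}
  have hK : IsOpen K := by
    have e1 := hP.continuousOn.norm.isOpen_inter_preimage hU (isOpen_Iio (a := ρ))
    have e2 := hY.continuousOn.norm.isOpen_inter_preimage hU (isOpen_Iio (a := ‖Y y‖ + 1))
    have := e1.inter e2
    convert this using 1
    ext z; simp [K]; tauto
  have := (hasProd_Ef_comp (X := ℂ) (R := ‖Y y‖ + 1) hρ0 h2 hq P Y hK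
    (hP.continuousOn.mono Set.inter_subset_left) (hY.continuousOn.mono Set.inter_subset_left)
    (fun x hx => hx.2.1.le) (fun x hx => hx.2.2.le)).differentiableOn
    (Filter.Eventually.of_forall fun s => by
      have hP' := hP.mono (Set.inter_subset_left : K ⊆ U)
      have hY' := hY.mono (Set.inter_subset_left : K ⊆ U)
      fun_prop) hK
  exact (this.differentiableAt (hK.mem_nhds ⟨hy, h1, by simp⟩)).differentiableWithinAt

theorem continuousOn_Qf {X : Type*} [TopologicalSpace X] {P Y : X → ℂ}
    {K : Set X} (hP : ContinuousOn P K) (hY : ContinuousOn Y K) (h : ∀ x ∈ K, ‖P x‖ < 1) :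
    ContinuousOn (fun x => Qf (P x) (Y x)) K :=
  (continuousOn_Ef (q := 0) (by simp) hP hY h).congr fun x hx => Qf_eq_Ef (h x hx) _

theorem differentiableOn_Qf {P Y : ℂ → ℂ}
    {U : Set ℂ} (hU : IsOpen U) (hP : DifferentiableOn ℂ P U) (hY : DifferentiableOn ℂ Y U)
    (h : ∀ x ∈ U, ‖P x‖ < 1) :
    DifferentiableOn ℂ (fun x => Qf (P x) (Y x)) U :=
  (differentiableOn_Ef (q := 0) (by simp) hU hP hY h).congr fun x hx => Qf_eq_Ef (h x hx) _

theorem differentiable_Qf {p : ℂ} (hp : ‖p‖ < 1) : Differentiable ℂ (Qf p) := by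
  rw [← differentiableOn_univ]
  exact differentiableOn_Qf isOpen_univ (by fun_prop) differentiableOn_id (fun _ _ => hp)

theorem differentiable_Ef {p q : ℂ} (hp : ‖p‖ < 1) (hq : ‖q‖ < 1) : Differentiable ℂ (Ef p q) := by
  rw [← differentiableOn_univ]
  exact differentiableOn_Ef hq isOpen_univ (by fun_prop) differentiableOn_id (fun _ _ => hp)

theorem differentiableAt_th {p x : ℂ} (hp : ‖p‖ < 1) (hx : x ≠ 0) :
    DifferentiableAt ℂ (th p) x := by
  unfold th
  have h1 := (differentiable_Qf hp).differentiableAt (x := x)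
  have h2 : DifferentiableAt ℂ (fun x => Qf p (p / x)) x :=
    DifferentiableAt.comp x (differentiable_Qf hp).differentiableAt (by fun_prop (disch := assumption))
  exact h1.mul h2

/-- The point `e^{iθ}` of the unit circle. -/
noncomputable def cx (θ : ℝ) : ℂ := Complex.exp (Complex.I * θ)

theorem norm_cx (θ : ℝ) : ‖cx θ‖ = 1 := by
  rw [cx, mul_comm, Complex.norm_exp_ofReal_mul_I]

theorem cx_ne_zero (θ : ℝ) : cx θ ≠ 0 := Complex.exp_ne_zero _

theorem continuous_cx : Continuous cx := by unfold cx; fun_prop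

theorem cx_add (a b : ℝ) : cx (a + b) = cx a * cx b := by
  rw [cx, cx, cx, ← Complex.exp_add]; congr 1; push_cast; ring

theorem cx_neg (a : ℝ) : cx (-a) = (cx a)⁻¹ := by
  rw [cx, cx, ← Complex.exp_neg]; congr 1; push_cast; ring

theorem cx_two_pi : cx (2 * π) = 1 := by
  rw [cx, show Complex.I * ((2 * π : ℝ) : ℂ) = 2 * π * Complex.I by push_cast; ring,
    Complex.exp_two_pi_mul_I]

theorem periodic_cx : Function.Periodic cx (2 * π) := fun θ => by rw [cx_add, cx_two_pi, mul_one]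

theorem exists_cx_eq {z : ℂ} (hz : ‖z‖ = 1) : ∃ θ : ℝ, cx θ = z := by
  obtain ⟨θ, h⟩ := (Complex.norm_eq_one_iff z).1 hz
  exact ⟨θ, by rw [cx, mul_comm, h]⟩

/-- Invariance of the mean over a circle under rotation. -/
theorem integral_cx_rotate (G : ℂ → ℂ) (a : ℝ) :
    ∫ φ in (0 : ℝ)..2 * π, G (cx a * cx φ) = ∫ φ in (0 : ℝ)..2 * π, G (cx φ) := by
  simp_rw [← cx_add]
  rw [intervalIntegral.integral_comp_add_left (fun x => G (cx x))]
  have h : Function.Periodic (fun x => G (cx x)) (2 * π) := fun x =>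
    congrArg G (periodic_cx x)
  have := h.intervalIntegral_add_eq a 0
  simpa using this

theorem integral_cx_inv (G : ℂ → ℂ) :
    ∫ φ in (0 : ℝ)..2 * π, G (cx φ)⁻¹ = ∫ φ in (0 : ℝ)..2 * π, G (cx φ) := by
  simp_rw [← cx_neg]
  rw [intervalIntegral.integral_comp_neg (fun x => G (cx x))]
  have h : Function.Periodic (fun x => G (cx x)) (2 * π) := fun x =>
    congrArg G (periodic_cx x)
  have := h.intervalIntegral_add_eq (-(2 * π)) 0
  simpa using this

/-- The mean over circles is constant in an annulus of analyticity. -/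
theorem integral_annulus_real {G : ℂ → ℂ} {a b : ℝ}
    (hG : DifferentiableOn ℂ G {z | a < ‖z‖ ∧ ‖z‖ < b}) {r R : ℝ} (hr0 : 0 < r)
    (har : a < r) (hrR : r ≤ R) (hRb : R < b) :
    ∫ φ in (0 : ℝ)..2 * π, G (R * cx φ) = ∫ φ in (0 : ℝ)..2 * π, G (r * cx φ) := by
  have hU : IsOpen {z : ℂ | a < ‖z‖ ∧ ‖z‖ < b} :=
    (isOpen_lt continuous_const continuous_norm).inter (isOpen_lt continuous_norm continuous_const)
  have key := Complex.circleIntegral_sub_center_inv_smul_eq_of_differentiable_on_annulus_off_countable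
    (c := 0) hr0 hrR (f := G) (s := ∅) Set.countable_empty
    (hG.continuousOn.mono fun z hz => by
      simp only [Set.mem_sdiff, Metric.mem_closedBall, Metric.mem_ball, dist_zero_right, not_lt] at hz
      exact ⟨har.trans_le hz.2, hz.1.trans_lt hRb⟩)
    (fun z hz => by
      simp only [Set.mem_sdiff, Metric.mem_closedBall, Metric.mem_ball, dist_zero_right, not_le] at hz
      exact (hG z ⟨har.trans hz.1.2, hz.1.1.trans hRb⟩).differentiableAt
        (hU.mem_nhds ⟨har.trans hz.1.2, hz.1.1.trans hRb⟩))
  have conv : ∀ ρ : ℝ, 0 < ρ → (∮ z in C(0, ρ), (z - 0)⁻¹ • G z) =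
      Complex.I * ∫ φ in (0 : ℝ)..2 * π, G (ρ * cx φ) := by
    intro ρ hρ
    rw [circleIntegral, ← intervalIntegral.integral_const_mul]
    refine intervalIntegral.integral_congr fun φ _ => ?_
    have h1 : circleMap 0 ρ φ = ρ * cx φ := by
      rw [circleMap, zero_add, cx, mul_comm (φ : ℂ)]
    have h2 : (ρ : ℂ) * cx φ ≠ 0 := mul_ne_zero (by exact_mod_cast hρ.ne') (cx_ne_zero φ)
    simp only [deriv_circleMap, h1, sub_zero, smul_eq_mul]
    rw [mul_comm _ Complex.I, mul_assoc, mul_inv_cancel_left₀ h2]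
  rw [conv r hr0, conv R (hr0.trans_le hrR)] at key
  exact mul_left_cancel₀ Complex.I_ne_zero key

theorem integral_annulus_one {G : ℂ → ℂ} {a b : ℝ}
    (hG : DifferentiableOn ℂ G {z | a < ‖z‖ ∧ ‖z‖ < b}) {w : ℂ} (hw : w ≠ 0) (haw : a < ‖w‖)
    (hwb : ‖w‖ < b) (ha : a < 1) (hb : 1 < b) :
    ∫ φ in (0 : ℝ)..2 * π, G (w * cx φ) = ∫ φ in (0 : ℝ)..2 * π, G (cx φ) := by
  obtain ⟨θ, hθ⟩ := exists_cx_eq (z := w / ‖w‖) (by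
    rw [norm_div, Complex.norm_real, norm_norm, div_self (norm_ne_zero_iff.2 hw)])
  have hn : (‖w‖ : ℂ) ≠ 0 := by exact_mod_cast norm_ne_zero_iff.2 hw
  have e1 : ∀ φ, w * cx φ = ‖w‖ * (cx θ * cx φ) := fun φ => by rw [hθ]; field_simp
  simp_rw [e1]
  rw [integral_cx_rotate (fun z => G (‖w‖ * z))]
  have hw0 := norm_pos_iff.2 hw
  rcases le_total 1 ‖w‖ with h | h
  · have := integral_annulus_real hG one_pos ha h hwb
    simpa using this
  · have := integral_annulus_real hG hw0 haw h hb
    simpa using this.symm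

/-- A continuous function on the circle all of whose Fourier coefficients vanish is zero. -/
theorem eq_zero_of_fourier {F : ℂ → ℂ} (hF : ContinuousOn F (Metric.sphere 0 1))
    (h : ∀ n : ℤ, ∫ φ in (0 : ℝ)..2 * π, F (cx φ) * cx φ ^ n = 0) {z : ℂ} (hz : ‖z‖ = 1) :
    F z = 0 := by
  have : Fact (0 < 2 * π) := ⟨Real.two_pi_pos⟩
  have hc : ∀ x : ℝ, ((AddCircle.toCircle (x : AddCircle (2 * π)) : Circle) : ℂ) = cx x := by
    intro x
    rw [AddCircle.toCircle_apply_mk, Circle.coe_exp, cx, mul_comm Complex.I]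
    congr 2; push_cast; field_simp
  let f : C(AddCircle (2 * π), ℂ) :=
    ⟨fun x => F (AddCircle.toCircle x : Circle), by
      refine hF.comp_continuous (by fun_prop) fun x => ?_
      rw [mem_sphere_zero_iff_norm]; exact Circle.norm_coe _⟩
  have hf : ∀ n, fourierCoeff f n = 0 := by
    intro n
    rw [fourierCoeff_eq_intervalIntegral _ n 0, zero_add]
    have : ∀ x : ℝ, (@fourier (2 * π) (-n) x • f x : ℂ) = F (cx x) * cx x ^ (-n) := by
      intro x
      have h1 : f (x : AddCircle (2 * π)) = F (cx x) := by
        change F _ = _; rw [hc]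
      rw [h1, fourier_coe_apply, smul_eq_mul, mul_comm, cx, ← Complex.exp_int_mul]
      congr 2
      have : (π : ℂ) ≠ 0 := by exact_mod_cast Real.pi_ne_zero
      push_cast
      field_simp
    simp_rw [this, h, smul_zero]
  obtain ⟨θ, rfl⟩ := exists_cx_eq hz
  have := has_pointwise_sum_fourier_series_of_summable (f := f)
    (by rw [show fourierCoeff (f : AddCircle (2 * π) → ℂ) = 0 from funext hf]; exact summable_zero)
    (θ : AddCircle (2 * π))
  simp only [hf, zero_smul] at this
  have h2 := this.unique hasSum_zero
  have h1 : f (θ : AddCircle (2 * π)) = F (cx θ) := by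
    change F _ = _; rw [hc]
  rw [← h1, h2]

/-- A holomorphic function on `ℂ \ {0}` with `f (p x) = K x⁻² f x` is determined by two of its
Laurent coefficients. -/
theorem eq_zero_of_quasi_periodic {p K : ℂ} (hp : p ≠ 0) (hK : K ≠ 0) {f : ℂ → ℂ}
    (hf : ∀ z, z ≠ 0 → DifferentiableAt ℂ f z) (hq : ∀ z, z ≠ 0 → z ^ 2 * f (p * z) = K * f z)
    (h0 : ∫ φ in (0 : ℝ)..2 * π, f (cx φ) = 0)
    (h1 : ∫ φ in (0 : ℝ)..2 * π, f (cx φ) * cx φ = 0) {z : ℂ} (hz : z ≠ 0) : f z = 0 := by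
  have hd : ∀ n : ℤ, ∀ a b : ℝ, 0 ≤ a →
      DifferentiableOn ℂ (fun z => f z * z ^ n) {z | a < ‖z‖ ∧ ‖z‖ < b} := by
    intro n a b ha z hz
    have hz0 : z ≠ 0 := norm_pos_iff.1 (ha.trans_lt hz.1)
    exact ((hf z hz0).mul (differentiableAt_zpow.2 (Or.inl hz0))).differentiableWithinAt
  have hmean : ∀ n : ℤ, ∀ w : ℂ, w ≠ 0 →
      ∫ φ in (0 : ℝ)..2 * π, f (w * cx φ) * (w * cx φ) ^ n =
      ∫ φ in (0 : ℝ)..2 * π, f (cx φ) * cx φ ^ n := by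
    intro n w hw
    exact integral_annulus_one (G := fun z => f z * z ^ n) (hd n 0 (‖w‖ + 2) le_rfl) hw
      (norm_pos_iff.2 hw) (by linarith) one_pos (by linarith [norm_nonneg w])
  have step : ∀ n : ℤ, (∫ φ in (0 : ℝ)..2 * π, f (cx φ) * cx φ ^ n) = 0 ↔
      (∫ φ in (0 : ℝ)..2 * π, f (cx φ) * cx φ ^ (n - 2)) = 0 := by
    intro n
    rw [← hmean n p hp]
    have : ∀ φ, f (p * cx φ) * (p * cx φ) ^ n = K * p ^ n * (f (cx φ) * cx φ ^ (n - 2)) := by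
      intro φ
      have hz := cx_ne_zero φ
      have := hq _ hz
      rw [mul_zpow, zpow_sub₀ hz, show (cx φ) ^ (2 : ℤ) = cx φ ^ 2 from zpow_natCast _ 2]
      field_simp
      linear_combination this
    simp_rw [this]
    rw [intervalIntegral.integral_const_mul]
    simp [hK, hp, zpow_ne_zero]
  have all : ∀ n : ℤ, (∫ φ in (0 : ℝ)..2 * π, f (cx φ) * cx φ ^ n) = 0 ∧
      (∫ φ in (0 : ℝ)..2 * π, f (cx φ) * cx φ ^ (n + 1)) = 0 := by
    intro n
    induction n using Int.induction_on with
    | zero => simpa using ⟨h0, h1⟩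
    | succ i ih =>
      refine ⟨ih.2, ?_⟩
      have := (step (i + 1 + 1)).2 (by convert ih.1 using 5; ring)
      exact this
    | pred i ih =>
      refine ⟨?_, by simpa using ih.1⟩
      have := (step (-i + 1)).1 ih.2
      convert this using 5; ring
  have hr : (‖z‖ : ℂ) ≠ 0 := by exact_mod_cast norm_ne_zero_iff.2 hz
  have := eq_zero_of_fourier (F := fun w => f (‖z‖ * w)) (fun w hw => by
      have hw0 : w ≠ 0 := by rintro rfl; simp at hw
      have h1 := (hf (‖z‖ * w) (mul_ne_zero hr hw0)).continuousAt
      exact (ContinuousAt.comp' (f := fun w => (‖z‖ : ℂ) * w) h1 (by fun_prop)).continuousWithinAt)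
    (fun n => by
      have := (hmean n ‖z‖ hr).trans (all n).1
      simp_rw [mul_zpow, ← mul_assoc, mul_comm _ ((‖z‖ : ℂ) ^ n), mul_assoc] at this
      rw [intervalIntegral.integral_const_mul] at this
      exact (mul_eq_zero.1 this).resolve_left (zpow_ne_zero _ hr))
    (z := z / ‖z‖) (by rw [norm_div, Complex.norm_real, norm_norm, div_self (norm_ne_zero_iff.2 hz)])
  simpa [mul_div_cancel₀ _ hr] using this

theorem exists_pow_of_Qf_eq_zero {p : ℂ} (hp : ‖p‖ < 1) {x : ℂ} (h : Qf p x = 0) :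
    ∃ j : ℕ, p ^ j * x = 1 := by
  by_contra! hc
  exact Qf_ne_zero hp hc h

theorem exists_zpow_of_th_eq_zero {p : ℂ} (hp : ‖p‖ < 1) {x : ℂ}
    (h : th p x = 0) : ∃ k : ℤ, x = p ^ k := by
  rcases mul_eq_zero.1 h with h | h
  · obtain ⟨j, hj⟩ := exists_pow_of_Qf_eq_zero hp h
    refine ⟨-j, ?_⟩
    rw [zpow_neg, zpow_natCast]
    exact eq_inv_of_mul_eq_one_right hj
  · obtain ⟨j, hj⟩ := exists_pow_of_Qf_eq_zero hp h
    refine ⟨j + 1, ?_⟩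
    have hx : x ≠ 0 := by rintro rfl; simp at hj
    field_simp at hj
    rw [← hj, ← Nat.cast_succ, zpow_natCast, pow_succ]

theorem th_zpow {p : ℂ} (hp : ‖p‖ < 1) (hp0 : p ≠ 0) (k : ℤ) : th p (p ^ k) = 0 := by
  induction k using Int.induction_on with
  | zero => simp [th_one]
  | succ i ih =>
    rw [zpow_add₀ hp0, zpow_one, mul_comm, th_mul_self hp hp0 (zpow_ne_zero _ hp0), ih, mul_zero]
  | pred i ih =>
    have h := th_mul_self hp hp0 (x := p ^ (-(i : ℤ) - 1)) (zpow_ne_zero _ hp0)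
    rw [← zpow_one_add₀ hp0, show (1 : ℤ) + (-i - 1) = -i by ring, ih] at h
    exact (mul_eq_zero.1 h.symm).resolve_left (neg_ne_zero.2 (inv_ne_zero (zpow_ne_zero _ hp0)))

/-- The product `θ(x/y)θ(x/y')`. -/
noncomputable def thp (p y y' x : ℂ) : ℂ := th p (x / y) * th p (x / y')

section
variable {p : ℂ}

theorem thp_quasi (hp : ‖p‖ < 1) (hp0 : p ≠ 0) {y y' x : ℂ} (hy : y ≠ 0) (hy' : y' ≠ 0)
    (hx : x ≠ 0) : x ^ 2 * thp p y y' (p * x) = y * y' * thp p y y' x := by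
  unfold thp
  rw [mul_div_assoc, mul_div_assoc, th_mul_self hp hp0 (div_ne_zero hx hy),
    th_mul_self hp hp0 (div_ne_zero hx hy')]
  field_simp

theorem differentiableAt_thp (hp : ‖p‖ < 1) {y y' x : ℂ} (hy : y ≠ 0) (hy' : y' ≠ 0)
    (hx : x ≠ 0) : DifferentiableAt ℂ (thp p y y') x := by
  unfold thp
  exact (DifferentiableAt.comp x (f := fun x => x / y) (differentiableAt_th hp (div_ne_zero hx hy))
    (by fun_prop)).mul (DifferentiableAt.comp x (f := fun x => x / y')
    (differentiableAt_th hp (div_ne_zero hx hy')) (by fun_prop))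

/-- Three products `θ(x/y)θ(x/y')` with the same `y y'` are linearly dependent. -/
theorem thp_dependent (hp : ‖p‖ < 1) (hp0 : p ≠ 0) {Y : ℂ} {b b' c c' d d' : ℂ}
    (hY : Y ≠ 0) (hb : b * b' = Y) (hc : c * c' = Y) (hd : d * d' = Y) :
    ∃ α β γ : ℂ, (α ≠ 0 ∨ β ≠ 0 ∨ γ ≠ 0) ∧
      ∀ x, x ≠ 0 → α * thp p b b' x + β * thp p c c' x + γ * thp p d d' x = 0 := by
  have nz : ∀ {u v : ℂ}, u * v = Y → u ≠ 0 ∧ v ≠ 0 := fun h =>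
    ⟨left_ne_zero_of_mul (h ▸ hY), right_ne_zero_of_mul (h ▸ hY)⟩
  have hdiff : ∀ {u v : ℂ}, u * v = Y → ∀ x, x ≠ 0 → DifferentiableAt ℂ (thp p u v) x :=
    fun h x hx => differentiableAt_thp hp (nz h).1 (nz h).2 hx
  have hcont : ∀ {u v : ℂ}, u * v = Y → Continuous fun φ : ℝ => thp p u v (cx φ) := fun h =>
    continuous_iff_continuousAt.2 fun φ =>
      ((hdiff h _ (cx_ne_zero φ)).continuousAt).comp continuous_cx.continuousAt
  let A : ℂ → ℂ → ℂ := fun u v => ∫ φ in (0 : ℝ)..2 * π, thp p u v (cx φ)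
  let B : ℂ → ℂ → ℂ := fun u v => ∫ φ in (0 : ℝ)..2 * π, thp p u v (cx φ) * cx φ
  obtain ⟨v, hv, hMv⟩ := Matrix.exists_mulVec_eq_zero_iff.2
    (show (!![A b b', A c c', A d d'; B b b', B c c', B d d'; 0, 0, 0]).det = 0 by
      simp [Matrix.det_fin_three])
  refine ⟨v 0, v 1, v 2, ?_, ?_⟩
  · by_contra! h
    exact hv (funext fun i => by fin_cases i <;> simp [h])
  have e0 := congrFun hMv 0
  have e1 := congrFun hMv 1
  simp [Matrix.mulVec, dotProduct, Fin.sum_univ_three] at e0 e1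
  intro x hx
  refine eq_zero_of_quasi_periodic (K := Y) hp0 hY
    (f := fun x => v 0 * thp p b b' x + v 1 * thp p c c' x + v 2 * thp p d d' x) ?_ ?_ ?_ ?_ hx
  · intro z hz
    have := hdiff hb z hz
    have := hdiff hc z hz
    have := hdiff hd z hz
    fun_prop
  · intro z hz
    have h1 := thp_quasi hp hp0 (nz hb).1 (nz hb).2 hz
    have h2 := thp_quasi hp hp0 (nz hc).1 (nz hc).2 hz
    have h3 := thp_quasi hp hp0 (nz hd).1 (nz hd).2 hz
    rw [hb] at h1; rw [hc] at h2; rw [hd] at h3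
    linear_combination v 0 * h1 + v 1 * h2 + v 2 * h3
  · have i1 := (hcont hb).intervalIntegrable (μ := volume) 0 (2 * π)
    have i2 := (hcont hc).intervalIntegrable (μ := volume) 0 (2 * π)
    have i3 := (hcont hd).intervalIntegrable (μ := volume) 0 (2 * π)
    rw [intervalIntegral.integral_add ((i1.const_mul _).add (i2.const_mul _)) (i3.const_mul _),
      intervalIntegral.integral_add (i1.const_mul _) (i2.const_mul _)]
    simp only [intervalIntegral.integral_const_mul]
    linear_combination e0
  · have hi : ∀ {u v : ℂ}, u * v = Y →
        IntervalIntegrable (fun φ => thp p u v (cx φ) * cx φ) volume 0 (2 * π) := fun h =>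
      ((hcont h).mul continuous_cx).intervalIntegrable (μ := volume) 0 (2 * π)
    have i1 := hi hb
    have i2 := hi hc
    have i3 := hi hd
    simp only [add_mul, mul_assoc]
    rw [intervalIntegral.integral_add ((i1.const_mul _).add (i2.const_mul _)) (i3.const_mul _),
      intervalIntegral.integral_add (i1.const_mul _) (i2.const_mul _)]
    simp only [intervalIntegral.integral_const_mul]
    linear_combination e1

/-- The antisymmetric bracket `a⁻¹ θ(ab)θ(a/b)`. -/
noncomputable def br (p a b : ℂ) : ℂ := a⁻¹ * (th p (a * b) * th p (a / b))

theorem br_self (a : ℂ) (ha : a ≠ 0) : br p a a = 0 := by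
  rw [br, div_self ha, th_one, mul_zero, mul_zero]

theorem br_antisymm (hp : ‖p‖ < 1) {a b : ℂ} (ha : a ≠ 0) (hb : b ≠ 0) :
    br p b a = -br p a b := by
  unfold br
  rw [← inv_div a b, th_inv hp (div_ne_zero ha hb), mul_comm b a]
  field_simp

theorem br_plucker (hp : ‖p‖ < 1) (hp0 : p ≠ 0) {a b c d : ℂ} (ha : a ≠ 0) (hb : b ≠ 0)
    (hc : c ≠ 0) (hd : d ≠ 0) :
    br p a b * br p c d - br p a c * br p b d + br p a d * br p b c = 0 := by
  obtain ⟨α, β, γ, h0, h⟩ := thp_dependent (p := p) hp hp0 one_ne_zero (inv_mul_cancel₀ hb)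
    (inv_mul_cancel₀ hc) (inv_mul_cancel₀ hd)
  have hbr : ∀ x u, x ≠ 0 → thp p u⁻¹ u x = x * br p x u := by
    intro x u hx
    rw [thp, br, div_inv_eq_mul]; field_simp
  have h' : ∀ x, x ≠ 0 → α * br p x b + β * br p x c + γ * br p x d = 0 := by
    intro x hx
    have := h x hx
    rw [hbr x b hx, hbr x c hx, hbr x d hx] at this
    have h2 : x * (α * br p x b + β * br p x c + γ * br p x d) = 0 := by linear_combination this
    exact (mul_eq_zero.1 h2).resolve_left hx
  have ea := h' a ha
  have eb := h' b hb
  have ec := h' c hc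
  have ed := h' d hd
  rw [br_self b hb] at eb
  rw [br_self c hc, br_antisymm hp hb hc] at ec
  rw [br_self d hd, br_antisymm hp hb hd, br_antisymm hp hc hd] at ed
  by_cases hα : α = 0
  · by_cases hβ : β = 0
    · have hγ : γ ≠ 0 := by simpa [hα, hβ] using h0
      apply mul_left_cancel₀ (mul_ne_zero hγ hγ)
      subst hα hβ
      linear_combination (γ * br p b c) * ea + (-γ * br p a c) * eb + (γ * br p a b) * ec
    · apply mul_left_cancel₀ (mul_ne_zero hβ hβ)
      subst hα
      linear_combination (-β * br p b d) * ea + (β * br p a d) * eb + (-β * br p a b) * ed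
  · apply mul_left_cancel₀ (mul_ne_zero hα hα)
    linear_combination (α * br p c d) * ea + (-α * br p a d) * ec + (α * br p a c) * ed

/-- Lagrange-type vanishing identity for the bracket. -/
theorem sum_br_eq_zero (hp : ‖p‖ < 1) (hp0 : p ≠ 0) {ι : Type*} [DecidableEq ι] {t : ι → ℂ}
    (ht : ∀ r, t r ≠ 0) (n : ℕ) : ∀ (S : Finset ι) (_ : S.card = n + 2)
    (_ : ∀ r ∈ S, ∀ s ∈ S, r ≠ s → br p (t r) (t s) ≠ 0) (z : Fin n → ℂ) (_ : ∀ i, z i ≠ 0),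
    ∑ r ∈ S, (∏ i, br p (t r) (z i)) / ∏ s ∈ S.erase r, br p (t r) (t s) = 0 := by
  induction n with
  | zero =>
    intro S hS hne z _
    obtain ⟨a, b, hab, rfl⟩ := Finset.card_eq_two.1 hS
    have h1 := hne a (by simp) b (by simp) hab
    have e1 : ({a, b} : Finset ι).erase a = {b} := by
      ext x; simp; grind
    have e2 : ({a, b} : Finset ι).erase b = {a} := by
      ext x; simp; grind
    rw [Finset.sum_pair hab, e1, e2]
    simp only [Finset.univ_eq_empty, Finset.prod_empty, Finset.prod_singleton]
    rw [br_antisymm hp (ht a) (ht b)]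
    field_simp
    ring
  | succ n ih =>
    intro S hS hne z hz
    obtain ⟨a, ha, b, hb, hab⟩ := Finset.one_lt_card.1 (by omega : 1 < S.card)
    have hab' := hne a ha b hb hab
    have key : ∀ c ∈ S, ∑ r ∈ S, ((∏ i : Fin n, br p (t r) (z i.castSucc)) * br p (t r) (t c)) /
        ∏ s ∈ S.erase r, br p (t r) (t s) = 0 := by
      intro c hc
      rw [← Finset.add_sum_erase S _ hc, br_self _ (ht c), mul_zero, zero_div, zero_add]
      rw [← ih (S.erase c) (by rw [Finset.card_erase_of_mem hc]; omega)
        (fun r hr s hs hrs => hne r (Finset.mem_of_mem_erase hr) s (Finset.mem_of_mem_erase hs) hrs)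
        (fun i => z i.castSucc) (fun i => hz _)]
      refine Finset.sum_congr rfl fun r hr => ?_
      have hrc := Finset.ne_of_mem_erase hr
      have hrS := Finset.mem_of_mem_erase hr
      rw [Finset.erase_right_comm,
        ← Finset.mul_prod_erase (S.erase r) _ (Finset.mem_erase.2 ⟨hrc.symm, hc⟩), mul_comm]
      rw [mul_div_mul_left _ _ (hne r hrS c hc hrc)]
    have ka := key a ha
    have kb := key b hb
    set y := z (Fin.last n)
    have hy : y ≠ 0 := hz _
    have e : ∀ r, br p (t r) y = (br p y (t b) / br p (t a) (t b)) * br p (t r) (t a) -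
        (br p y (t a) / br p (t a) (t b)) * br p (t r) (t b) := by
      intro r
      have := br_plucker hp hp0 (ht r) hy (ht a) (ht b)
      field_simp
      linear_combination this
    simp only [Fin.prod_univ_castSucc]
    change ∑ r ∈ S, ((∏ i : Fin n, br p (t r) (z i.castSucc)) * br p (t r) y) / _ = 0
    calc _ = (br p y (t b) / br p (t a) (t b)) * ∑ r ∈ S, ((∏ i : Fin n, br p (t r) (z i.castSucc))
            * br p (t r) (t a)) / ∏ s ∈ S.erase r, br p (t r) (t s)
          - (br p y (t a) / br p (t a) (t b)) * ∑ r ∈ S, ((∏ i : Fin n, br p (t r) (z i.castSucc))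
            * br p (t r) (t b)) / ∏ s ∈ S.erase r, br p (t r) (t s) := by
          rw [Finset.mul_sum, Finset.mul_sum, ← Finset.sum_sub_distrib]
          refine Finset.sum_congr rfl fun r _ => ?_
          rw [e r]; ring
      _ = 0 := by rw [ka, kb]; ring

/-- Partial fraction identity for theta functions of type `A`. -/
theorem sum_th_eq_zero (hp : ‖p‖ < 1) (hp0 : p ≠ 0) {ι : Type*} [DecidableEq ι] {x : ι → ℂ}
    (hx : ∀ r, x r ≠ 0) (n : ℕ) : ∀ (S : Finset ι) (_ : S.card = n + 1)
    (_ : ∀ r ∈ S, ∀ s ∈ S, r ≠ s → th p (x r / x s) ≠ 0) (y : Fin (n + 1) → ℂ) (_ : ∀ i, y i ≠ 0)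
    (_ : ∏ r ∈ S, x r = ∏ i, y i),
    ∑ r ∈ S, (∏ i, th p (x r / y i)) / ∏ s ∈ S.erase r, th p (x r / x s) = 0 := by
  induction n with
  | zero =>
    intro S hS hne y hy h
    obtain ⟨a, rfl⟩ := Finset.card_eq_one.1 hS
    simp at h
    simp [h, div_self (hy 0), th_one]
  | succ n ih =>
    intro S hS hne y hy h
    rcases n with _ | n
    · obtain ⟨a, b, hab, rfl⟩ := Finset.card_eq_two.1 hS
      have h1 := hne a (by simp) b (by simp) hab
      have e1 : ({a, b} : Finset ι).erase a = {b} := by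
        ext x; simp; grind
      have e2 : ({a, b} : Finset ι).erase b = {a} := by
        ext x; simp; grind
      have hp2 : ∀ f : Fin (0 + 1 + 1) → ℂ, ∏ i, f i = f 0 * f 1 := fun f => Fin.prod_univ_two f
      have ha := hx a
      have hb := hx b
      have h0 := hy 0
      have h1' := hy 1
      rw [Finset.prod_pair hab, hp2] at h
      rw [Finset.sum_pair hab, e1, e2]
      simp only [hp2, Finset.prod_singleton]
      have f1 : x b / y 0 = (x a / y 1)⁻¹ := by
        rw [inv_div, div_eq_div_iff h0 ha]; linear_combination h
      have f2 : x b / y 1 = (x a / y 0)⁻¹ := by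
        rw [inv_div, div_eq_div_iff h1' ha]; linear_combination h
      rw [f1, f2, ← inv_div (x a) (x b), th_inv hp (div_ne_zero ha h1'),
        th_inv hp (div_ne_zero ha h0), th_inv hp (div_ne_zero ha hb)]
      field_simp
      have hY : y 1 = x a * x b / y 0 := by rw [eq_div_iff h0]; linear_combination -h
      rw [hY]
      field_simp
      ring
    · set Y := y 0 * y 1 with hY
      have hY0 : Y ≠ 0 := mul_ne_zero (hy 0) (hy 1)
      obtain ⟨a, ha, b, hb, hab, hgood⟩ : ∃ a ∈ S, ∃ b ∈ S, a ≠ b ∧ th p (x a * x b / Y) ≠ 0 := by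
        obtain ⟨a, ha, b, hb, c, hc, hab, hac, hbc⟩ := Finset.two_lt_card.1 (by omega : 2 < S.card)
        by_contra! hcon
        obtain ⟨k, hk⟩ := exists_zpow_of_th_eq_zero hp (hcon a ha b hb hab)
        obtain ⟨l, hl⟩ := exists_zpow_of_th_eq_zero hp (hcon a ha c hc hac)
        refine hne b hb c hc hbc ?_
        have : x b / x c = p ^ (k - l) := by
          rw [zpow_sub₀ hp0, ← hk, ← hl]
          have := hx a; have := hx c
          field_simp
        rw [this, th_zpow hp hp0]
      have hxa := hx a
      have hxb := hx b
      obtain ⟨α, β, γ, h0, hdep⟩ := thp_dependent (p := p) hp hp0 hY0 hY.symm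
        (mul_div_cancel₀ Y hxa) (mul_div_cancel₀ Y hxb)
      have ea := hdep (x a) hxa
      have eb := hdep (x b) hxb
      have v1 : thp p (x a) (Y / x a) (x a) = 0 := by simp [thp, div_self hxa, th_one]
      have v2 : thp p (x b) (Y / x b) (x b) = 0 := by simp [thp, div_self hxb, th_one]
      have v3 : thp p (x b) (Y / x b) (x a) ≠ 0 := by
        rw [thp, div_div_eq_mul_div]
        exact mul_ne_zero (hne a ha b hb hab) hgood
      have v4 : thp p (x a) (Y / x a) (x b) ≠ 0 := by
        rw [thp, div_div_eq_mul_div, mul_comm (x b)]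
        exact mul_ne_zero (hne b hb a ha hab.symm) hgood
      have hα : α ≠ 0 := by
        rintro rfl
        have hγ : γ = 0 := by simpa [v1, v3] using ea
        have hβ : β = 0 := by simpa [v2, v4] using eb
        simp [hγ, hβ] at h0
      have key : ∀ c ∈ S, ∑ r ∈ S, (thp p (x c) (Y / x c) (x r) *
          ∏ i : Fin (n + 1), th p (x r / y i.succ.succ)) / ∏ s ∈ S.erase r, th p (x r / x s) = 0 := by
        intro c hc
        have hxc := hx c
        rw [← Finset.add_sum_erase S _ hc]
        rw [show thp p (x c) (Y / x c) (x c) = 0 by simp [thp, div_self hxc, th_one], zero_mul,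
          zero_div, zero_add]
        rw [← ih (S.erase c) (by rw [Finset.card_erase_of_mem hc]; omega)
          (fun r hr s hs hrs => hne r (Finset.mem_of_mem_erase hr) s (Finset.mem_of_mem_erase hs) hrs)
          (Fin.cons (Y / x c) fun i => y i.succ.succ)
          (fun i => by
            refine Fin.cases ?_ (fun i => ?_) i
            · simpa using ⟨hY0, hxc⟩
            · simpa using hy _)
          (by
            rw [Fin.prod_univ_succ, Fin.prod_univ_succ, ← Finset.mul_prod_erase S _ hc] at h
            rw [Fin.prod_univ_succ]
            simp only [Fin.cons_zero, Fin.cons_succ]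
            apply mul_left_cancel₀ hxc
            rw [h, hY, ← mul_assoc (x c), mul_div_cancel₀ _ hxc]
            simp only [Fin.succ_zero_eq_one]
            ring)]
        refine Finset.sum_congr rfl fun r hr => ?_
        have hrc := Finset.ne_of_mem_erase hr
        have hrS := Finset.mem_of_mem_erase hr
        rw [Finset.erase_right_comm,
          ← Finset.mul_prod_erase (S.erase r) _ (Finset.mem_erase.2 ⟨hrc.symm, hc⟩),
          Fin.prod_univ_succ (n := n + 1)]
        simp only [Fin.cons_zero, Fin.cons_succ]
        rw [thp, mul_assoc, mul_div_mul_left _ _ (hne r hrS c hc hrc)]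
      have ka := key a ha
      have kb := key b hb
      have e : ∀ r, thp p (y 0) (y 1) (x r) = -(β / α) * thp p (x a) (Y / x a) (x r) -
          (γ / α) * thp p (x b) (Y / x b) (x r) := by
        intro r
        have := hdep (x r) (hx r)
        field_simp
        linear_combination this
      calc _ = ∑ r ∈ S, (thp p (y 0) (y 1) (x r) *
          ∏ i : Fin (n + 1), th p (x r / y i.succ.succ)) / ∏ s ∈ S.erase r, th p (x r / x s) := by
            refine Finset.sum_congr rfl fun r _ => ?_
            rw [Fin.prod_univ_succ, Fin.prod_univ_succ, thp]
            simp only [Fin.succ_zero_eq_one]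
            ring
        _ = -(β / α) * (∑ r ∈ S, (thp p (x a) (Y / x a) (x r) *
          ∏ i : Fin (n + 1), th p (x r / y i.succ.succ)) / ∏ s ∈ S.erase r, th p (x r / x s)) -
          (γ / α) * ∑ r ∈ S, (thp p (x b) (Y / x b) (x r) *
          ∏ i : Fin (n + 1), th p (x r / y i.succ.succ)) / ∏ s ∈ S.erase r, th p (x r / x s) := by
            rw [Finset.mul_sum, Finset.mul_sum, ← Finset.sum_sub_distrib]
            refine Finset.sum_congr rfl fun r _ => ?_
            rw [e r]; ring
        _ = 0 := by rw [ka, kb]; ring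

end

/-- The unit torus. -/
def tor (N : ℕ) : Set (Fin N → ℂ) := {z | ∀ i, ‖z i‖ = 1}

/-- The uniform measure on `[0, 2π]`. -/
noncomputable def arc : Measure ℝ := volume.restrict (Set.Icc 0 (2 * π))

instance : IsFiniteMeasure arc := by unfold arc; infer_instance

/-- The parametrisation of the torus by angles. -/
noncomputable def cxs {N : ℕ} (θ : Fin N → ℝ) : Fin N → ℂ := fun i => cx (θ i)

theorem cxs_mem {N : ℕ} (θ : Fin N → ℝ) : cxs θ ∈ tor N := fun i => norm_cx (θ i)

theorem continuous_cxs {N : ℕ} : Continuous (cxs (N := N)) :=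
  continuous_pi fun i => continuous_cx.comp (continuous_apply i)

theorem tor_ne_zero {N : ℕ} {z : Fin N → ℂ} (hz : z ∈ tor N) (i : Fin N) : z i ≠ 0 := by
  intro h; have := hz i; simp [h] at this

theorem box_restrict (N : ℕ) :
    volume.restrict (Set.univ.pi fun _ : Fin N => Set.Icc (0 : ℝ) (2 * π)) =
      Measure.pi fun _ : Fin N => arc := by
  rw [arc, ← Measure.restrict_pi_pi]; rfl

theorem torusInt_eq (N : ℕ) (f : (Fin N → ℂ) → ℂ) :
    torusInt N f = ((1 / (2 * π) : ℝ) : ℂ) ^ N *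
      ∫ θ, f (cxs θ) ∂(Measure.pi fun _ : Fin N => arc) := by
  rw [← box_restrict]; rfl

theorem continuous_comp_cxs {N : ℕ} {f : (Fin N → ℂ) → ℂ} (hf : ContinuousOn f (tor N)) :
    Continuous fun θ => f (cxs θ) :=
  hf.comp_continuous continuous_cxs cxs_mem

theorem isCompact_box (N : ℕ) :
    IsCompact (Set.univ.pi fun _ : Fin N => Set.Icc (0 : ℝ) (2 * π)) :=
  isCompact_univ_pi fun _ => isCompact_Icc

theorem integrable_cxs {N : ℕ} {f : (Fin N → ℂ) → ℂ} (hf : ContinuousOn f (tor N)) :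
    Integrable (fun θ => f (cxs θ)) (Measure.pi fun _ : Fin N => arc) := by
  rw [← box_restrict]
  exact (continuous_comp_cxs hf).continuousOn.integrableOn_compact (isCompact_box N)

theorem torusInt_congr {N : ℕ} {f g : (Fin N → ℂ) → ℂ} (h : ∀ z ∈ tor N, f z = g z) :
    torusInt N f = torusInt N g := by
  rw [torusInt_eq, torusInt_eq]
  simp_rw [h _ (cxs_mem _)]

theorem torusInt_const_mul (N : ℕ) (c : ℂ) (f : (Fin N → ℂ) → ℂ) :
    torusInt N (fun z => c * f z) = c * torusInt N f := by
  rw [torusInt_eq, torusInt_eq, integral_const_mul]; ring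

theorem torusInt_sum {N : ℕ} {ι : Type*} (S : Finset ι) (f : ι → (Fin N → ℂ) → ℂ)
    (hf : ∀ i ∈ S, ContinuousOn (f i) (tor N)) :
    torusInt N (fun z => ∑ i ∈ S, f i z) = ∑ i ∈ S, torusInt N (f i) := by
  simp_rw [torusInt_eq]
  rw [integral_finsetSum _ fun i hi => integrable_cxs (hf i hi), Finset.mul_sum]

theorem torusInt_perm {N : ℕ} (σ : Equiv.Perm (Fin N)) (f : (Fin N → ℂ) → ℂ) :
    torusInt N (fun z => f (z ∘ σ)) = torusInt N f := by
  rw [torusInt_eq, torusInt_eq,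
    ← (measurePreserving_piCongrLeft (fun _ : Fin N => arc) σ).integral_comp']
  congr 2
  ext θ
  congr 1
  ext i
  simp only [Function.comp_apply, cxs]
  congr 1
  exact (Equiv.piCongrLeft_apply_apply (fun _ => ℝ) σ θ i).symm ▸ rfl

theorem continuousOn_torusInt {X : Type*} [TopologicalSpace X] [FirstCountableTopology X]
    [LocallyCompactSpace X] {N : ℕ} {f : X → (Fin N → ℂ) → ℂ} {U : Set X} (hU : IsOpen U)
    (hc : ContinuousOn (fun x : X × (Fin N → ℂ) => f x.1 x.2) (U ×ˢ tor N)) :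
    ContinuousOn (fun s => torusInt N (f s)) U := by
  have : LocallyCompactSpace U := hU.locallyCompactSpace
  rw [continuousOn_iff_continuous_domRestrict]
  refine continuous_const.mul ?_
  refine continuous_parametric_integral_of_continuous (X := U)
    (f := fun (s : U) θ => f s (cxs θ)) ?_ (isCompact_box N)
  exact hc.comp_continuous (f := fun x : U × (Fin N → ℝ) => ((x.1 : X), cxs x.2))
    (by have := continuous_cxs (N := N); fun_prop) fun x => ⟨x.1.2, cxs_mem _⟩

theorem differentiableOn_torusInt {N : ℕ} {f : ℂ → (Fin N → ℂ) → ℂ} {U : Set ℂ} (hU : IsOpen U)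
    (hc : ContinuousOn (fun x : ℂ × (Fin N → ℂ) => f x.1 x.2) (U ×ˢ tor N))
    (hd : ∀ z ∈ tor N, DifferentiableOn ℂ (fun s => f s z) U) :
    DifferentiableOn ℂ (fun s => torusInt N (f s)) U := by
  intro s hs
  obtain ⟨ρ, hρ, hρU⟩ := Metric.isOpen_iff.1 hU s hs
  set r := ρ / 3 with hr
  have hr0 : 0 < r := by positivity
  have hsub : Metric.closedBall s (2 * r) ⊆ U :=
    (Metric.closedBall_subset_ball (by linarith)).trans hρU
  have hcc : ∀ x ∈ U, ContinuousOn (f x) (tor N) := fun x hx =>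
    hc.comp (f := fun z => (x, z)) (by fun_prop) fun z hz => ⟨hx, hz⟩
  obtain ⟨M, hM⟩ := ((isCompact_closedBall s (2 * r)).prod (isCompact_box N)).bddAbove_image
    (f := fun x : ℂ × (Fin N → ℝ) => ‖f x.1 (cxs x.2)‖)
    ((hc.comp (f := fun x : ℂ × (Fin N → ℝ) => (x.1, cxs x.2))
      (by have := continuous_cxs (N := N); fun_prop)
      fun x hx => ⟨hsub hx.1, cxs_mem _⟩).norm)
  have hdat : ∀ z ∈ tor N, ∀ x ∈ Metric.closedBall s (2 * r), DifferentiableAt ℂ (fun s => f s z) x :=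
    fun z hz x hx => (hd z hz x (hsub hx)).differentiableAt (hU.mem_nhds (hsub hx))
  have hsc : s ∈ Metric.closedBall s (2 * r) := Metric.mem_closedBall_self (by positivity)
  have key := hasDerivAt_integral_of_dominated_loc_of_deriv_le (𝕜 := ℂ)
    (μ := Measure.pi fun _ : Fin N => arc) (F := fun x θ => f x (cxs θ))
    (F' := fun x θ => deriv (fun y => f y (cxs θ)) x) (x₀ := s) (s := Metric.ball s r)
    (bound := fun _ => M / r) (Metric.ball_mem_nhds s hr0) ?_ (integrable_cxs (hcc s hs)) ?_ ?_ ?_ ?_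
  · exact ((key.2.const_mul (((1 / (2 * π) : ℝ) : ℂ) ^ N)).congr_of_eventuallyEq
      (Filter.Eventually.of_forall fun x => torusInt_eq N (f x))).differentiableAt.differentiableWithinAt
  · filter_upwards [hU.mem_nhds hs] with x hx
    exact (integrable_cxs (hcc x hx)).aestronglyMeasurable
  · have hlim : Filter.Tendsto (fun n : ℕ => ((r / (n + 1) : ℝ) : ℂ)) Filter.atTop
        (nhdsWithin 0 {0}ᶜ) := by
      refine tendsto_nhdsWithin_iff.2 ⟨?_, Filter.Eventually.of_forall fun n => ?_⟩
      · have h1 : Filter.Tendsto (fun n : ℕ => (r * (1 / ((n : ℝ) + 1)) : ℝ)) Filter.atTop (nhds (r * 0)) :=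
          tendsto_one_div_add_atTop_nhds_zero_nat.const_mul r
        rw [mul_zero] at h1
        have := (Complex.continuous_ofReal.tendsto 0).comp h1
        simpa [Function.comp_def, div_eq_mul_inv] using this
      · have : (r / (n + 1) : ℝ) ≠ 0 := by positivity
        exact Complex.ofReal_ne_zero.2 this
    refine aestronglyMeasurable_of_tendsto_ae Filter.atTop
      (f := fun (n : ℕ) θ => ((r / (n + 1) : ℝ) : ℂ)⁻¹ • (f (s + ((r / (n + 1) : ℝ) : ℂ)) (cxs θ) - f s (cxs θ)))
      (fun n => ?_) (Filter.Eventually.of_forall fun θ => ?_)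
    · have hn : s + ((r / (n + 1) : ℝ) : ℂ) ∈ Metric.closedBall s (2 * r) := ?_
      · exact (((integrable_cxs (hcc _ (hsub hn))).sub
          (integrable_cxs (hcc s hs))).smul (((r / (n + 1) : ℝ) : ℂ)⁻¹)).aestronglyMeasurable
      rw [Metric.mem_closedBall, dist_eq_norm, add_sub_cancel_left, Complex.norm_real, Real.norm_eq_abs,
        abs_of_pos (by positivity)]
      have : r / ((n : ℝ) + 1) ≤ r := div_le_self hr0.le (by linarith [n.cast_nonneg (α := ℝ)])
      linarith
    · exact ((hdat _ (cxs_mem θ) s hsc).hasDerivAt.tendsto_slope_zero).comp hlim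
  · rw [← box_restrict]
    refine ae_restrict_of_forall_mem (isCompact_box N).measurableSet fun θ hθ x hx => ?_
    have hball : ∀ y ∈ Metric.closedBall x r, y ∈ Metric.closedBall s (2 * r) := by
      intro y hy
      rw [Metric.mem_closedBall] at hy ⊢
      rw [Metric.mem_ball] at hx
      linarith [dist_triangle y x s]
    refine Complex.norm_deriv_le_of_forall_mem_sphere_norm_le hr0 ⟨fun y hy => ?_, ?_⟩ fun y hy => ?_
    · exact (hdat _ (cxs_mem θ) y
        (hball y (Metric.ball_subset_closedBall hy))).differentiableWithinAt
    · refine fun y hy => (hdat _ (cxs_mem θ) y (hball y ?_)).continuousAt.continuousWithinAt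
      exact Metric.closure_ball_subset_closedBall hy
    · exact hM ⟨(y, θ), ⟨hball y (Metric.sphere_subset_closedBall hy), hθ⟩, rfl⟩
  · exact integrable_const _
  · refine Filter.Eventually.of_forall fun θ x hx => (hdat _ (cxs_mem θ) x ?_).hasDerivAt
    exact Metric.ball_subset_closedBall (Metric.ball_subset_ball (by linarith) hx)

theorem cons_mem_tor {n : ℕ} {w : ℂ} {z : Fin n → ℂ} (hw : ‖w‖ = 1) (hz : z ∈ tor n) :
    (Fin.cons w z : Fin (n + 1) → ℂ) ∈ tor (n + 1) := by
  intro i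
  refine Fin.cases ?_ (fun i => ?_) i
  · simpa using hw
  · simpa using hz i

theorem cxs_cons {n : ℕ} (φ : ℝ) (θ : Fin n → ℝ) :
    cxs (Fin.cons φ θ : Fin (n + 1) → ℝ) = Fin.cons (cx φ) (cxs θ) := by
  ext i
  refine Fin.cases ?_ (fun i => ?_) i <;> simp [cxs]

theorem integral_arc (g : ℝ → ℂ) : ∫ φ, g φ ∂arc = ∫ φ in (0 : ℝ)..2 * π, g φ := by
  rw [arc, integral_Icc_eq_integral_Ioc, intervalIntegral.integral_of_le (by positivity)]

theorem pi_arc_succ {n : ℕ} (f : (Fin (n + 1) → ℂ) → ℂ) :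
    ∫ θ, f (cxs θ) ∂(Measure.pi fun _ : Fin (n + 1) => arc) =
      ∫ x : ℝ × (Fin n → ℝ), f (Fin.cons (cx x.1) (cxs x.2))
        ∂(arc.prod (Measure.pi fun _ : Fin n => arc)) := by
  rw [← ((measurePreserving_piFinSuccAbove (fun _ : Fin (n + 1) => arc) 0).symm).integral_comp']
  simp_rw [← cxs_cons]
  simp [MeasurableEquiv.piFinSuccAbove_symm_apply, Fin.insertNthEquiv]

theorem integrable_cons {n : ℕ} {f : (Fin (n + 1) → ℂ) → ℂ} (hf : ContinuousOn f (tor (n + 1))) :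
    Integrable (fun x : ℝ × (Fin n → ℝ) => f (Fin.cons (cx x.1) (cxs x.2)))
      (arc.prod (Measure.pi fun _ : Fin n => arc)) := by
  have h := ((measurePreserving_piFinSuccAbove (fun _ : Fin (n + 1) => arc) 0).symm)
  have := (h.integrable_comp_emb (MeasurableEquiv.measurableEmbedding _)).2 (integrable_cxs hf)
  simp_rw [← cxs_cons]
  simpa [MeasurableEquiv.piFinSuccAbove_symm_apply, Fin.insertNthEquiv, Function.comp_def] using this

theorem torusInt_succ {n : ℕ} {f : (Fin (n + 1) → ℂ) → ℂ} (hf : ContinuousOn f (tor (n + 1))) :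
    torusInt (n + 1) f = torusInt n fun z =>
      ((1 / (2 * π) : ℝ) : ℂ) * ∫ φ in (0 : ℝ)..2 * π, f (Fin.cons (cx φ) z) := by
  rw [torusInt_eq, torusInt_eq, pi_arc_succ, integral_prod_symm _ (integrable_cons hf)]
  simp_rw [integral_arc]
  rw [integral_const_mul]
  ring

theorem torusInt_succ' {n : ℕ} {f : (Fin (n + 1) → ℂ) → ℂ} (hf : ContinuousOn f (tor (n + 1))) :
    torusInt (n + 1) f = ((1 / (2 * π) : ℝ) : ℂ) * ∫ φ in (0 : ℝ)..2 * π,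
      torusInt n fun z => f (Fin.cons (cx φ) z) := by
  simp_rw [torusInt_eq]
  rw [pi_arc_succ, integral_prod _ (integrable_cons hf), intervalIntegral.integral_const_mul,
    integral_arc]
  ring

theorem ae_cx_linear_ne_one {N : ℕ} (L : (Fin N → ℝ) →ₗ[ℝ] ℝ) (hL : L ≠ 0) :
    ∀ᵐ θ ∂(volume : Measure (Fin N → ℝ)), cx (L θ) ≠ 1 := by
  have h : ∀ k : ℤ, volume {θ : Fin N → ℝ | L θ = k * (2 * π)} = 0 := by
    intro k
    by_cases hne : ∃ θ₀, L θ₀ = k * (2 * π)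
    · obtain ⟨θ₀, h0⟩ := hne
      have := Measure.addHaar_affineSubspace (volume : Measure (Fin N → ℝ))
        (AffineSubspace.mk' θ₀ (LinearMap.ker L)) (by
          intro htop
          apply hL
          ext1
          have := congrArg AffineSubspace.direction htop
          rw [AffineSubspace.direction_mk', AffineSubspace.direction_top] at this
          rw [LinearMap.ker_eq_top.1 this])
      refine measure_mono_null ?_ this
      intro θ hθ
      rw [SetLike.mem_coe, AffineSubspace.mem_mk', LinearMap.mem_ker, vsub_eq_sub, map_sub, h0,
        show L θ = _ from hθ, sub_self]
    · rw [show {θ : Fin N → ℝ | L θ = k * (2 * π)} = ∅ from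
        Set.eq_empty_of_forall_notMem fun θ hθ => hne ⟨θ, hθ⟩, measure_empty]
  have h2 : ∀ᵐ θ ∂(volume : Measure (Fin N → ℝ)), ∀ k : ℤ, L θ ≠ k * (2 * π) :=
    ae_all_iff.2 fun k => by rw [ae_iff]; simpa using h k
  filter_upwards [h2] with θ hθ h1
  rw [cx, Complex.exp_eq_one_iff] at h1
  obtain ⟨k, hk⟩ := h1
  apply hθ k
  have : (L θ : ℂ) = ((k * (2 * π) : ℝ) : ℂ) := by
    have hI := Complex.I_ne_zero
    apply mul_left_cancel₀ hI
    rw [hk]; push_cast; ring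
  exact_mod_cast this

/-- Points of the torus with pairwise distinct `z_i^{±1}`. -/
def Generic {N : ℕ} (z : Fin N → ℂ) : Prop :=
  (∀ i, z i ^ 2 ≠ 1) ∧ ∀ i j, i ≠ j → z i ≠ z j ∧ z i * z j ≠ 1

theorem ae_generic (N : ℕ) : ∀ᵐ θ ∂(Measure.pi fun _ : Fin N => arc), Generic (cxs θ) := by
  rw [← box_restrict]
  refine ae_restrict_of_ae ?_
  let pr : Fin N → (Fin N → ℝ) →ₗ[ℝ] ℝ := fun i => LinearMap.proj i
  have h1 : ∀ i j : Fin N, ∀ᵐ θ ∂(volume : Measure (Fin N → ℝ)), cx (θ i + θ j) ≠ 1 := fun i j => by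
    refine ae_cx_linear_ne_one (pr i + pr j) fun h => ?_
    have := LinearMap.congr_fun h (fun _ => 1)
    simp [pr] at this
  have h2 : ∀ i j : Fin N, i ≠ j →
      ∀ᵐ θ ∂(volume : Measure (Fin N → ℝ)), cx (θ i + -θ j) ≠ 1 := fun i j hij => by
    refine ae_cx_linear_ne_one (pr i + -pr j) fun h => ?_
    have := LinearMap.congr_fun h (Pi.single i 1)
    simp [pr, hij.symm] at this
  have h1' := ae_all_iff.2 fun i => ae_all_iff.2 fun j => h1 i j
  have h2' := ae_all_iff.2 fun i => ae_all_iff.2 fun j => ae_all_iff.2 fun hij => h2 i j hij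
  filter_upwards [h1', h2'] with θ a b
  refine ⟨fun i => ?_, fun i j hij => ⟨fun h => b i j hij ?_, ?_⟩⟩
  · have := a i i
    rwa [cx_add, ← pow_two] at this
  · rw [cx_add, cx_neg, show cx (θ i) = cx (θ j) from h, mul_inv_cancel₀ (cx_ne_zero _)]
  · have := a i j
    rwa [cx_add] at this

theorem torusInt_congr_generic {N : ℕ} {f g : (Fin N → ℂ) → ℂ}
    (h : ∀ z ∈ tor N, Generic z → f z = g z) : torusInt N f = torusInt N g := by
  rw [torusInt_eq, torusInt_eq]
  congr 1
  refine integral_congr_ae ?_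
  filter_upwards [ae_generic N] with θ hθ
  exact h _ (cxs_mem θ) hθ

/-- The product of `K` over unordered pairs of indices. -/
noncomputable def pairProd {N : ℕ} (K : Fin N → Fin N → ℂ) : ℂ :=
  ∏ i, ∏ j, if i < j then K i j else 1

theorem pairProd_congr {N : ℕ} {K K' : Fin N → Fin N → ℂ} (h : ∀ i j, i < j → K i j = K' i j) :
    pairProd K = pairProd K' := by
  unfold pairProd
  refine Finset.prod_congr rfl fun i _ => Finset.prod_congr rfl fun j _ => ?_
  split_ifs with hij
  · exact h i j hij
  · rfl

theorem pairProd_mul {N : ℕ} (K K' : Fin N → Fin N → ℂ) :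
    pairProd (fun i j => K i j * K' i j) = pairProd K * pairProd K' := by
  unfold pairProd
  simp_rw [← Finset.prod_mul_distrib]
  refine Finset.prod_congr rfl fun i _ => Finset.prod_congr rfl fun j _ => ?_
  split_ifs <;> simp

theorem pairProd_succ {n : ℕ} (K : Fin (n + 1) → Fin (n + 1) → ℂ) :
    pairProd K = (∏ j : Fin n, K 0 j.succ) * pairProd fun i j : Fin n => K i.succ j.succ := by
  unfold pairProd
  rw [Fin.prod_univ_succ, Fin.prod_univ_succ]
  simp [Fin.prod_univ_succ]

theorem pairProd_eq_sym2 {N : ℕ} (K : Fin N → Fin N → ℂ) (hK : ∀ i j, K i j = K j i) :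
    pairProd K = ∏ x ∈ (Finset.univ : Finset (Fin N)).sym2 with ¬ x.IsDiag,
      Sym2.lift ⟨K, hK⟩ x := by
  have h := congrArg Additive.toMul (Finset.sum_sym2_filter_not_isDiag (M := Additive ℂ)
    (Finset.univ : Finset (Fin N)) fun x => Additive.ofMul (Sym2.lift ⟨K, hK⟩ x))
  simp only [toMul_sum, toMul_ofMul, Sym2.lift_mk] at h
  rw [h, pairProd, ← Finset.prod_product', ← Finset.prod_filter]
  refine Finset.prod_congr ?_ fun _ _ => rfl
  ext x
  simp only [Finset.mem_filter, Finset.mem_offDiag, Finset.mem_univ, true_and]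
  exact ⟨fun h => ⟨h.2.ne, h.2⟩, fun h => ⟨by simp, h.2⟩⟩

theorem pairProd_perm {N : ℕ} (K : Fin N → Fin N → ℂ) (hK : ∀ i j, K i j = K j i)
    (σ : Equiv.Perm (Fin N)) : pairProd (fun i j => K (σ i) (σ j)) = pairProd K := by
  rw [pairProd_eq_sym2 K hK, pairProd_eq_sym2 _ fun i j => hK _ _]
  refine Finset.prod_nbij (Sym2.map σ) (fun x hx => ?_) (Sym2.map.injective σ.injective).injOn
    (fun x hx => ⟨Sym2.map σ.symm x, ?_, ?_⟩) fun x _ => ?_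
  · simpa [Sym2.isDiag_map σ.injective] using hx
  · simpa [Sym2.isDiag_map σ.symm.injective] using hx
  · simp [Sym2.map_map]
  · induction x with
    | _ a b => simp

theorem pairProd_append {a b : ℕ} (K : Fin (a + b) → Fin (a + b) → ℂ) :
    pairProd K = (pairProd fun i j : Fin a => K (i.castAdd b) (j.castAdd b)) *
      (∏ i : Fin a, ∏ j : Fin b, K (i.castAdd b) (j.natAdd a)) *
      pairProd fun i j : Fin b => K (i.natAdd a) (j.natAdd a) := by
  unfold pairProd
  have h1 : ∀ (i : Fin a) (j : Fin b), i.castAdd b < j.natAdd a := fun i j => by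
    rw [Fin.lt_def]; simp; omega
  have h2 : ∀ (i : Fin a) (j : Fin b), ¬ j.natAdd a < i.castAdd b := fun i j => (h1 i j).asymm
  have h3 : ∀ i j : Fin a, i.castAdd b < j.castAdd b ↔ i < j := fun i j => Iff.rfl
  have h4 : ∀ i j : Fin b, i.natAdd a < j.natAdd a ↔ i < j := fun i j => by simp
  simp only [Fin.prod_univ_add, h1, h2, h3, h4, if_true, if_false, Finset.prod_mul_distrib,
    Finset.prod_const_one]
  ring

theorem pairProd_star {N : ℕ} (r : Fin N) (h : Fin N → ℂ) :
    pairProd (fun i j => if i = r then h j else if j = r then h i else 1) =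
      ∏ s ∈ Finset.univ.erase r, h s := by
  rw [pairProd_congr (K' := fun i j => (if i = r then h j else 1) * (if j = r then h i else 1))
    fun i j hij => ?_, pairProd_mul]
  · have e1 : (pairProd fun i j => if i = r then h j else 1) = ∏ j, if r < j then h j else 1 := by
      unfold pairProd
      rw [Finset.prod_eq_single r (fun i _ hi => by simp [hi]) (by simp)]
      simp
    have e2 : (pairProd fun i j => if j = r then h i else 1) = ∏ j, if j < r then h j else 1 := by
      unfold pairProd
      refine Finset.prod_congr rfl fun i _ => ?_
      rw [Finset.prod_eq_single r (fun i _ hi => by simp [hi]) (by simp)]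
      simp
    rw [e1, e2, ← Finset.prod_mul_distrib, ← Finset.prod_erase Finset.univ (a := r) (by simp)]
    refine Finset.prod_congr rfl fun s hs => ?_
    rcases lt_or_gt_of_ne (Finset.ne_of_mem_erase hs) with h | h
    · simp [h, h.asymm]
    · simp [h, h.asymm]
  · by_cases h1 : i = r
    · subst h1; simp [hij.ne']
    · simp [h1]

section
variable {X : Type*} [TopologicalSpace X] {K : Set X} {P Y Z : X → ℂ} {q : ℂ}

theorem continuousOn_th (hP : ContinuousOn P K) (hY : ContinuousOn Y K) (h : ∀ x ∈ K, ‖P x‖ < 1)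
    (h0 : ∀ x ∈ K, Y x ≠ 0) : ContinuousOn (fun x => th (P x) (Y x)) K :=
  (continuousOn_Qf hP hY h).mul (continuousOn_Qf hP (hP.div hY h0) h)

theorem differentiableOn_th {P Y : ℂ → ℂ} {U : Set ℂ} (hU : IsOpen U) (hP : DifferentiableOn ℂ P U)
    (hY : DifferentiableOn ℂ Y U) (h : ∀ x ∈ U, ‖P x‖ < 1) (h0 : ∀ x ∈ U, Y x ≠ 0) :
    DifferentiableOn ℂ (fun x => th (P x) (Y x)) U :=
  (differentiableOn_Qf hU hP hY h).mul (differentiableOn_Qf hU hP (hP.div hY h0) h)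

/-- The interaction between two variables. -/
noncomputable def Kf (p q z w : ℂ) : ℂ :=
  th p (z * w) * th q (1 / (z * w)) * (th p (z / w) * th q (w / z))

/-- The self-interaction of one variable. -/
noncomputable def ef (p q z : ℂ) : ℂ := th p (z ^ 2) * th q (1 / z ^ 2)

theorem continuousOn_Kf (hq : ‖q‖ < 1) (hP : ContinuousOn P K) (hY : ContinuousOn Y K)
    (hZ : ContinuousOn Z K) (h : ∀ x ∈ K, ‖P x‖ < 1) (hY0 : ∀ x ∈ K, Y x ≠ 0)
    (hZ0 : ∀ x ∈ K, Z x ≠ 0) : ContinuousOn (fun x => Kf (P x) q (Y x) (Z x)) K := by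
  have hYZ : ∀ x ∈ K, Y x * Z x ≠ 0 := fun x hx => mul_ne_zero (hY0 x hx) (hZ0 x hx)
  have hc : ContinuousOn (fun _ : X => q) K := continuousOn_const
  exact ((continuousOn_th hP (hY.mul hZ) h hYZ).mul
    (continuousOn_th hc (continuousOn_const.div (hY.mul hZ) hYZ) (fun _ _ => hq)
      fun x hx => one_div_ne_zero (hYZ x hx))).mul
    ((continuousOn_th hP (hY.div hZ hZ0) h fun x hx => div_ne_zero (hY0 x hx) (hZ0 x hx)).mul
    (continuousOn_th hc (hZ.div hY hY0) (fun _ _ => hq)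
      fun x hx => div_ne_zero (hZ0 x hx) (hY0 x hx)))

theorem continuousOn_ef (hq : ‖q‖ < 1) (hP : ContinuousOn P K) (hY : ContinuousOn Y K)
    (h : ∀ x ∈ K, ‖P x‖ < 1) (hY0 : ∀ x ∈ K, Y x ≠ 0) :
    ContinuousOn (fun x => ef (P x) q (Y x)) K := by
  have hYZ : ∀ x ∈ K, Y x ^ 2 ≠ 0 := fun x hx => pow_ne_zero 2 (hY0 x hx)
  have hc : ContinuousOn (fun _ : X => q) K := continuousOn_const
  exact (continuousOn_th hP (hY.pow 2) h hYZ).mul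
    (continuousOn_th hc (continuousOn_const.div (hY.pow 2) hYZ) (fun _ _ => hq)
      fun x hx => one_div_ne_zero (hYZ x hx))

theorem differentiableOn_Kf {q z w : ℂ} {P : ℂ → ℂ} {U : Set ℂ} (hU : IsOpen U)
    (hP : DifferentiableOn ℂ P U) (h : ∀ x ∈ U, ‖P x‖ < 1) (hz : z ≠ 0) (hw : w ≠ 0) :
    DifferentiableOn ℂ (fun x => Kf (P x) q z w) U :=
  ((differentiableOn_th hU hP (differentiableOn_const _) h fun _ _ => mul_ne_zero hz hw).mul
    (differentiableOn_const _)).mul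
  ((differentiableOn_th hU hP (differentiableOn_const _) h fun _ _ => div_ne_zero hz hw).mul
    (differentiableOn_const _))

theorem differentiableOn_ef {q z : ℂ} {P : ℂ → ℂ} {U : Set ℂ} (hU : IsOpen U)
    (hP : DifferentiableOn ℂ P U) (h : ∀ x ∈ U, ‖P x‖ < 1) (hz : z ≠ 0) :
    DifferentiableOn ℂ (fun x => ef (P x) q z) U :=
  (differentiableOn_th hU hP (differentiableOn_const _) h fun _ _ => pow_ne_zero 2 hz).mul
    (differentiableOn_const _)
end

theorem Kf_comm {p q z w : ℂ} (hp : ‖p‖ < 1) (hq : ‖q‖ < 1) (hz : z ≠ 0) (hw : w ≠ 0) :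
    Kf p q z w = Kf p q w z := by
  unfold Kf
  have h1 := th_inv hp (div_ne_zero hz hw)
  have h2 := th_inv hq (div_ne_zero hw hz)
  rw [inv_div] at h1 h2
  rw [h1, h2, mul_comm w z]
  field_simp

/-- The integrand of a `BC_N` integral with one-body weight `g`. -/
noncomputable def Wt (N : ℕ) (p q : ℂ) (g : ℂ → ℂ) (z : Fin N → ℂ) : ℂ :=
  (∏ i, g (z i)) * (pairProd (fun i j => Kf p q (z i) (z j)) * ∏ i, ef p q (z i))

/-- The one-body weight with parameters `s`. -/
noncomputable def gam {d : ℕ} (p q : ℂ) (s : Fin d → ℂ) (z : ℂ) : ℂ :=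
  ∏ r, ellGamma (s r * z) p q * ellGamma (s r / z) p q

/-- The normalisation of a `BC_N` integral. -/
noncomputable def nrm (N : ℕ) (p q : ℂ) : ℂ := (qPoch p * qPoch q) ^ N / ((2 ^ N * N.factorial : ℕ) : ℂ)

theorem I_BC_eq {N d : ℕ} {s : Fin d → ℂ} {p q : ℂ} (hp : ‖p‖ < 1) (hq : ‖q‖ < 1) :
    I_BC N d s p q = nrm N p q * torusInt N (Wt N p q (gam p q s)) := by
  unfold I_BC nrm
  congr 1
  refine torusInt_congr fun z hz => ?_
  have hdiv : ∀ i j, ‖z i / z j‖ = 1 := fun i j => by rw [norm_div, hz, hz, div_one]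
  have hmul : ∀ i j, ‖z i * z j‖ = 1 := fun i j => by rw [norm_mul, hz, hz, one_mul]
  rw [div_eq_mul_inv, mul_inv, Wt]
  unfold gam
  congr 2
  · unfold pairProd
    simp_rw [← Finset.prod_inv_distrib]
    refine Finset.prod_congr rfl fun i _ => Finset.prod_congr rfl fun j _ => ?_
    split_ifs
    · have a := ellGamma_mul_inv hp hq (hmul i j)
      have b := ellGamma_mul_inv hp hq (hdiv i j)
      rw [one_div_div] at b
      rw [Kf, ← a, ← b, ← mul_inv]
      congr 1
      ring
    · simp
  · rw [← Finset.prod_inv_distrib]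
    refine Finset.prod_congr rfl fun i _ => ?_
    rw [ef, ← ellGamma_mul_inv hp hq (by rw [norm_pow, hz, one_pow])]

theorem continuousOn_pairProd {X : Type*} [TopologicalSpace X] {N : ℕ} {F : X → Fin N → Fin N → ℂ}
    {K : Set X} (h : ∀ i j, ContinuousOn (fun x => F x i j) K) :
    ContinuousOn (fun x => pairProd (F x)) K := by
  unfold pairProd
  refine continuousOn_finsetProd _ fun i _ => continuousOn_finsetProd _ fun j _ => ?_
  split_ifs
  · exact h i j
  · exact continuousOn_const

theorem differentiableOn_pairProd {N : ℕ} {F : ℂ → Fin N → Fin N → ℂ}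
    {U : Set ℂ} (h : ∀ i j, DifferentiableOn ℂ (fun x => F x i j) U) :
    DifferentiableOn ℂ (fun x => pairProd (F x)) U := by
  unfold pairProd
  refine DifferentiableOn.fun_finsetProd fun i _ => DifferentiableOn.fun_finsetProd fun j _ => ?_
  split_ifs
  · exact h i j
  · exact differentiableOn_const _

theorem continuousOn_Wt {X : Type*} [TopologicalSpace X] {N : ℕ} {K : Set X} {P : X → ℂ} {q : ℂ}
    {g : X → ℂ → ℂ} {z : X → Fin N → ℂ} (hq : ‖q‖ < 1) (hP : ContinuousOn P K)
    (h : ∀ x ∈ K, ‖P x‖ < 1) (hz : ContinuousOn z K) (hzt : ∀ x ∈ K, ∀ i, z x i ≠ 0)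
    (hg : ∀ i, ContinuousOn (fun x => g x (z x i)) K) :
    ContinuousOn (fun x => Wt N (P x) q (g x) (z x)) K := by
  have hzi : ∀ i, ContinuousOn (fun x => z x i) K := fun i =>
    (continuous_apply i).comp_continuousOn hz
  exact (continuousOn_finsetProd _ fun i _ => hg i).mul
    ((continuousOn_pairProd fun i j => continuousOn_Kf hq hP (hzi i) (hzi j) h
      (fun x hx => hzt x hx i) fun x hx => hzt x hx j).mul
    (continuousOn_finsetProd _ fun i _ => continuousOn_ef hq hP (hzi i) h fun x hx => hzt x hx i))

theorem differentiableOn_Wt {N : ℕ} {U : Set ℂ} {P : ℂ → ℂ} {q : ℂ} {g : ℂ → ℂ → ℂ}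
    {z : Fin N → ℂ} (hU : IsOpen U) (hP : DifferentiableOn ℂ P U) (h : ∀ x ∈ U, ‖P x‖ < 1)
    (hz : ∀ i, z i ≠ 0) (hg : ∀ i, DifferentiableOn ℂ (fun x => g x (z i)) U) :
    DifferentiableOn ℂ (fun x => Wt N (P x) q (g x) z) U :=
  (DifferentiableOn.fun_finsetProd fun i _ => hg i).mul
    ((differentiableOn_pairProd fun i j => differentiableOn_Kf hU hP h (hz i) (hz j)).mul
    (DifferentiableOn.fun_finsetProd fun i _ => differentiableOn_ef hU hP h (hz i)))

theorem continuousOn_ellGamma {X : Type*} [TopologicalSpace X] {p q : ℂ} {Y : X → ℂ} {K : Set X}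
    (hp : ‖p‖ < 1) (hq : ‖q‖ < 1)
    (hY : ContinuousOn Y K) (h0 : ∀ x ∈ K, Y x ≠ 0) (h1 : ∀ x ∈ K, ‖Y x‖ < 1) :
    ContinuousOn (fun x => ellGamma (Y x) p q) K := by
  simp_rw [ellGamma_eq hp hq]
  exact ((differentiable_Ef hp hq).continuous.comp_continuousOn (continuousOn_const.div hY h0)).div
    ((differentiable_Ef hp hq).continuous.comp_continuousOn hY)
    fun x hx => Ef_ne_zero_of_norm_lt hp hq (h1 x hx)

theorem continuousOn_gam {d : ℕ} {p q : ℂ} {s : Fin d → ℂ} (hp : ‖p‖ < 1) (hq : ‖q‖ < 1)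
    (hs0 : ∀ r, s r ≠ 0) (hs : ∀ r, ‖s r‖ < 1) : ContinuousOn (gam p q s) {z | ‖z‖ = 1} := by
  have hz : ∀ z : ℂ, ‖z‖ = 1 → z ≠ 0 := fun z h h0 => by simp [h0] at h
  refine continuousOn_finsetProd _ fun r _ => ?_
  refine (continuousOn_ellGamma hp hq (by fun_prop) (fun z h => mul_ne_zero (hs0 r) (hz z h))
    fun z h => ?_).mul (continuousOn_ellGamma hp hq
      (continuousOn_const.div continuousOn_id hz) (fun z h => div_ne_zero (hs0 r) (hz z h))
    fun z h => ?_)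
  · rw [norm_mul, show ‖z‖ = 1 from h, mul_one]; exact hs r
  · rw [norm_div, show ‖z‖ = 1 from h, div_one]; exact hs r

theorem continuousOn_Wt_gam {N d : ℕ} {p q : ℂ} {s : Fin d → ℂ} (hp : ‖p‖ < 1) (hq : ‖q‖ < 1)
    (hs0 : ∀ r, s r ≠ 0) (hs : ∀ r, ‖s r‖ < 1) : ContinuousOn (Wt N p q (gam p q s)) (tor N) :=
  continuousOn_Wt hq continuousOn_const (fun _ _ => hp) continuousOn_id
    (fun _ hz i => tor_ne_zero hz i) fun i => (continuousOn_gam hp hq hs0 hs).comp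
      (continuous_apply i).continuousOn fun _ hz => hz i

theorem prod_update_apply {d : ℕ} (F : ℂ → ℂ) (t : Fin d → ℂ) (r : Fin d) (v : ℂ) :
    ∏ s, F (Function.update t r v s) = F v * ∏ s ∈ Finset.univ.erase r, F (t s) := by
  rw [← Finset.mul_prod_erase Finset.univ _ (Finset.mem_univ r), Function.update_self]
  congr 1
  refine Finset.prod_congr rfl fun s hs => ?_
  rw [Function.update_of_ne (Finset.ne_of_mem_erase hs)]

theorem gam_update_mul {d : ℕ} {p q : ℂ} (hp : ‖p‖ < 1) (hq : ‖q‖ < 1) (hq0 : q ≠ 0)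
    (t : Fin d → ℂ) (r : Fin d) (hr : ‖t r‖ < 1) {z : ℂ} (hz : ‖z‖ = 1) :
    gam p q (Function.update t r (q * t r)) z =
      th p (t r * z) * th p (t r / z) * gam p q t z := by
  unfold gam
  rw [prod_update_apply (fun a => ellGamma (a * z) p q * ellGamma (a / z) p q),
    ← Finset.mul_prod_erase Finset.univ _ (Finset.mem_univ r), mul_assoc q, mul_div_assoc q,
    ellGamma_shift hp hq hq0, ellGamma_shift hp hq hq0]
  · ring
  · exact Ef_ne_zero_of_norm_lt hp hq (by rw [norm_div, hz, div_one]; exact hr)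
  · exact Ef_ne_zero_of_norm_lt hp hq (by rw [norm_mul, hz, mul_one]; exact hr)

/-- Coefficients of the three-term type relations. -/
noncomputable def rc {d : ℕ} (N : ℕ) (p : ℂ) (t : Fin d → ℂ) (S : Finset (Fin d)) (r : Fin d) : ℂ :=
  (t r ^ N)⁻¹ / ∏ s ∈ S.erase r, br p (t r) (t s)

theorem Wt_mul (N : ℕ) (p q : ℂ) (g h : ℂ → ℂ) (z : Fin N → ℂ) :
    Wt N p q (fun x => h x * g x) z = (∏ i, h (z i)) * Wt N p q g z := by
  unfold Wt
  rw [Finset.prod_mul_distrib]; ring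

theorem Wt_congr {N : ℕ} {p q : ℂ} {g h : ℂ → ℂ} {z : Fin N → ℂ} (H : ∀ i, g (z i) = h (z i)) :
    Wt N p q g z = Wt N p q h z := by
  unfold Wt
  simp_rw [H]

theorem norm_update_lt {d : ℕ} {t : Fin d → ℂ} (ht : ∀ r, ‖t r‖ < 1) (r : Fin d) {v : ℂ}
    (hv : ‖v‖ < 1) (s : Fin d) : ‖Function.update t r v s‖ < 1 := by
  rcases eq_or_ne s r with rfl | h
  · rwa [Function.update_self]
  · rw [Function.update_of_ne h]; exact ht s

theorem update_ne_zero {d : ℕ} {t : Fin d → ℂ} (ht : ∀ r, t r ≠ 0) (r : Fin d) {v : ℂ}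
    (hv : v ≠ 0) (s : Fin d) : Function.update t r v s ≠ 0 := by
  rcases eq_or_ne s r with rfl | h
  · rwa [Function.update_self]
  · rw [Function.update_of_ne h]; exact ht s

theorem norm_mul_lt_one {a b : ℂ} (ha : ‖a‖ < 1) (hb : ‖b‖ < 1) : ‖a * b‖ < 1 := by
  rw [norm_mul]; exact mul_lt_one_of_nonneg_of_lt_one_left (norm_nonneg _) ha hb.le

/-- Difference relation in the parameters of a `BC_N` integral. -/
theorem sum_rc_mul_I_BC {N d : ℕ} {p q : ℂ} (hp : ‖p‖ < 1) (hp0 : p ≠ 0) (hq : ‖q‖ < 1)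
    (hq0 : q ≠ 0) {t : Fin d → ℂ} (ht0 : ∀ r, t r ≠ 0) (ht : ∀ r, ‖t r‖ < 1)
    {S : Finset (Fin d)} (hS : S.card = N + 2)
    (hne : ∀ r ∈ S, ∀ s ∈ S, r ≠ s → br p (t r) (t s) ≠ 0) :
    ∑ r ∈ S, rc N p t S r * I_BC N d (Function.update t r (q * t r)) p q = 0 := by
  have hup : ∀ r, torusInt N (Wt N p q (gam p q (Function.update t r (q * t r)))) =
      torusInt N fun z => (∏ i, (t r * br p (t r) (z i))) * Wt N p q (gam p q t) z := fun r =>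
    torusInt_congr fun z hz => by
      rw [Wt_congr (h := fun z => (th p (t r * z) * th p (t r / z)) * gam p q t z)
        fun i => gam_update_mul hp hq hq0 t r (ht r) (hz i), Wt_mul]
      congr 1
      refine Finset.prod_congr rfl fun i _ => ?_
      rw [br, mul_inv_cancel_left₀ (ht0 r)]
  have hcont : ∀ r, ContinuousOn (fun z : Fin N → ℂ =>
      (∏ i, br p (t r) (z i)) * Wt N p q (gam p q t) z) (tor N) := by
    intro r
    refine (continuousOn_finsetProd _ fun i _ => continuousOn_const.mul
      ((continuousOn_th continuousOn_const (by fun_prop) (fun _ _ => hp) ?_).mul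
      (continuousOn_th continuousOn_const (continuousOn_const.div (by fun_prop) ?_)
        (fun _ _ => hp) ?_))).mul (continuousOn_Wt_gam hp hq ht0 ht)
    · exact fun z hz => mul_ne_zero (ht0 r) (tor_ne_zero hz i)
    · exact fun z hz => tor_ne_zero hz i
    · exact fun z hz => div_ne_zero (ht0 r) (tor_ne_zero hz i)
  have h1 : ∀ r ∈ S, rc N p t S r * I_BC N d (Function.update t r (q * t r)) p q =
      nrm N p q * torusInt N fun z => (∏ s ∈ S.erase r, br p (t r) (t s))⁻¹ *
        ((∏ i, br p (t r) (z i)) * Wt N p q (gam p q t) z) := by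
    intro r _
    rw [I_BC_eq hp hq, hup, torusInt_const_mul]
    simp_rw [Finset.prod_mul_distrib, Finset.prod_const, Finset.card_univ, Fintype.card_fin, mul_assoc]
    rw [torusInt_const_mul, rc]
    have := pow_ne_zero N (ht0 r)
    field_simp
  rw [Finset.sum_congr rfl h1, ← Finset.mul_sum, ← torusInt_sum S
    (fun r z => (∏ s ∈ S.erase r, br p (t r) (t s))⁻¹ *
      ((∏ i, br p (t r) (z i)) * Wt N p q (gam p q t) z)) fun r _ =>
    continuousOn_const.mul (hcont r), torusInt_congr (g := fun z => 0 * 0), torusInt_const_mul]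
  · simp
  · intro z hz
    have := sum_br_eq_zero hp hp0 ht0 N S hS hne z fun i => tor_ne_zero hz i
    rw [mul_zero, ← zero_mul (Wt N p q (gam p q t) z), ← this, Finset.sum_mul]
    refine Finset.sum_congr rfl fun r _ => ?_
    ring

theorem th_ne_zero {p x : ℂ} (hp : ‖p‖ < 1) (h1 : ‖p‖ < ‖x‖) (h2 : ‖x‖ ≤ 1) (h3 : x ≠ 1) :
    th p x ≠ 0 := by
  have hx : 0 < ‖x‖ := (norm_nonneg _).trans_lt h1
  refine mul_ne_zero (Qf_ne_zero hp fun j h => ?_) (Qf_ne_zero_of_norm_lt hp ?_)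
  · rcases j with _ | j
    · exact h3 (by simpa using h)
    · have := congrArg norm h
      rw [norm_mul, norm_pow, norm_one, pow_succ] at this
      have h4 : ‖p‖ ^ j ≤ 1 := pow_le_one₀ (norm_nonneg _) hp.le
      nlinarith [norm_nonneg p, mul_le_mul h4 hp.le (norm_nonneg _) zero_le_one,
        mul_nonneg (pow_nonneg (norm_nonneg p) j) (norm_nonneg p)]
  · rw [norm_div, div_lt_one hx]; exact h1

/-- The partial fraction identity for theta functions, in shifted balancing. -/
theorem sum_mul_th_eq_zero {p : ℂ} (hp : ‖p‖ < 1) (hp0 : p ≠ 0) {ι κ : Type*} [DecidableEq ι]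
    {x : ι → ℂ} (hx : ∀ r, x r ≠ 0) {y : κ → ℂ} (hy : ∀ a, y a ≠ 0) {S : Finset ι} {T : Finset κ}
    (hST : S.card = T.card) (hT : T.Nonempty)
    (hne : ∀ r ∈ S, ∀ s ∈ S, r ≠ s → th p (x r / x s) ≠ 0)
    (hbal : ∏ r ∈ S, x r = p * ∏ a ∈ T, y a) :
    ∑ r ∈ S, x r * (∏ a ∈ T, th p (x r / y a)) / ∏ s ∈ S.erase r, th p (x r / x s) = 0 := by
  obtain ⟨n, hn⟩ : ∃ n, T.card = n + 1 := ⟨T.card - 1, by have := hT.card_pos; omega⟩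
  let e : Fin (n + 1) ≃ T := (finCongr hn.symm).trans T.equivFin.symm
  have hprod : ∀ f : κ → ℂ, ∏ a ∈ T, f a = ∏ i, f (e i) := fun f => by
    rw [← Finset.prod_coe_sort, ← e.prod_comp]
  have key := sum_th_eq_zero hp hp0 hx n S (hST.trans hn) hne
    (Fin.cons (p * y (e 0)) fun i => y (e i.succ)) (fun i => by
      refine Fin.cases ?_ (fun i => ?_) i
      · simpa using ⟨hp0, hy _⟩
      · simpa using hy _) (by
      rw [hbal, hprod, Fin.prod_univ_succ, Fin.prod_univ_succ]
      simp [mul_assoc])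
  rw [← mul_zero (-(p * y (e 0))), ← key, Finset.mul_sum]
  refine Finset.sum_congr rfl fun r _ => ?_
  rw [hprod, Fin.prod_univ_succ, Fin.prod_univ_succ]
  simp only [Fin.cons_zero, Fin.cons_succ]
  have h := th_mul_self hp hp0 (x := x r / (p * y (e 0)))
    (div_ne_zero (hx r) (mul_ne_zero hp0 (hy _)))
  rw [show p * (x r / (p * y (e 0))) = x r / y (e 0) by field_simp] at h
  rw [h]
  have := hx r
  have := hy (e 0)
  field_simp

section antisym
variable {d : ℕ} {p q : ℂ} {s : Fin d → ℂ} {S : Finset (Fin d)} {k : ℕ}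

/-- The reduced one-variable integrand whose contour integral vanishes by antisymmetry. -/
noncomputable def Gf (p q : ℂ) (s : Fin d → ℂ) (S : Finset (Fin d)) (z : Fin k → ℂ) (u : ℂ) : ℂ :=
  u ^ (2 * k + 3) * (∏ a ∈ Sᶜ, ellGamma (s a * u) p q * ellGamma (q * (s a / u)) p q) *
    (∏ b ∈ S, ellGamma (s b * u / q) p q * ellGamma (s b / u) p q) *
    (th q (1 / u ^ 2) * ∏ j, th q (1 / (u * z j)) * th q (z j / u))

theorem Gf_antisymm (hq : ‖q‖ < 1) (hq0 : q ≠ 0) {z : Fin k → ℂ} (hz : ∀ j, z j ≠ 0) {u : ℂ}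
    (hu : u ≠ 0) : Gf p q s S z (q / u) = -Gf p q s S z u := by
  have e1 : th q (1 / (q / u) ^ 2) = -(u ^ 6 / q ^ 3) * th q (1 / u ^ 2) := by
    have h0 : (1 / u ^ 2) ≠ 0 := one_div_ne_zero (pow_ne_zero 2 hu)
    rw [← th_div_self hq0, show q / (1 / (q / u) ^ 2) = q * (q * (q * (1 / u ^ 2))) by field_simp,
      th_mul_self hq hq0 (mul_ne_zero hq0 (mul_ne_zero hq0 h0)),
      th_mul_self hq hq0 (mul_ne_zero hq0 h0), th_mul_self hq hq0 h0]
    field_simp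
  have e2 : ∀ j, th q (1 / (q / u * z j)) * th q (z j / (q / u)) =
      u ^ 4 / q ^ 2 * (th q (1 / (u * z j)) * th q (z j / u)) := fun j => by
    have hj := hz j
    have h1 : z j / u ≠ 0 := div_ne_zero hj hu
    have h2 : 1 / (u * z j) ≠ 0 := one_div_ne_zero (mul_ne_zero hu hj)
    rw [← th_div_self hq0 (1 / _), ← th_div_self hq0 (z j / (q / u)),
      show q / (1 / (q / u * z j)) = q * (q * (z j / u)) by field_simp,
      show q / (z j / (q / u)) = q * (q * (1 / (u * z j))) by field_simp,
      th_mul_self hq hq0 (mul_ne_zero hq0 h1), th_mul_self hq hq0 h1,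
      th_mul_self hq hq0 (mul_ne_zero hq0 h2), th_mul_self hq hq0 h2]
    field_simp
  unfold Gf
  simp_rw [e1, e2, Finset.prod_mul_distrib, Finset.prod_const, Finset.card_univ, Fintype.card_fin]
  have e3 : ∀ a, s a * (q / u) = q * (s a / u) := fun a => by ring
  have e4 : ∀ a, q * (s a / (q / u)) = s a * u := fun a => by field_simp
  have e5 : ∀ a, q * (s a / u) / q = s a / u := fun a => by field_simp
  have e6 : ∀ a, s a / (q / u) = s a * u / q := fun a => by field_simp
  simp_rw [e3, e4, e5, e6]
  have : (q / u) ^ (2 * k + 3) * ((u ^ 6 / q ^ 3) * (u ^ 4 / q ^ 2) ^ k) = u ^ (2 * k + 3) := by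
    rw [div_pow, div_pow, ← pow_mul, ← pow_mul]
    field_simp
    ring
  rw [← this]
  ring

theorem differentiableOn_ellGamma {U : Set ℂ} (hp : ‖p‖ < 1) (hq : ‖q‖ < 1) {Y : ℂ → ℂ}
    (hY : DifferentiableOn ℂ Y U) (h0 : ∀ x ∈ U, Y x ≠ 0) (h1 : ∀ x ∈ U, ‖Y x‖ < 1) :
    DifferentiableOn ℂ (fun x => ellGamma (Y x) p q) U := by
  simp_rw [ellGamma_eq hp hq]
  exact ((differentiable_Ef hp hq).comp_differentiableOn ((differentiableOn_const _).div hY h0)).div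
    ((differentiable_Ef hp hq).comp_differentiableOn hY)
    fun x hx => Ef_ne_zero_of_norm_lt hp hq (h1 x hx)

theorem exists_lt_one_forall_lt {ι : Type*} [Finite ι] (c : ι → ℝ) (hc : ∀ r, c r < 1) :
    ∃ ρ : ℝ, 0 < ρ ∧ ρ < 1 ∧ ∀ r, c r < ρ := by
  have h1 : ∀ᶠ ρ in nhdsWithin (1 : ℝ) (Set.Iio 1), ∀ r, c r < ρ :=
    Filter.eventually_all.2 fun r => nhdsWithin_le_nhds (lt_mem_nhds (hc r))
  have h2 : ∀ᶠ ρ in nhdsWithin (1 : ℝ) (Set.Iio 1), 0 < ρ :=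
    nhdsWithin_le_nhds (lt_mem_nhds zero_lt_one)
  obtain ⟨ρ, ⟨a, b⟩, c⟩ := ((h1.and h2).and self_mem_nhdsWithin).exists
  exact ⟨ρ, b, c, a⟩

theorem differentiableOn_Gf (hp : ‖p‖ < 1) (hq : ‖q‖ < 1) (hq0 : q ≠ 0) {z : Fin k → ℂ}
    (hz : ∀ j, z j ≠ 0) (hs0 : ∀ r, s r ≠ 0) {ρ : ℝ} (hρ : 0 < ρ)
    (h1 : ∀ r, ‖s r‖ < ρ) (h2 : ∀ r ∈ S, ‖s r‖ < ‖q‖ * ρ) :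
    DifferentiableOn ℂ (Gf p q s S z) {u | ‖q‖ * ρ < ‖u‖ ∧ ‖u‖ < 1 / ρ} := by
  have hqn : 0 < ‖q‖ := norm_pos_iff.2 hq0
  have hu : ∀ u ∈ {u : ℂ | ‖q‖ * ρ < ‖u‖ ∧ ‖u‖ < 1 / ρ}, u ≠ 0 := fun u hu => by
    rw [← norm_pos_iff]; exact (by positivity : 0 < ‖q‖ * ρ).trans hu.1
  have hS : ∀ u ∈ {u : ℂ | ‖q‖ * ρ < ‖u‖ ∧ ‖u‖ < 1 / ρ}, ∀ c : ℝ, 0 ≤ c → c < ρ → c * ‖u‖ < 1 := by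
    intro u hu c hc0 hc
    calc c * ‖u‖ ≤ c * (1 / ρ) := by gcongr; exact hu.2.le
      _ < ρ * (1 / ρ) := by gcongr
      _ = 1 := by field_simp
  unfold Gf
  refine (((differentiableOn_id.pow _).mul (DifferentiableOn.fun_finsetProd fun a _ => ?_)).mul
    (DifferentiableOn.fun_finsetProd fun b hb => ?_)).mul
    (DifferentiableOn.mul ?_ (DifferentiableOn.fun_finsetProd fun j _ => ?_))
  · refine (differentiableOn_ellGamma hp hq (by fun_prop) (fun u h => mul_ne_zero (hs0 a) (hu u h))
      fun u h => ?_).mul (differentiableOn_ellGamma hp hq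
      ((differentiableOn_const _).mul ((differentiableOn_const _).div differentiableOn_id hu))
      (fun u h => mul_ne_zero hq0 (div_ne_zero (hs0 a) (hu u h))) fun u h => ?_)
    · rw [norm_mul]; exact hS u h _ (norm_nonneg _) (h1 a)
    · rw [norm_mul, norm_div, ← mul_div_assoc, div_lt_one (norm_pos_iff.2 (hu u h))]
      exact lt_trans (by gcongr; exact h1 a) h.1
  · refine (differentiableOn_ellGamma hp hq (by fun_prop)
      (fun u h => div_ne_zero (mul_ne_zero (hs0 b) (hu u h)) hq0)
      fun u h => ?_).mul (differentiableOn_ellGamma hp hq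
      ((differentiableOn_const _).div differentiableOn_id hu)
      (fun u h => div_ne_zero (hs0 b) (hu u h)) fun u h => ?_)
    · rw [norm_div, norm_mul, mul_div_right_comm]
      refine hS u h _ (by positivity) ?_
      rw [div_lt_iff₀ hqn, mul_comm]; exact h2 b hb
    · rw [norm_div, div_lt_one (norm_pos_iff.2 (hu u h))]
      exact (h2 b hb).trans h.1
  · exact fun u h => ((differentiableAt_th hq (one_div_ne_zero (pow_ne_zero 2 (hu u h)))).comp u
      (f := fun u => 1 / u ^ 2) (by have := hu u h; fun_prop (disch := simpa using this))).differentiableWithinAt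
  · have hj := hz j
    exact fun u h => (((differentiableAt_th hq (one_div_ne_zero (mul_ne_zero (hu u h) hj))).comp u
      (f := fun u => 1 / (u * z j)) (by have := hu u h; fun_prop (disch := simp [*]))).mul
      ((differentiableAt_th hq (div_ne_zero hj (hu u h))).comp u
      (f := fun u => z j / u) (by have := hu u h; fun_prop (disch := simp [*])))).differentiableWithinAt

theorem integral_Gf (hp : ‖p‖ < 1) (hq : ‖q‖ < 1) (hq0 : q ≠ 0) {z : Fin k → ℂ}
    (hz : ∀ j, z j ≠ 0) (hs0 : ∀ r, s r ≠ 0)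
    (h1 : ∀ r, ‖s r‖ < 1) (h2 : ∀ r ∈ S, ‖s r‖ < ‖q‖) :
    ∫ φ in (0 : ℝ)..2 * π, Gf p q s S z (cx φ) = 0 := by
  have hqn : 0 < ‖q‖ := norm_pos_iff.2 hq0
  obtain ⟨ρ, hρ0, hρ1, hρ⟩ := exists_lt_one_forall_lt
    (fun r => max ‖s r‖ (if r ∈ S then ‖s r‖ / ‖q‖ else 0)) (fun r => by
      refine max_lt (h1 r) ?_
      split_ifs with h
      · rw [div_lt_one hqn]; exact h2 r h
      · exact zero_lt_one)
  have hd := differentiableOn_Gf (S := S) hp hq hq0 hz hs0 hρ0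
    (fun r => (le_max_left _ _).trans_lt (hρ r)) (fun r hr => by
      have := (le_max_right _ _).trans_lt (hρ r)
      rw [if_pos hr, div_lt_iff₀ hqn] at this
      linarith)
  have hi : 1 < 1 / ρ := by rw [lt_div_iff₀ hρ0]; linarith
  have e1 := integral_annulus_one hd hq0 (by nlinarith) (hq.trans hi)
    (by nlinarith) hi
  have e2 : ∫ φ in (0 : ℝ)..2 * π, Gf p q s S z (q * cx φ) =
      ∫ φ in (0 : ℝ)..2 * π, -Gf p q s S z (cx φ)⁻¹ :=
    intervalIntegral.integral_congr fun φ _ => by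
      rw [← Gf_antisymm hq hq0 hz (inv_ne_zero (cx_ne_zero φ)), div_inv_eq_mul]
  rw [intervalIntegral.integral_neg, integral_cx_inv] at e2
  rw [e2] at e1
  exact self_eq_neg.1 e1.symm

end antisym

section weights
variable {p q : ℂ}

theorem gam_inv {d : ℕ} (s : Fin d → ℂ) (z : ℂ) : gam p q s z⁻¹ = gam p q s z := by
  unfold gam
  refine Finset.prod_congr rfl fun r _ => ?_
  rw [div_inv_eq_mul, ← div_eq_mul_inv, mul_comm]

theorem ef_inv (hp : ‖p‖ < 1) (hq : ‖q‖ < 1) {z : ℂ} (hz : z ≠ 0) : ef p q z⁻¹ = ef p q z := by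
  have h := pow_ne_zero 2 hz
  unfold ef
  rw [inv_pow, one_div, one_div, th_inv hp h, th_inv hq (inv_ne_zero h)]
  field_simp

theorem Kf_inv (hp : ‖p‖ < 1) (hq : ‖q‖ < 1) {z w : ℂ} (hz : z ≠ 0) (hw : w ≠ 0) :
    Kf p q z⁻¹ w = Kf p q z w := by
  unfold Kf
  rw [show z⁻¹ * w = (z / w)⁻¹ by rw [inv_div]; ring, show z⁻¹ / w = (z * w)⁻¹ by
    rw [mul_inv]; ring, show w / z⁻¹ = (1 / (z * w))⁻¹ by rw [one_div, inv_inv, div_inv_eq_mul, mul_comm],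
    show 1 / (z / w)⁻¹ = (w / z)⁻¹ by rw [inv_div, inv_div, one_div_div],
    th_inv hp (div_ne_zero hz hw), th_inv hp (mul_ne_zero hz hw),
    th_inv hq (div_ne_zero hw hz), th_inv hq (one_div_ne_zero (mul_ne_zero hz hw))]
  field_simp

theorem Wt_cons {n : ℕ} (g : ℂ → ℂ) (u : ℂ) (z : Fin n → ℂ) :
    Wt (n + 1) p q g (Fin.cons u z) = g u * ef p q u * (∏ j, Kf p q u (z j)) * Wt n p q g z := by
  unfold Wt
  rw [pairProd_succ, Fin.prod_univ_succ, Fin.prod_univ_succ]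
  simp only [Fin.cons_zero, Fin.cons_succ]
  ring

theorem Wt_perm {N : ℕ} (hp : ‖p‖ < 1) (hq : ‖q‖ < 1) (g : ℂ → ℂ) {z : Fin N → ℂ}
    (hz : ∀ i, z i ≠ 0) (σ : Equiv.Perm (Fin N)) : Wt N p q g (z ∘ σ) = Wt N p q g z := by
  unfold Wt
  simp only [Function.comp]
  rw [Equiv.prod_comp σ fun i => g (z i), Equiv.prod_comp σ fun i => ef p q (z i),
    pairProd_perm (fun i j => Kf p q (z i) (z j)) fun i j => Kf_comm hp hq (hz i) (hz j)]

theorem Wt_cons_inv {n : ℕ} (hp : ‖p‖ < 1) (hq : ‖q‖ < 1) {d : ℕ} (s : Fin d → ℂ) {u : ℂ}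
    (hu : u ≠ 0) {z : Fin n → ℂ} (hz : ∀ i, z i ≠ 0) :
    Wt (n + 1) p q (gam p q s) (Fin.cons u⁻¹ z) = Wt (n + 1) p q (gam p q s) (Fin.cons u z) := by
  rw [Wt_cons, Wt_cons, gam_inv, ef_inv hp hq hu]
  simp_rw [fun j => Kf_inv hp hq hu (hz j)]

end weights

theorem prod_mul_prod_eq {ι : Type*} {T : Finset ι} {f g h k : ι → ℂ} {c : ℂ}
    (H : ∀ a ∈ T, f a * g a = h a * c * k a) :
    (∏ a ∈ T, f a) * ∏ a ∈ T, g a = (∏ a ∈ T, h a) * c ^ T.card * ∏ a ∈ T, k a := by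
  rw [← Finset.prod_mul_distrib, Finset.prod_congr rfl H, Finset.prod_mul_distrib,
    Finset.prod_mul_distrib, Finset.prod_const]

section reduction
variable {d k : ℕ} {p q : ℂ} {s : Fin d → ℂ} {S : Finset (Fin d)}

/-- The residue coefficient attached to an integration variable. -/
noncomputable def Tf (p q : ℂ) (s : Fin d → ℂ) (S : Finset (Fin d)) (u : ℂ) : ℂ :=
  u * (∏ a ∈ Sᶜ, th p (u / s a)) / ((∏ b ∈ S, th p (u / (p * q / s b))) * th p (u ^ 2))

theorem Tf_mul_Wt (hp : ‖p‖ < 1) (hp0 : p ≠ 0) (hq : ‖q‖ < 1) (hq0 : q ≠ 0)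
    (hd : d = 2 * S.card + 2 * (k + 1)) (hs0 : ∀ r, s r ≠ 0) (h1 : ∀ r, ‖s r‖ < 1)
    (h2 : ∀ r ∈ S, ‖s r‖ < ‖q‖) (h3 : ∀ r ∈ S, ‖p * q‖ < ‖s r‖) {u : ℂ} (hu : ‖u‖ = 1)
    (hu2 : u ^ 2 ≠ 1) {z : Fin k → ℂ} (hz : z ∈ tor k) (hzu : ∀ j, u ≠ z j ∧ u * z j ≠ 1) :
    Tf p q s S u / (∏ j, th p (u * z j) * th p (u / z j)) *
      Wt (k + 1) p q (gam p q s) (Fin.cons u z) =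
    ((∏ a ∈ Sᶜ, -(s a)⁻¹) * ∏ b ∈ S, -(p * q / s b)) *
      (Gf p q s S z u * Wt k p q (gam p q s) z) := by
  have hu0 : u ≠ 0 := norm_ne_zero_iff.1 (by rw [hu]; exact one_ne_zero)
  have eA : ∀ a ∈ Sᶜ, th p (u / s a) * (ellGamma (s a * u) p q * ellGamma (s a / u) p q) =
      -(s a)⁻¹ * u * (ellGamma (s a * u) p q * ellGamma (q * (s a / u)) p q) := fun a _ => by
    rw [ellGamma_shift hp hq hq0 (Ef_ne_zero_of_norm_lt hp hq (by rw [norm_div, hu, div_one]; exact h1 a)),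
      ← inv_div, th_inv hp (div_ne_zero (hs0 a) hu0), inv_div]
    ring
  have eB : ∀ b ∈ S, (th p (u / (p * q / s b)))⁻¹ *
      (ellGamma (s b * u) p q * ellGamma (s b / u) p q) =
      -(p * q / s b) * u⁻¹ * (ellGamma (s b * u / q) p q * ellGamma (s b / u) p q) := fun b hb => by
    have hsb := hs0 b
    have hqn : 0 < ‖q‖ := norm_pos_iff.2 hq0
    have hn : ‖s b * u / q‖ < 1 := by rw [norm_div, norm_mul, hu, mul_one, div_lt_one hqn]; exact h2 b hb
    have hne : th p (s b * u / q) ≠ 0 := by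
      refine th_ne_zero hp ?_ hn.le fun h => ?_
      · rw [norm_div, norm_mul, hu, mul_one, lt_div_iff₀ hqn, ← norm_mul]; exact h3 b hb
      · rw [h, norm_one] at hn; exact lt_irrefl _ hn
    have e := ellGamma_shift hp hq hq0 (Ef_ne_zero_of_norm_lt hp hq hn)
    rw [show q * (s b * u / q) = s b * u by field_simp] at e
    have e' := th_mul_self hp hp0 (x := u / (p * q / s b)) (by positivity)
    rw [show p * (u / (p * q / s b)) = s b * u / q by field_simp] at e'
    rw [e]
    rw [e'] at hne ⊢
    have := right_ne_zero_of_mul hne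
    rw [inv_mul_eq_iff_eq_mul₀ this]
    field_simp
  have hth2 : th p (u ^ 2) ≠ 0 := th_ne_zero hp (by rw [norm_pow, hu, one_pow]; exact hp)
    (by rw [norm_pow, hu, one_pow]) hu2
  have eK : ∀ j, (th p (u * z j) * th p (u / z j))⁻¹ * Kf p q u (z j) =
      th q (1 / (u * z j)) * th q (z j / u) := fun j => by
    have hj0 := tor_ne_zero hz j
    have a1 : th p (u * z j) ≠ 0 := th_ne_zero hp (by rw [norm_mul, hu, hz j, mul_one]; exact hp)
      (by rw [norm_mul, hu, hz j, mul_one]) (hzu j).2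
    have a2 : th p (u / z j) ≠ 0 := th_ne_zero hp (by rw [norm_div, hu, hz j, div_one]; exact hp)
      (by rw [norm_div, hu, hz j, div_one]) fun h => (hzu j).1 ((div_eq_one_iff_eq hj0).1 h)
    unfold Kf
    field_simp
  have gsplit : gam p q s u = (∏ a ∈ Sᶜ, ellGamma (s a * u) p q * ellGamma (s a / u) p q) *
      ∏ b ∈ S, ellGamma (s b * u) p q * ellGamma (s b / u) p q := by
    rw [mul_comm]; exact (Finset.prod_mul_prod_compl S _).symm
  have eef : (th p (u ^ 2))⁻¹ * ef p q u = th q (1 / u ^ 2) := by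
    unfold ef; field_simp
  have PA := prod_mul_prod_eq eA
  have PB := prod_mul_prod_eq eB
  have PK := Finset.prod_congr rfl fun j (_ : j ∈ Finset.univ) => eK j
  rw [Finset.card_compl, Fintype.card_fin] at PA
  rw [Finset.prod_inv_distrib] at PB
  rw [Finset.prod_mul_distrib, Finset.prod_inv_distrib] at PK
  have hpow : u * (u ^ (d - S.card) * u⁻¹ ^ S.card) = u ^ (2 * k + 3) := by
    rw [show d - S.card = (2 * k + 2) + S.card by omega, pow_add _ _ S.card, mul_assoc, ← mul_pow,
      mul_inv_cancel₀ hu0]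
    ring
  rw [Wt_cons, gsplit, Gf, Tf, ← PK, ← hpow, ← eef, div_eq_mul_inv, div_eq_mul_inv, mul_inv]
  linear_combination (u * (th p (u ^ 2))⁻¹ * (∏ x, th p (u * z x) * th p (u / z x))⁻¹ * ef p q u *
    (∏ j, Kf p q u (z j)) * Wt k p q (gam p q s) z) *
    ((∏ b ∈ S, th p (u / (p * q / s b)))⁻¹ *
      (∏ b ∈ S, ellGamma (s b * u) p q * ellGamma (s b / u) p q) * PA +
      (∏ i ∈ Sᶜ, -(s i)⁻¹) * u ^ (d - S.card) *
        (∏ i ∈ Sᶜ, ellGamma (s i * u) p q * ellGamma (q * (s i / u)) p q) * PB)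

theorem continuousOn_Gf_mul_Wt (hp : ‖p‖ < 1) (hq : ‖q‖ < 1) (hq0 : q ≠ 0)
    (hs0 : ∀ r, s r ≠ 0) (h1 : ∀ r, ‖s r‖ < 1) (h2 : ∀ r ∈ S, ‖s r‖ < ‖q‖) :
    ContinuousOn (fun z : Fin (k + 1) → ℂ =>
      Gf p q s S (fun j => z j.succ) (z 0) * Wt k p q (gam p q s) fun j => z j.succ)
      (tor (k + 1)) := by
  have ci : ∀ i, ContinuousOn (fun z : Fin (k + 1) → ℂ => z i) (tor (k + 1)) := fun i => by fun_prop
  have h0 : ∀ i, ∀ z ∈ tor (k + 1), z i ≠ 0 := fun i z hz => tor_ne_zero hz i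
  have hn : ∀ i, ∀ z ∈ tor (k + 1), ‖z i‖ = 1 := fun i z hz => hz i
  have cq : ContinuousOn (fun _ : Fin (k + 1) → ℂ => q) (tor (k + 1)) := continuousOn_const
  have hqn : 0 < ‖q‖ := norm_pos_iff.2 hq0
  refine ContinuousOn.mul ?_ ?_
  · unfold Gf
    refine ((((ci 0).pow _).mul (continuousOn_finsetProd _ fun a _ =>
      (continuousOn_ellGamma hp hq (continuousOn_const.mul (ci 0)) ?_ ?_).mul
      (continuousOn_ellGamma hp hq (continuousOn_const.mul (continuousOn_const.div (ci 0) (h0 0)))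
        ?_ ?_))).mul (continuousOn_finsetProd _ fun b hb =>
      (continuousOn_ellGamma hp hq ((continuousOn_const.mul (ci 0)).div_const _) ?_ ?_).mul
      (continuousOn_ellGamma hp hq (continuousOn_const.div (ci 0) (h0 0)) ?_ ?_))).mul
      ((continuousOn_th cq (continuousOn_const.div ((ci 0).pow 2)
        fun z hz => pow_ne_zero 2 (h0 0 z hz)) (fun _ _ => hq)
        fun z hz => one_div_ne_zero (pow_ne_zero 2 (h0 0 z hz))).mul
      (continuousOn_finsetProd _ fun j _ => (continuousOn_th cq (continuousOn_const.div
        ((ci 0).mul (ci j.succ)) fun z hz => mul_ne_zero (h0 0 z hz) (h0 _ z hz)) (fun _ _ => hq)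
        fun z hz => one_div_ne_zero (mul_ne_zero (h0 0 z hz) (h0 _ z hz))).mul
        (continuousOn_th cq ((ci j.succ).div (ci 0) (h0 0)) (fun _ _ => hq)
        fun z hz => div_ne_zero (h0 _ z hz) (h0 0 z hz))))
    · exact fun z hz => mul_ne_zero (hs0 a) (h0 0 z hz)
    · exact fun z hz => by
        change ‖s a * z 0‖ < 1
        rw [norm_mul, hn 0 z hz, mul_one]; exact h1 a
    · exact fun z hz => mul_ne_zero hq0 (div_ne_zero (hs0 a) (h0 0 z hz))
    · exact fun z hz => norm_mul_lt_one hq (by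
        change ‖s a / z 0‖ < 1
        rw [norm_div, hn 0 z hz, div_one]; exact h1 a)
    · exact fun z hz => div_ne_zero (mul_ne_zero (hs0 b) (h0 0 z hz)) hq0
    · exact fun z hz => by
        change ‖s b * z 0 / q‖ < 1
        rw [norm_div, norm_mul, hn 0 z hz, mul_one, div_lt_one hqn]; exact h2 b hb
    · exact fun z hz => div_ne_zero (hs0 b) (h0 0 z hz)
    · exact fun z hz => by
        change ‖s b / z 0‖ < 1
        rw [norm_div, hn 0 z hz, div_one]; exact h1 b
  · exact (continuousOn_Wt_gam hp hq hs0 h1).comp (by fun_prop) fun z hz j => hz j.succ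

end reduction

section reduction
variable {d m : ℕ} {p q : ℂ} {s : Fin d → ℂ} {S : Finset (Fin d)}

theorem tor_perm {N : ℕ} {z : Fin N → ℂ} (hz : z ∈ tor N) (σ : Equiv.Perm (Fin N)) :
    z ∘ σ ∈ tor N := fun i => hz (σ i)

theorem Generic.perm {N : ℕ} {z : Fin N → ℂ} (hz : Generic z) (σ : Equiv.Perm (Fin N)) :
    Generic (z ∘ σ) :=
  ⟨fun i => hz.1 (σ i), fun _ _ hij => hz.2 _ _ (σ.injective.ne hij)⟩

theorem torusInt_Gf_mul_Wt (hp : ‖p‖ < 1) (hq : ‖q‖ < 1) (hq0 : q ≠ 0) {k : ℕ}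
    (hs0 : ∀ r, s r ≠ 0) (h1 : ∀ r, ‖s r‖ < 1) (h2 : ∀ r ∈ S, ‖s r‖ < ‖q‖) :
    torusInt (k + 1) (fun z => Gf p q s S (fun j => z j.succ) (z 0) *
      Wt k p q (gam p q s) fun j => z j.succ) = 0 := by
  rw [torusInt_succ (continuousOn_Gf_mul_Wt hp hq hq0 hs0 h1 h2),
    torusInt_congr (g := fun _ => 0 * 0), torusInt_const_mul, zero_mul]
  intro z hz
  simp only [Fin.cons_zero, Fin.cons_succ]
  rw [intervalIntegral.integral_mul_const, integral_Gf hp hq hq0 (tor_ne_zero hz) hs0 h1 h2]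
  ring

/-- Signed variable: `z` or its inverse. -/
noncomputable def sgn (ε : Bool) (z : ℂ) : ℂ := if ε then z else z⁻¹

theorem torusInt_residue_eq_zero (hp : ‖p‖ < 1) (hp0 : p ≠ 0) (hq : ‖q‖ < 1) (hq0 : q ≠ 0)
    (hd : d = 2 * S.card + 2 * m) (hs0 : ∀ r, s r ≠ 0) (h1 : ∀ r, ‖s r‖ < 1)
    (h2 : ∀ r ∈ S, ‖s r‖ < ‖q‖) (h3 : ∀ r ∈ S, ‖p * q‖ < ‖s r‖) (i : Fin m) (ε : Bool) :
    ∃ g : (Fin m → ℂ) → ℂ, ContinuousOn g (tor m) ∧ torusInt m g = 0 ∧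
      ∀ z ∈ tor m, Generic z → Tf p q s S (sgn ε (z i)) /
        (∏ j ∈ Finset.univ.erase i, th p (sgn ε (z i) * z j) * th p (sgn ε (z i) / z j)) *
        Wt m p q (gam p q s) z = g z := by
  obtain _ | k := m
  · exact i.elim0
  let σ : Equiv.Perm (Fin (k + 1)) := Equiv.swap 0 i
  let c : ℂ := (∏ a ∈ Sᶜ, -(s a)⁻¹) * ∏ b ∈ S, -(p * q / s b)
  let H : (Fin (k + 1) → ℂ) → ℂ := fun z => c * (Gf p q s S (fun j => z j.succ) (z 0) *
    Wt k p q (gam p q s) fun j => z j.succ)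
  have hHc : ContinuousOn H (tor (k + 1)) :=
    continuousOn_const.mul (continuousOn_Gf_mul_Wt hp hq hq0 hs0 h1 h2)
  have hH0 : torusInt (k + 1) H = 0 := by
    rw [torusInt_const_mul, torusInt_Gf_mul_Wt hp hq hq0 hs0 h1 h2, mul_zero]
  let τ : (Fin (k + 1) → ℂ) → Fin (k + 1) → ℂ := fun z => Fin.cons (sgn ε (z 0)) fun j => z j.succ
  have hτ : ∀ z ∈ tor (k + 1), τ z ∈ tor (k + 1) := fun z hz => by
    refine cons_mem_tor ?_ fun j => hz j.succ
    unfold sgn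
    split_ifs
    · exact hz 0
    · rw [norm_inv, hz 0, inv_one]
  have hτc : ContinuousOn τ (tor (k + 1)) := by
    refine continuousOn_pi.2 fun j => ?_
    refine Fin.cases ?_ (fun j => ?_) j
    · simp only [τ, Fin.cons_zero, sgn]
      split_ifs
      · fun_prop
      · exact ContinuousOn.inv₀ (by fun_prop) fun z hz => tor_ne_zero hz 0
    · simp only [τ, Fin.cons_succ]
      fun_prop
  have hσc : ContinuousOn (fun z : Fin (k + 1) → ℂ => z ∘ σ) (tor (k + 1)) := by
    unfold Function.comp; fun_prop
  have hHτ : torusInt (k + 1) (fun z => H (τ z)) = 0 := by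
    rw [torusInt_succ (f := fun z => H (τ z)) (hHc.comp hτc hτ), ← hH0, torusInt_succ hHc]
    refine torusInt_congr fun z _ => ?_
    simp only [τ, Fin.cons_zero, Fin.cons_succ, sgn]
    split_ifs
    · rfl
    · rw [integral_cx_inv fun w => H (Fin.cons w z)]
  refine ⟨fun z => H (τ (z ∘ σ)), (hHc.comp hτc hτ).comp hσc fun z hz => tor_perm hz σ,
    (torusInt_perm σ fun z => H (τ z)).trans hHτ, fun z hz hgen => ?_⟩
  set w := z ∘ σ with hw
  have hwt : w ∈ tor (k + 1) := tor_perm hz σ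
  have hwg : Generic w := hgen.perm σ
  have hw0 : w 0 = z i := by simp [hw, σ]
  have hprod : ∀ f : ℂ → ℂ, ∏ j ∈ Finset.univ.erase i, f (z j) = ∏ j : Fin k, f (w j.succ) := fun f => by
    have e : ∏ j ∈ Finset.univ.erase i, f (z j) = ∏ j ∈ Finset.univ.erase 0, f (w j) := by
      refine Finset.prod_bij' (fun j _ => σ j) (fun j _ => σ j) ?_ ?_ ?_ ?_ ?_
      · intro j hj
        simp only [Finset.mem_erase, Finset.mem_univ, and_true] at hj ⊢
        exact fun h => hj (by rw [← σ.injective.eq_iff, h]; simp [σ])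
      · intro j hj
        simp only [Finset.mem_erase, Finset.mem_univ, and_true] at hj ⊢
        exact fun h => hj (by rw [← σ.injective.eq_iff, h]; simp [σ])
      · intro j _; simp [σ]
      · intro j _; simp [σ]
      · intro j _; simp [hw, σ]
    rw [e, ← Finset.compl_singleton, ← Fin.image_succ_univ, Finset.prod_image]
    exact (Fin.succ_injective _).injOn
  have hsn : ‖sgn ε (w 0)‖ = 1 := by
    unfold sgn; split_ifs
    · exact hwt 0
    · rw [norm_inv, hwt 0, inv_one]
  have hs2 : sgn ε (w 0) ^ 2 ≠ 1 := by
    unfold sgn; split_ifs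
    · exact hwg.1 0
    · rw [inv_pow]; exact inv_ne_one.2 (hwg.1 0)
  have hw00 := tor_ne_zero hwt 0
  have hsu : ∀ j : Fin k, sgn ε (w 0) ≠ w j.succ ∧ sgn ε (w 0) * w j.succ ≠ 1 := fun j => by
    have h := hwg.2 0 j.succ (Fin.succ_ne_zero j).symm
    have hj := tor_ne_zero hwt j.succ
    unfold sgn; split_ifs
    · exact h
    · refine ⟨fun e => h.2 ?_, fun e => h.1 ?_⟩
      · rw [← e, mul_inv_cancel₀ hw00]
      · rw [inv_mul_eq_one₀ hw00] at e; exact e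
  have hWt : Wt (k + 1) p q (gam p q s) z =
      Wt (k + 1) p q (gam p q s) (Fin.cons (sgn ε (w 0)) fun j => w j.succ) := by
    have e : Fin.cons (w 0) (fun j => w j.succ) = w := Fin.cons_self_tail w
    rw [← Wt_perm hp hq _ (tor_ne_zero hz) σ]
    change Wt (k + 1) p q (gam p q s) w = _
    unfold sgn; split_ifs
    · rw [e]
    · rw [Wt_cons_inv hp hq s hw00 fun j => tor_ne_zero hwt j.succ, e]
  rw [hWt, ← hw0, hprod fun x => th p (sgn ε (w 0) * x) * th p (sgn ε (w 0) / x),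
    Tf_mul_Wt hp hp0 hq hq0 hd hs0 h1 h2 h3 hsn hs2 (fun j => hwt j.succ) hsu]
  rfl

/-- Coefficients of the dual difference relation. -/
noncomputable def rd (p q : ℂ) (s : Fin d → ℂ) (S : Finset (Fin d)) (r : Fin d) : ℂ :=
  p * q / s r * (∏ a ∈ Sᶜ, th p (p * q / s r / s a)) / ∏ b ∈ S.erase r, th p (s b / s r)

theorem disjSum_erase_inl {α β : Type*} [DecidableEq α] [DecidableEq β] (S : Finset α)
    (T : Finset β) (r : α) : (S.disjSum T).erase (Sum.inl r) = (S.erase r).disjSum T := by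
  ext (x | x) <;> simp

theorem disjSum_erase_inr {α β : Type*} [DecidableEq α] [DecidableEq β] (S : Finset α)
    (T : Finset β) (r : β) : (S.disjSum T).erase (Sum.inr r) = S.disjSum (T.erase r) := by
  ext (x | x) <;> simp

theorem prod_erase_bool (f : Fin m × Bool → ℂ) (i : Fin m) (ε : Bool) :
    ∏ x ∈ Finset.univ.erase (i, ε), f x =
      f (i, !ε) * ∏ j ∈ Finset.univ.erase i, f (j, true) * f (j, false) := by
  have : Finset.univ.erase (i, ε) =
      insert (i, !ε) ((Finset.univ.erase i) ×ˢ (Finset.univ : Finset Bool)) := by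
    ext ⟨j, η⟩
    simp only [Finset.mem_erase, Finset.mem_insert, Finset.mem_product, Finset.mem_univ, and_true, ne_eq,
      Prod.mk.injEq]
    by_cases h : j = i <;> cases ε <;> cases η <;> simp [h]
  rw [this, Finset.prod_insert (by simp), Finset.prod_product]
  simp

theorem sgn_cases {z : ℂ} {P : ℂ → Prop} (h1 : P z) (h2 : P z⁻¹) (ε : Bool) : P (sgn ε z) := by
  cases ε
  · exact h2
  · exact h1

theorem sgn_eq_sgn {ε η : Bool} {z w : ℂ} (hz : z ≠ 0) (hw : w ≠ 0) (h : sgn ε z = sgn η w) :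
    (ε = η ∧ z = w) ∨ z * w = 1 := by
  cases ε <;> cases η <;> simp only [sgn, if_true, Bool.false_eq_true, if_false] at h
  · exact Or.inl ⟨rfl, inv_injective h⟩
  · exact Or.inr (by rw [← h, mul_inv_cancel₀ hz])
  · exact Or.inr (by rw [h, inv_mul_cancel₀ hw])
  · exact Or.inl ⟨rfl, h⟩

theorem sum_rd_mul_pointwise (hp : ‖p‖ < 1) (hp0 : p ≠ 0) (hq0 : q ≠ 0) (hS : S.Nonempty)
    (hd : d = 2 * S.card + 2 * m) (hs0 : ∀ r, s r ≠ 0)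
    (h2 : ∀ r ∈ S, ‖s r‖ < ‖q‖) (h3 : ∀ r ∈ S, ‖p * q‖ < ‖s r‖)
    (hbal : p * ∏ r, s r = (p * q) ^ S.card)
    (hne : ∀ r ∈ S, ∀ b ∈ S, r ≠ b → th p (s b / s r) ≠ 0) {z : Fin m → ℂ} (hz : z ∈ tor m)
    (hg : Generic z) :
    ∑ r ∈ S, rd p q s S r / (∏ i, th p (p * q / s r / z i) * th p (p * q / s r * z i)) +
      ∑ i : Fin m, ∑ ε : Bool, Tf p q s S (sgn ε (z i)) /
        (∏ j ∈ Finset.univ.erase i, th p (sgn ε (z i) * z j) * th p (sgn ε (z i) / z j)) = 0 := by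
  have hpq : p * q ≠ 0 := mul_ne_zero hp0 hq0
  let x : Fin d ⊕ (Fin m × Bool) → ℂ := Sum.elim (fun r => p * q / s r) fun i => sgn i.2 (z i.1)
  have hz0 := tor_ne_zero hz
  have hz1 : ∀ i ε, ‖sgn ε (z i)‖ = 1 := fun i ε =>
    sgn_cases (P := fun w => ‖w‖ = 1) (hz i) (by rw [norm_inv, hz i, inv_one]) ε
  have hx : ∀ r, x r ≠ 0 := by
    rintro (r | ⟨i, ε⟩)
    · exact div_ne_zero hpq (hs0 r)
    · exact norm_ne_zero_iff.1 (by simp [x, hz1])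
  have hxn : ∀ r ∈ S, ‖p‖ < ‖p * q / s r‖ ∧ ‖p * q / s r‖ < 1 := fun r hr => by
    have := norm_pos_iff.2 (hs0 r)
    have := norm_pos_iff.2 hp0
    rw [norm_div, lt_div_iff₀ (by assumption), div_lt_one (by assumption)]
    exact ⟨by rw [norm_mul]; gcongr; exact h2 r hr, h3 r hr⟩
  have key := sum_mul_th_eq_zero hp hp0 (x := x) hx (y := s) hs0
    (S := S.disjSum (Finset.univ : Finset (Fin m × Bool))) (T := Sᶜ)
    (by
      rw [Finset.card_disjSum, Finset.card_compl]; simp; omega)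
    (by
      rw [← Finset.card_pos, Finset.card_compl, Fintype.card_fin]
      have := hS.card_pos; omega)
    (by
      have hdiv : ∀ r ∈ S, ∀ i ε, th p (p * q / s r / sgn ε (z i)) ≠ 0 := fun r hr i ε =>
        th_ne_zero hp (by rw [norm_div, hz1, div_one]; exact (hxn r hr).1)
          (by rw [norm_div, hz1, div_one]; exact (hxn r hr).2.le) fun h => by
            have := congrArg norm h
            rw [norm_div, hz1, div_one, norm_one] at this
            exact (hxn r hr).2.ne this
      rintro (r | ⟨i, ε⟩) hr (b | ⟨j, η⟩) hb hrb
      · have := hne r (by simpa using hr) b (by simpa using hb) (by simpa using hrb)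
        simp only [x, Sum.elim_inl]
        rwa [div_div_div_cancel_left' _ _ hpq]
      · exact hdiv r (by simpa using hr) j η
      · have := hdiv b (by simpa using hb) i ε
        rw [← inv_div, th_inv hp (div_ne_zero (hx (Sum.inl b)) (hx (Sum.inr (i, ε))))]
        exact mul_ne_zero (neg_ne_zero.2 (inv_ne_zero
          (div_ne_zero (hx (Sum.inl b)) (hx (Sum.inr (i, ε)))))) this
      · have hj : sgn η (z j) ≠ 0 := hx (Sum.inr (j, η))
        simp only [x, Sum.elim_inr]
        refine th_ne_zero hp (by rw [norm_div, hz1, hz1, div_one]; exact hp)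
          (by rw [norm_div, hz1, hz1, div_one]) fun h => ?_
        rw [div_eq_one_iff_eq hj] at h
        rcases sgn_eq_sgn (hz0 i) (hz0 j) h with ⟨he, h⟩ | h
        · exact (hg.2 i j fun hij => hrb (by rw [hij, he])).1 h
        · by_cases hij : i = j
          · subst hij; exact hg.1 i (by rw [sq, h])
          · exact (hg.2 i j hij).2 h)
    (by
      rw [Finset.prod_disjSum, Fintype.prod_prod_type]
      simp only [x, Sum.elim_inl, Sum.elim_inr, Fintype.prod_bool, sgn, if_true, Bool.false_eq_true,
        if_false]
      rw [Finset.prod_eq_one (f := fun i => z i * (z i)⁻¹) fun i _ => mul_inv_cancel₀ (hz0 i), mul_one,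
        Finset.prod_div_distrib, Finset.prod_const, ← hbal, ← Finset.prod_mul_prod_compl S]
      have : ∏ r ∈ S, s r ≠ 0 := Finset.prod_ne_zero_iff.2 fun r _ => hs0 r
      field_simp)
  rw [Finset.sum_disjSum] at key
  simp_rw [disjSum_erase_inl, disjSum_erase_inr, Finset.prod_disjSum, Fintype.sum_prod_type,
    Fintype.prod_prod_type, prod_erase_bool] at key
  simp only [x, Sum.elim_inl, Sum.elim_inr, Fintype.prod_bool] at key
  rw [← key]
  congr 1
  · refine Finset.sum_congr rfl fun r _ => ?_
    simp only [sgn, if_true, Bool.false_eq_true, if_false, div_inv_eq_mul]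
    rw [rd, div_div]
    congr 2
    exact Finset.prod_congr rfl fun b _ => by rw [div_div_div_cancel_left' _ _ hpq]
  · refine Finset.sum_congr rfl fun i _ => Finset.sum_congr rfl fun ε _ => ?_
    rw [Tf, div_div]
    congr 1
    rw [mul_assoc]
    congr 2
    · have := hz0 i
      cases ε <;> simp [sgn, sq, div_eq_mul_inv]
    · refine Finset.prod_congr rfl fun j _ => ?_
      simp only [sgn, if_true, Bool.false_eq_true, if_false, div_inv_eq_mul]
      ring

theorem gam_update_div (hp : ‖p‖ < 1) (hq : ‖q‖ < 1) (hp0 : p ≠ 0) (hq0 : q ≠ 0) (hs0 : ∀ r, s r ≠ 0)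
    {r : Fin d} (h2 : ‖s r‖ < ‖q‖) {z : ℂ} (hz : ‖z‖ = 1) :
    th p (p * q / s r / z) * th p (p * q / s r * z) *
      gam p q (Function.update s r (s r / q)) z = gam p q s z := by
  have hn : ‖s r / q‖ < 1 := by rw [norm_div, div_lt_one (norm_pos_iff.2 hq0)]; exact h2
  have hz0 : z ≠ 0 := norm_ne_zero_iff.1 (by rw [hz]; exact one_ne_zero)
  have hr := hs0 r
  have h := gam_update_mul hp hq hq0 (Function.update s r (s r / q)) r
    (by rwa [Function.update_self]) hz
  rw [Function.update_self, Function.update_idem, mul_div_cancel₀ _ hq0, Function.update_eq_self] at h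
  rw [h, ← th_div_self hp0 (s r / q * z), ← th_div_self hp0 (s r / q / z),
    show p / (s r / q * z) = p * q / s r / z by field_simp,
    show p / (s r / q / z) = p * q / s r * z by field_simp]

/-- Dual difference relation in the parameters of a `BC_m` integral. -/
theorem sum_rd_mul_torusInt (hp : ‖p‖ < 1) (hp0 : p ≠ 0) (hq : ‖q‖ < 1) (hq0 : q ≠ 0)
    (hd : d = 2 * S.card + 2 * m) (hs0 : ∀ r, s r ≠ 0) (h1 : ∀ r, ‖s r‖ < 1)
    (h2 : ∀ r ∈ S, ‖s r‖ < ‖q‖) (h3 : ∀ r ∈ S, ‖p * q‖ < ‖s r‖)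
    (hbal : p * ∏ r, s r = (p * q) ^ S.card)
    (hne : ∀ r ∈ S, ∀ b ∈ S, r ≠ b → th p (s b / s r) ≠ 0) :
    ∑ r ∈ S, rd p q s S r *
      torusInt m (Wt m p q (gam p q (Function.update s r (s r / q)))) = 0 := by
  rcases S.eq_empty_or_nonempty with rfl | hS
  · simp
  have hqn : 0 < ‖q‖ := norm_pos_iff.2 hq0
  have hpq : p * q ≠ 0 := mul_ne_zero hp0 hq0
  choose g hgc hg0 hg using torusInt_residue_eq_zero hp hp0 hq hq0 hd hs0 h1 h2 h3
  let f : Fin d → (Fin m → ℂ) → ℂ := fun r z =>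
    rd p q s S r * Wt m p q (gam p q (Function.update s r (s r / q))) z
  have hfc : ∀ r ∈ S, ContinuousOn (f r) (tor m) := fun r hr =>
    continuousOn_const.mul (continuousOn_Wt_gam hp hq (update_ne_zero hs0 r (div_ne_zero (hs0 r) hq0))
      (norm_update_lt h1 r (by rw [norm_div, div_lt_one hqn]; exact h2 r hr)))
  have e1 : ∑ r ∈ S, rd p q s S r * torusInt m (Wt m p q (gam p q (Function.update s r (s r / q)))) =
      torusInt m fun z => ∑ r ∈ S, f r z := by
    rw [torusInt_sum S f hfc]
    exact Finset.sum_congr rfl fun r _ => (torusInt_const_mul m _ _).symm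
  have e2 : torusInt m (fun z => ∑ x : Fin m × Bool, (-1) * g x.1 x.2 z) = 0 := by
    rw [torusInt_sum Finset.univ (fun (x : Fin m × Bool) z => (-1) * g x.1 x.2 z)
      fun x _ => continuousOn_const.mul (hgc x.1 x.2)]
    simp_rw [torusInt_const_mul, hg0, mul_zero, Finset.sum_const_zero]
  rw [e1, ← e2]
  refine torusInt_congr_generic fun z hz hgen => ?_
  have hpt := sum_rd_mul_pointwise hp hp0 hq0 hS hd hs0 h2 h3 hbal hne hz hgen
  have e3 : ∀ r ∈ S, f r z = rd p q s S r /
      (∏ i, th p (p * q / s r / z i) * th p (p * q / s r * z i)) * Wt m p q (gam p q s) z := fun r hr => by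
    have hx : ∀ w, ‖w‖ = 1 → th p (p * q / s r * w) ≠ 0 := fun w hw => by
      have hsr := norm_pos_iff.2 (hs0 r)
      have hlt : ‖p * q / s r * w‖ < 1 := by
        rw [norm_mul, hw, mul_one, norm_div, div_lt_one hsr]; exact h3 r hr
      refine th_ne_zero hp ?_ hlt.le fun h => by rw [h, norm_one] at hlt; exact lt_irrefl _ hlt
      rw [norm_mul, hw, mul_one, norm_div, lt_div_iff₀ hsr, norm_mul]
      have := norm_pos_iff.2 hp0
      gcongr
      exact h2 r hr
    have hprod : ∏ i, th p (p * q / s r / z i) * th p (p * q / s r * z i) ≠ 0 :=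
      Finset.prod_ne_zero_iff.2 fun i _ => mul_ne_zero
        (by rw [div_eq_mul_inv _ (z i)]; exact hx _ (by rw [norm_inv, hz i, inv_one])) (hx _ (hz i))
    rw [Wt_congr (g := gam p q s) (h := fun w => th p (p * q / s r / w) * th p (p * q / s r * w) *
      gam p q (Function.update s r (s r / q)) w) fun i => (gam_update_div hp hq hp0 hq0 hs0 (h2 r hr) (hz i)).symm,
      Wt_mul m p q _ fun w => th p (p * q / s r / w) * th p (p * q / s r * w)]
    simp only [f]
    rw [← mul_assoc, div_mul_cancel₀ _ hprod]
  rw [Finset.sum_congr rfl e3, ← Finset.sum_mul, eq_neg_of_add_eq_zero_left hpt, ← Finset.mul_sum,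
    Fintype.sum_prod_type, neg_mul, neg_one_mul, Finset.sum_mul]
  congr 1
  refine Finset.sum_congr rfl fun i _ => ?_
  rw [Finset.sum_mul]
  exact Finset.sum_congr rfl fun ε _ => hg i ε z hz hgen

end reduction

section
variable {d : ℕ} {p q : ℂ}

/-- The prefactor of the transformation. -/
noncomputable def pref (p q : ℂ) (t : Fin d → ℂ) : ℂ :=
  pairProd fun i j => ellGamma (t i * t j) p q

theorem pref_update_mul (hp : ‖p‖ < 1) (hq : ‖q‖ < 1) (hq0 : q ≠ 0) {t : Fin d → ℂ}
    (ht : ∀ r, ‖t r‖ < 1) (r : Fin d) :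
    pref p q (Function.update t r (q * t r)) =
      (∏ s ∈ Finset.univ.erase r, th p (t r * t s)) * pref p q t := by
  have h : ∀ i j, ellGamma (q * (t i * t j)) p q = th p (t i * t j) * ellGamma (t i * t j) p q :=
    fun i j => ellGamma_shift hp hq hq0
      (Ef_ne_zero_of_norm_lt hp hq (norm_mul_lt_one (ht i) (ht j)))
  rw [← pairProd_star r fun s => th p (t r * t s)]
  unfold pref
  rw [← pairProd_mul]
  refine pairProd_congr fun i j hij => ?_
  by_cases hi : i = r
  · subst hi
    rw [if_pos rfl, Function.update_self, Function.update_of_ne hij.ne', mul_assoc, h]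
  · rw [if_neg hi, Function.update_of_ne hi]
    by_cases hj : j = r
    · subst hj
      rw [if_pos rfl, Function.update_self, mul_left_comm, h, mul_comm (t j)]
    · rw [if_neg hj, Function.update_of_ne hj, one_mul]

/-- The difference of the two sides of the transformation. -/
noncomputable def defect (n m d : ℕ) (p q ω : ℂ) (t : Fin d → ℂ) : ℂ :=
  I_BC n d t p q - pref p q t * I_BC m d (fun r => ω / t r) p q

theorem br_ne_zero_iff {a b : ℂ} (ha : a ≠ 0) :
    br p a b ≠ 0 ↔ th p (a * b) ≠ 0 ∧ th p (a / b) ≠ 0 := by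
  simp [br, ha]

theorem sum_rc_mul_defect {n m : ℕ} {ω : ℂ} (hp : ‖p‖ < 1) (hp0 : p ≠ 0) (hq : ‖q‖ < 1)
    (hq0 : q ≠ 0) (hω : ω ^ 2 = p * q) {t : Fin d → ℂ} {S : Finset (Fin d)} (hS : S.card = n + 2)
    (hd : d = 2 * S.card + 2 * m)
    (h1 : ∀ r, ‖t r‖ < 1) (h1' : ∀ r, ‖ω‖ < ‖t r‖) (h2 : ∀ r ∈ S, ‖ω / t r‖ < ‖q‖)
    (hbal : p * ∏ r, ω / t r = (p * q) ^ S.card)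
    (hne : ∀ r ∈ S, ∀ s ∈ S, r ≠ s → br p (t r) (t s) ≠ 0) :
    ∑ r ∈ S, rc n p t S r * defect n m d p q ω (Function.update t r (q * t r)) = 0 := by
  have hω0 : ω ≠ 0 := fun h => mul_ne_zero hp0 hq0 (by rw [← hω, h]; simp)
  have ht0 : ∀ r, t r ≠ 0 := fun r h => by
    have := h1' r; rw [h, norm_zero] at this; exact absurd this (not_lt.2 (norm_nonneg _))
  have key1 := sum_rc_mul_I_BC hp hp0 hq hq0 ht0 h1 hS hne
  have hs1 : ∀ r, ‖ω / t r‖ < 1 := fun r => by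
    rw [norm_div, div_lt_one (norm_pos_iff.2 (ht0 r))]; exact h1' r
  have key2 := sum_rd_mul_torusInt (m := m) hp hp0 hq hq0 hd (fun r => div_ne_zero hω0 (ht0 r)) hs1 h2
    (fun r hr => by
      rw [← hω, norm_pow, norm_div, lt_div_iff₀ (norm_pos_iff.2 (ht0 r)), pow_two, mul_assoc]
      have := norm_pos_iff.2 hω0
      refine mul_lt_of_lt_one_right this (lt_of_le_of_lt ?_ (((h1' r).trans (h1 r))))
      exact mul_le_of_le_one_right (norm_nonneg _) (h1 r).le) hbal
    (fun r hr b hb hrb => by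
      rw [div_div_div_cancel_left' _ _ hω0]
      exact ((br_ne_zero_iff (ht0 r)).1 (hne r hr b hb hrb)).2)
  have hup : ∀ r, (fun x => ω / Function.update t r (q * t r) x) =
      Function.update (fun x => ω / t x) r (ω / t r / q) := fun r => by
    funext x
    rcases eq_or_ne x r with rfl | hx
    · simp only [Function.update_self]; rw [div_div, mul_comm q]
    · simp only [Function.update_of_ne hx]
  have hrd : ∀ r ∈ S, rd p q (fun x => ω / t x) S r =
      ω * (rc n p t S r * ∏ s ∈ Finset.univ.erase r, th p (t r * t s)) := fun r hr => by
    have e1 : Finset.univ.erase r = Sᶜ ∪ S.erase r := by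
      ext x; simp only [Finset.mem_erase, Finset.mem_univ, Finset.mem_union, Finset.mem_compl]
      by_cases h : x = r <;> simp [h, hr, em']
    have e2 : Disjoint Sᶜ (S.erase r) := by
      refine Finset.disjoint_left.2 fun x hx hx' => ?_
      exact (Finset.mem_compl.1 hx) (Finset.mem_of_mem_erase hx')
    have e3 : ∀ s ∈ S.erase r, th p (t r * t s) ≠ 0 ∧ th p (t r / t s) ≠ 0 := fun s hs =>
      (br_ne_zero_iff (ht0 r)).1 (hne r hr s (Finset.mem_of_mem_erase hs)
        (Finset.ne_of_mem_erase hs).symm)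
    have a1 : ∏ s ∈ S.erase r, th p (t r * t s) ≠ 0 := Finset.prod_ne_zero_iff.2 fun s hs => (e3 s hs).1
    have a2 : ∏ s ∈ S.erase r, th p (t r / t s) ≠ 0 := Finset.prod_ne_zero_iff.2 fun s hs => (e3 s hs).2
    rw [e1, Finset.prod_union e2, rd, rc]
    unfold br
    rw [Finset.prod_mul_distrib, Finset.prod_mul_distrib, Finset.prod_const,
      Finset.card_erase_of_mem hr, hS]
    have e4 : ∀ b, ω / t b / (ω / t r) = t r / t b := fun b => div_div_div_cancel_left' _ _ hω0
    have e5 : ∀ a, p * q / (ω / t r) / (ω / t a) = t r * t a := fun a => by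
      rw [← hω]; field_simp
    have e6 : p * q / (ω / t r) = ω * t r := by rw [← hω]; field_simp
    simp_rw [e4, e5, e6, show n + 2 - 1 = n + 1 from rfl]
    have := ht0 r
    field_simp
    rw [one_div, inv_pow, pow_succ, ← div_eq_mul_inv]
    field_simp
  have : ∀ r ∈ S, rc n p t S r * defect n m d p q ω (Function.update t r (q * t r)) =
      rc n p t S r * I_BC n d (Function.update t r (q * t r)) p q -
      ω⁻¹ * pref p q t * nrm m p q * (rd p q (fun x => ω / t x) S r * torusInt m (Wt m p q
        (gam p q (Function.update (fun x => ω / t x) r (ω / t r / q))))) := fun r hr => by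
    rw [defect, hup, I_BC_eq (N := m) hp hq, pref_update_mul hp hq hq0 h1, hrd r hr, mul_sub]
    congr 1
    field_simp
  rw [Finset.sum_congr rfl this, Finset.sum_sub_distrib, ← Finset.mul_sum, key1, key2, mul_zero,
    sub_zero]
end

/-- A ratio of two double products. -/
noncomputable def Rf (p q y x : ℂ) : ℂ := Ef p q y / Ef p q x

section
variable {X : Type*} [TopologicalSpace X] {K : Set X} {P Y Z : X → ℂ} {q : ℂ}

theorem continuousOn_Rf (hq : ‖q‖ < 1) (hP : ContinuousOn P K) (hY : ContinuousOn Y K)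
    (hZ : ContinuousOn Z K) (h : ∀ x ∈ K, ‖P x‖ < 1) (h1 : ∀ x ∈ K, ‖Z x‖ < 1) :
    ContinuousOn (fun x => Rf (P x) q (Y x) (Z x)) K :=
  (continuousOn_Ef hq hP hY h).div (continuousOn_Ef hq hP hZ h)
    fun x hx => Ef_ne_zero_of_norm_lt (h x hx) hq (h1 x hx)

theorem differentiableOn_Rf {P Y Z : ℂ → ℂ} {U : Set ℂ} (hq : ‖q‖ < 1) (hU : IsOpen U)
    (hP : DifferentiableOn ℂ P U) (hY : DifferentiableOn ℂ Y U)
    (hZ : DifferentiableOn ℂ Z U) (h : ∀ x ∈ U, ‖P x‖ < 1) (h1 : ∀ x ∈ U, ‖Z x‖ < 1) :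
    DifferentiableOn ℂ (fun x => Rf (P x) q (Y x) (Z x)) U :=
  (differentiableOn_Ef hq hU hP hY h).div (differentiableOn_Ef hq hU hP hZ h)
    fun x hx => Ef_ne_zero_of_norm_lt (h x hx) hq (h1 x hx)
end

/-- The domain of the parameters `(P, v, a)`. -/
def Dom {M : ℕ} (κ P : ℂ) (v a : Fin M → ℂ) : Prop :=
  ‖P‖ < 1 ∧ (∀ i, ‖P * κ‖ < ‖v i‖ ∧ ‖v i‖ < 1) ∧ ∀ i, ‖P * κ‖ < ‖a i‖ ∧ ‖a i‖ < 1

section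
variable {M : ℕ} {κ q P : ℂ} {v a : Fin M → ℂ}

theorem Dom.symm (h : Dom κ P v a) : Dom κ P a v := ⟨h.1, h.2.2, h.2.1⟩

theorem Dom.v_ne_zero (h : Dom κ P v a) (i : Fin M) : v i ≠ 0 :=
  norm_pos_iff.1 ((norm_nonneg _).trans_lt (h.2.1 i).1)

theorem Dom.norm_sq_lt (h : Dom κ P v a) : ‖P ^ 2‖ < 1 := by
  rw [norm_pow]; exact pow_lt_one₀ (norm_nonneg _) h.1 two_ne_zero

theorem Dom.norm_div_lt (h : Dom κ P v a) (i : Fin M) : ‖P * κ / v i‖ < 1 := by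
  rw [norm_div, div_lt_one (norm_pos_iff.2 (h.v_ne_zero i))]; exact (h.2.1 i).1

/-- The one-body weight, regular at `P = 0`. -/
noncomputable def gw (κ q P : ℂ) (v a : Fin M → ℂ) (z : ℂ) : ℂ :=
  (∏ i, Rf (P ^ 2) q (P ^ 2 * q / (v i * z)) (v i * z) *
    Rf (P ^ 2) q (P ^ 2 * q / (v i / z)) (v i / z)) *
  ∏ i, Rf (P ^ 2) q (P * κ * a i / z) (P * κ / a i * z) *
    Rf (P ^ 2) q (P * κ * a i * z) (P * κ / a i / z)

/-- The prefactor, regular at `P = 0`. -/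
noncomputable def Pf (κ q P : ℂ) (v a : Fin M → ℂ) : ℂ :=
  (pairProd fun i j => Rf (P ^ 2) q (P ^ 2 * q / (v i * v j)) (v i * v j)) *
  (∏ i, ∏ j, Rf (P ^ 2) q (P * κ * a j / v i) (v i * (P * κ / a j))) *
  pairProd fun i j => Rf (P ^ 2) q (a i * a j) (P * κ / a i * (P * κ / a j))

/-- The integral, regular at `P = 0`. -/
noncomputable def Lf (N : ℕ) (κ q P : ℂ) (v a : Fin M → ℂ) : ℂ :=
  nrm N (P ^ 2) q * torusInt N (Wt N (P ^ 2) q (gw κ q P v a))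

/-- The defect of the transformation, regular at `P = 0`. -/
noncomputable def Df (N : ℕ) (κ q P : ℂ) (v a : Fin M → ℂ) : ℂ :=
  Lf N κ q P v a - Pf κ q P v a * Lf N κ q P a v

theorem ellGamma_eq_Rf {p q : ℂ} (hp : ‖p‖ < 1) (hq : ‖q‖ < 1) (x : ℂ) :
    ellGamma x p q = Rf p q (p * q / x) x := ellGamma_eq hp hq x

theorem gam_append (hκ : κ ^ 2 = q) (hP : P ≠ 0) (hκ0 : κ ≠ 0) (hq : ‖q‖ < 1) (h : Dom κ P v a)
    {z : ℂ} (hz : z ≠ 0) :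
    gam (P ^ 2) q (Fin.append v fun i => P * κ / a i) z = gw κ q P v a z := by
  unfold gam gw
  rw [Fin.prod_univ_add]
  simp only [Fin.append_left, Fin.append_right, ellGamma_eq_Rf h.norm_sq_lt hq]
  congr 1
  refine Finset.prod_congr rfl fun i _ => ?_
  have := h.symm.v_ne_zero i
  congr 2 <;> (rw [← hκ]; field_simp)

theorem gam_append' (hκ : κ ^ 2 = q) (hP : P ≠ 0) (hκ0 : κ ≠ 0) (hq : ‖q‖ < 1) (h : Dom κ P v a)
    {z : ℂ} (hz : z ≠ 0) :
    gam (P ^ 2) q (fun r => P * κ / Fin.append v (fun i => P * κ / a i) r) z = gw κ q P a v z := by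
  rw [← gam_append hκ hP hκ0 hq h.symm hz]
  unfold gam
  rw [Fin.prod_univ_add, Fin.prod_univ_add, mul_comm]
  simp only [Fin.append_left, Fin.append_right]
  congr 1
  refine Finset.prod_congr rfl fun i _ => ?_
  have := h.symm.v_ne_zero i
  rw [div_div_cancel₀ (mul_ne_zero hP hκ0)]

theorem pref_append (hκ : κ ^ 2 = q) (hP : P ≠ 0) (hκ0 : κ ≠ 0) (hq : ‖q‖ < 1) (h : Dom κ P v a) :
    pref (P ^ 2) q (Fin.append v fun i => P * κ / a i) = Pf κ q P v a := by
  unfold pref Pf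
  rw [pairProd_append]
  simp only [Fin.append_left, Fin.append_right, ellGamma_eq_Rf h.norm_sq_lt hq]
  congr 1
  · congr 1
    refine Finset.prod_congr rfl fun i _ => Finset.prod_congr rfl fun j _ => ?_
    have := h.symm.v_ne_zero j
    have := h.v_ne_zero i
    congr 1; rw [← hκ]; field_simp
  · refine pairProd_congr fun i j _ => ?_
    have := h.symm.v_ne_zero j
    have := h.symm.v_ne_zero i
    congr 1; rw [← hκ]; field_simp

theorem defect_append (N : ℕ) (hκ : κ ^ 2 = q) (hP : P ≠ 0) (hκ0 : κ ≠ 0) (hq : ‖q‖ < 1)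
    (h : Dom κ P v a) :
    defect N N (M + M) (P ^ 2) q (P * κ) (Fin.append v fun i => P * κ / a i) =
      Df N κ q P v a := by
  rw [defect, I_BC_eq h.norm_sq_lt hq, I_BC_eq h.norm_sq_lt hq, pref_append hκ hP hκ0 hq h, Df, Lf, Lf]
  congr 2
  · exact torusInt_congr fun z hz => Wt_congr fun i =>
      gam_append hκ hP hκ0 hq h (tor_ne_zero hz i)
  · congr 1
    exact torusInt_congr fun z hz => Wt_congr fun i =>
      gam_append' hκ hP hκ0 hq h (tor_ne_zero hz i)

theorem Pf_self (hq : ‖q‖ < 1) (hκ : κ ^ 2 = q) (h : Dom κ P v v) : Pf κ q P v v = 1 := by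
  have hd : ∀ i j, Ef (P ^ 2) q (v i * (P * κ / v j)) ≠ 0 := fun i j =>
    Ef_ne_zero_of_norm_lt h.norm_sq_lt hq (norm_mul_lt_one (h.2.1 i).2 (h.norm_div_lt j))
  have e1 : (∏ i, ∏ j, Rf (P ^ 2) q (P * κ * v j / v i) (v i * (P * κ / v j))) = 1 := by
    unfold Rf
    simp_rw [Finset.prod_div_distrib]
    rw [Finset.prod_comm, div_eq_one_iff_eq]
    · refine Finset.prod_congr rfl fun i _ => Finset.prod_congr rfl fun j _ => ?_
      congr 1; ring
    · exact Finset.prod_ne_zero_iff.2 fun i _ => Finset.prod_ne_zero_iff.2 fun j _ => hd i j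
  unfold Pf
  rw [e1, mul_one, ← pairProd_mul]
  unfold pairProd
  refine Finset.prod_eq_one fun i _ => Finset.prod_eq_one fun j _ => ?_
  split_ifs
  · simp only [Rf]
    rw [show P * κ / v i * (P * κ / v j) = P ^ 2 * q / (v i * v j) by
      rw [← hκ, div_mul_div_comm]; ring]
    have h1 := Ef_ne_zero_of_norm_lt h.norm_sq_lt hq (norm_mul_lt_one (h.2.1 i).2 (h.2.1 j).2)
    have h2 := Ef_ne_zero_of_norm_lt h.norm_sq_lt hq (norm_mul_lt_one (h.norm_div_lt i) (h.norm_div_lt j))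
    rw [show P * κ / v i * (P * κ / v j) = P ^ 2 * q / (v i * v j) by
      rw [← hκ, div_mul_div_comm]; ring] at h2
    rw [div_mul_div_comm, mul_comm, div_self (mul_ne_zero h1 h2)]
  · rfl

theorem Df_self (N : ℕ) (hq : ‖q‖ < 1) (hκ : κ ^ 2 = q) (h : Dom κ P v v) : Df N κ q P v v = 0 := by
  rw [Df, Pf_self hq hκ h, one_mul, sub_self]

theorem Pf_perm (σ : Equiv.Perm (Fin M)) : Pf κ q P v (a ∘ σ) = Pf κ q P v a := by
  unfold Pf
  congr 1
  · congr 1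
    refine Finset.prod_congr rfl fun i _ => ?_
    exact Equiv.prod_comp σ fun j => Rf (P ^ 2) q (P * κ * a j / v i) (v i * (P * κ / a j))
  · refine pairProd_perm (fun i j => Rf (P ^ 2) q (a i * a j) (P * κ / a i * (P * κ / a j)))
      (fun i j => ?_) σ
    rw [mul_comm (a i), mul_comm (P * κ / a i)]

theorem Df_perm (N : ℕ) (σ : Equiv.Perm (Fin M)) : Df N κ q P v (a ∘ σ) = Df N κ q P v a := by
  unfold Df Lf
  rw [Pf_perm]
  have h1 : gw κ q P v (a ∘ σ) = gw κ q P v a := by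
    funext z
    unfold gw
    congr 1
    exact Equiv.prod_comp σ fun i => Rf (P ^ 2) q (P * κ * a i / z) (P * κ / a i * z) *
      Rf (P ^ 2) q (P * κ * a i * z) (P * κ / a i / z)
  have h2 : gw κ q P (a ∘ σ) v = gw κ q P a v := by
    funext z
    unfold gw
    congr 1
    exact Equiv.prod_comp σ fun i => Rf (P ^ 2) q (P ^ 2 * q / (a i * z)) (a i * z) *
      Rf (P ^ 2) q (P ^ 2 * q / (a i / z)) (a i / z)
  rw [h1, h2]
end

section
variable {M : ℕ} {κ q : ℂ}

theorem continuousOn_gw {X : Type*} [TopologicalSpace X] {K : Set X} {P z : X → ℂ}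
    {v a : X → Fin M → ℂ} (hq : ‖q‖ < 1) (hP : ContinuousOn P K)
    (hv : ∀ i, ContinuousOn (fun x => v x i) K) (ha : ∀ i, ContinuousOn (fun x => a x i) K)
    (hz : ContinuousOn z K) (hz1 : ∀ x ∈ K, ‖z x‖ = 1) (h : ∀ x ∈ K, Dom κ (P x) (v x) (a x)) :
    ContinuousOn (fun x => gw κ q (P x) (v x) (a x) (z x)) K := by
  have hz0 : ∀ x ∈ K, z x ≠ 0 := fun x hx h0 => by
    have := hz1 x hx; rw [h0, norm_zero] at this; exact zero_ne_one this
  have hp := fun x hx => (h x hx).norm_sq_lt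
  have hP2 := hP.pow 2
  have hPk : ContinuousOn (fun x => P x * κ) K := hP.mul continuousOn_const
  have hPq : ContinuousOn (fun x => P x ^ 2 * q) K := hP2.mul continuousOn_const
  refine (continuousOn_finsetProd _ fun i _ => ?_).mul (continuousOn_finsetProd _ fun i _ => ?_)
  · have h0 : ∀ x ∈ K, v x i ≠ 0 := fun x hx => (h x hx).v_ne_zero i
    refine (continuousOn_Rf hq hP2 (hPq.div ((hv i).mul hz) fun x hx =>
      mul_ne_zero (h0 x hx) (hz0 x hx)) ((hv i).mul hz) hp fun x hx => ?_).mul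
      (continuousOn_Rf hq hP2 (hPq.div ((hv i).div hz hz0) fun x hx =>
      div_ne_zero (h0 x hx) (hz0 x hx)) ((hv i).div hz hz0) hp fun x hx => ?_)
    · change ‖v x i * z x‖ < 1
      rw [norm_mul, hz1 x hx, mul_one]; exact ((h x hx).2.1 i).2
    · rw [norm_div, hz1 x hx, div_one]; exact ((h x hx).2.1 i).2
  · have h0 : ∀ x ∈ K, a x i ≠ 0 := fun x hx => (h x hx).symm.v_ne_zero i
    refine (continuousOn_Rf hq hP2 ((hPk.mul (ha i)).div hz hz0)
      ((hPk.div (ha i) h0).mul hz) hp fun x hx => ?_).mul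
      (continuousOn_Rf hq hP2 ((hPk.mul (ha i)).mul hz)
      ((hPk.div (ha i) h0).div hz hz0) hp fun x hx => ?_)
    · change ‖P x * κ / a x i * z x‖ < 1
      rw [norm_mul, hz1 x hx, mul_one]; exact (h x hx).symm.norm_div_lt i
    · rw [norm_div, hz1 x hx, div_one]; exact (h x hx).symm.norm_div_lt i

theorem differentiableOn_gw {U : Set ℂ} {P : ℂ → ℂ} {z : ℂ}
    {v a : ℂ → Fin M → ℂ} (hq : ‖q‖ < 1) (hU : IsOpen U) (hP : DifferentiableOn ℂ P U)
    (hv : ∀ i, DifferentiableOn ℂ (fun x => v x i) U)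
    (ha : ∀ i, DifferentiableOn ℂ (fun x => a x i) U)
    (hz1 : ‖z‖ = 1) (h : ∀ x ∈ U, Dom κ (P x) (v x) (a x)) :
    DifferentiableOn ℂ (fun x => gw κ q (P x) (v x) (a x) z) U := by
  have hz0 : z ≠ 0 := fun h0 => by
    rw [h0, norm_zero] at hz1; exact zero_ne_one hz1
  have hp := fun x hx => (h x hx).norm_sq_lt
  have hz : DifferentiableOn ℂ (fun _ : ℂ => z) U := differentiableOn_const _
  have hP2 : DifferentiableOn ℂ (fun x => P x ^ 2) U := hP.pow 2
  have hPk : DifferentiableOn ℂ (fun x => P x * κ) U := hP.mul (differentiableOn_const _)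
  have hPq : DifferentiableOn ℂ (fun x => P x ^ 2 * q) U := hP2.mul (differentiableOn_const _)
  refine (DifferentiableOn.fun_finsetProd fun i _ => ?_).mul
    (DifferentiableOn.fun_finsetProd fun i _ => ?_)
  · have h0 : ∀ x ∈ U, v x i ≠ 0 := fun x hx => (h x hx).v_ne_zero i
    refine (differentiableOn_Rf hq hU hP2 (hPq.div ((hv i).mul hz) fun x hx =>
      mul_ne_zero (h0 x hx) hz0) ((hv i).mul hz) hp fun x hx => ?_).mul
      (differentiableOn_Rf hq hU hP2 (hPq.div ((hv i).div hz fun _ _ => hz0) fun x hx =>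
      div_ne_zero (h0 x hx) hz0) ((hv i).div hz fun _ _ => hz0) hp fun x hx => ?_)
    · change ‖v x i * z‖ < 1
      rw [norm_mul, hz1, mul_one]; exact ((h x hx).2.1 i).2
    · rw [norm_div, hz1, div_one]; exact ((h x hx).2.1 i).2
  · have h0 : ∀ x ∈ U, a x i ≠ 0 := fun x hx => (h x hx).symm.v_ne_zero i
    refine (differentiableOn_Rf hq hU hP2 ((hPk.mul (ha i)).div hz fun _ _ => hz0)
      ((hPk.div (ha i) h0).mul hz) hp fun x hx => ?_).mul
      (differentiableOn_Rf hq hU hP2 ((hPk.mul (ha i)).mul hz)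
      ((hPk.div (ha i) h0).div hz fun _ _ => hz0) hp fun x hx => ?_)
    · change ‖P x * κ / a x i * z‖ < 1
      rw [norm_mul, hz1, mul_one]; exact (h x hx).symm.norm_div_lt i
    · rw [norm_div, hz1, div_one]; exact (h x hx).symm.norm_div_lt i

theorem differentiableOn_Pf {U : Set ℂ} {P : ℂ → ℂ}
    {v a : ℂ → Fin M → ℂ} (hq : ‖q‖ < 1) (hU : IsOpen U) (hP : DifferentiableOn ℂ P U)
    (hv : ∀ i, DifferentiableOn ℂ (fun x => v x i) U)
    (ha : ∀ i, DifferentiableOn ℂ (fun x => a x i) U)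
    (h : ∀ x ∈ U, Dom κ (P x) (v x) (a x)) :
    DifferentiableOn ℂ (fun x => Pf κ q (P x) (v x) (a x)) U := by
  have hp := fun x hx => (h x hx).norm_sq_lt
  have hP2 : DifferentiableOn ℂ (fun x => P x ^ 2) U := hP.pow 2
  have hPk : DifferentiableOn ℂ (fun x => P x * κ) U := hP.mul (differentiableOn_const _)
  have hPq : DifferentiableOn ℂ (fun x => P x ^ 2 * q) U := hP2.mul (differentiableOn_const _)
  have h0 : ∀ i, ∀ x ∈ U, v x i ≠ 0 := fun i x hx => (h x hx).v_ne_zero i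
  have h0' : ∀ i, ∀ x ∈ U, a x i ≠ 0 := fun i x hx => (h x hx).symm.v_ne_zero i
  refine ((differentiableOn_pairProd fun i j => ?_).mul
    (DifferentiableOn.fun_finsetProd fun i _ => DifferentiableOn.fun_finsetProd fun j _ => ?_)).mul
    (differentiableOn_pairProd fun i j => ?_)
  · exact differentiableOn_Rf hq hU hP2 (hPq.div ((hv i).mul (hv j)) fun x hx =>
      mul_ne_zero (h0 i x hx) (h0 j x hx)) ((hv i).mul (hv j)) hp fun x hx =>
      norm_mul_lt_one ((h x hx).2.1 i).2 ((h x hx).2.1 j).2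
  · exact differentiableOn_Rf hq hU hP2 ((hPk.mul (ha j)).div (hv i) (h0 i))
      ((hv i).mul (hPk.div (ha j) (h0' j))) hp fun x hx =>
      norm_mul_lt_one ((h x hx).2.1 i).2 ((h x hx).symm.norm_div_lt j)
  · exact differentiableOn_Rf hq hU hP2 ((ha i).mul (ha j))
      ((hPk.div (ha i) (h0' i)).mul (hPk.div (ha j) (h0' j))) hp fun x hx =>
      norm_mul_lt_one ((h x hx).symm.norm_div_lt i) ((h x hx).symm.norm_div_lt j)

theorem differentiableOn_Lf (N : ℕ) {U : Set ℂ} {P : ℂ → ℂ}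
    {v a : ℂ → Fin M → ℂ} (hq : ‖q‖ < 1) (hU : IsOpen U) (hP : DifferentiableOn ℂ P U)
    (hv : ∀ i, DifferentiableOn ℂ (fun x => v x i) U)
    (ha : ∀ i, DifferentiableOn ℂ (fun x => a x i) U)
    (h : ∀ x ∈ U, Dom κ (P x) (v x) (a x)) :
    DifferentiableOn ℂ (fun x => Lf N κ q (P x) (v x) (a x)) U := by
  have hp := fun x hx => (h x hx).norm_sq_lt
  have hP2 : DifferentiableOn ℂ (fun x => P x ^ 2) U := hP.pow 2
  have hfst : ∀ {f : ℂ → ℂ}, DifferentiableOn ℂ f U → ContinuousOn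
      (fun x : ℂ × (Fin N → ℂ) => f x.1) (U ×ˢ tor N) := fun hf =>
    hf.continuousOn.comp continuousOn_fst fun x hx => hx.1
  refine DifferentiableOn.mul ?_ (differentiableOn_torusInt hU ?_ fun z hz => ?_)
  · unfold nrm
    simp_rw [qPoch_eq]
    exact (((differentiableOn_Qf hU hP2 hP2 hp).mul (differentiableOn_const _)).pow N).div_const _
  · refine continuousOn_Wt hq (hfst hP2) (fun x hx => hp x.1 hx.1) continuousOn_snd
      (fun x hx i => tor_ne_zero hx.2 i) fun i => ?_
    exact continuousOn_gw hq (hfst hP) (fun i => hfst (hv i)) (fun i => hfst (ha i))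
      ((continuous_apply i).comp_continuousOn continuousOn_snd) (fun x hx => hx.2 i)
      fun x hx => h x.1 hx.1
  · exact differentiableOn_Wt hU hP2 hp (fun i => tor_ne_zero hz i) fun i =>
      differentiableOn_gw hq hU hP hv ha (hz i) h

theorem differentiableOn_Df (N : ℕ) {U : Set ℂ} {P : ℂ → ℂ}
    {v a : ℂ → Fin M → ℂ} (hq : ‖q‖ < 1) (hU : IsOpen U) (hP : DifferentiableOn ℂ P U)
    (hv : ∀ i, DifferentiableOn ℂ (fun x => v x i) U)
    (ha : ∀ i, DifferentiableOn ℂ (fun x => a x i) U)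
    (h : ∀ x ∈ U, Dom κ (P x) (v x) (a x)) :
    DifferentiableOn ℂ (fun x => Df N κ q (P x) (v x) (a x)) U :=
  (differentiableOn_Lf N hq hU hP hv ha h).sub
    ((differentiableOn_Pf hq hU hP hv ha h).mul
      (differentiableOn_Lf N hq hU hP ha hv fun x hx => (h x hx).symm))
end

section
open scoped Topology
open Filter

theorem append_update_left {m n : ℕ} (v : Fin m → ℂ) (w : Fin n → ℂ) (i : Fin m) (c : ℂ) :
    Function.update (Fin.append v w) (i.castAdd n) c = Fin.append (Function.update v i c) w := by
  funext x
  refine Fin.addCases (fun j => ?_) (fun j => ?_) x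
  · rw [Fin.append_left, Function.update_apply, Function.update_apply, Fin.append_left]
    simp only [Fin.castAdd_inj]
  · rw [Fin.append_right, Function.update_of_ne, Fin.append_right]
    exact fun h => absurd (congrArg Fin.val h) (by simp; omega)

theorem append_update_right {m n : ℕ} (v : Fin m → ℂ) (w : Fin n → ℂ) (i : Fin n) (c : ℂ) :
    Function.update (Fin.append v w) (i.natAdd m) c = Fin.append v (Function.update w i c) := by
  funext x
  refine Fin.addCases (fun j => ?_) (fun j => ?_) x
  · rw [Fin.append_left, Function.update_of_ne, Fin.append_left]
    exact fun h => absurd (congrArg Fin.val h) (by simp; omega)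
  · rw [Fin.append_right, Function.update_apply, Function.update_apply, Fin.append_right]
    simp only [Fin.natAdd_inj]

theorem Qf_zero_left (x : ℂ) : Qf 0 x = 1 - x := by
  rw [Qf_shift (by simp) x, zero_mul, Qf_zero_right, mul_one]

theorem tendsto_Qf_sq {l : Filter ℂ} (hl : l ≤ 𝓝 0) {Y : ℂ → ℂ} {y : ℂ} (hY : Tendsto Y l (𝓝 y)) :
    Tendsto (fun P => Qf (P ^ 2) (Y P)) l (𝓝 (1 - y)) := by
  have hK : IsOpen {x : ℂ × ℂ | ‖x.1 ^ 2‖ < 1} := isOpen_lt (by fun_prop) continuous_const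
  have h : ContinuousOn (fun x : ℂ × ℂ => Qf (x.1 ^ 2) x.2) {x : ℂ × ℂ | ‖x.1 ^ 2‖ < 1} :=
    continuousOn_Qf (by fun_prop) (by fun_prop) fun x hx => hx
  have h0 := (h.continuousAt (hK.mem_nhds (show ‖((0, y) : ℂ × ℂ).1 ^ 2‖ < 1 by simp))).tendsto.comp
    ((tendsto_id.mono_right hl).prodMk_nhds hY)
  simp only [ne_eq, OfNat.ofNat_ne_zero, not_false_eq_true, zero_pow, Qf_zero_left] at h0
  exact h0

section
variable {l : Filter ℂ} {c : ℂ}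

theorem tendsto_th_const (hl : l ≤ 𝓝 0) : Tendsto (fun P => th (P ^ 2) c) l (𝓝 (1 - c)) := by
  have h := (tendsto_Qf_sq hl (tendsto_const_nhds (x := c))).mul
    (tendsto_Qf_sq hl (Y := fun P => P ^ 2 / c) (y := 0 ^ 2 / c)
      (((continuous_id.pow 2).div_const c).continuousAt.tendsto.mono_left hl))
  simp only [ne_eq, OfNat.ofNat_ne_zero, not_false_eq_true, zero_pow, zero_div, sub_zero,
    mul_one] at h
  exact h

theorem tendsto_th_mul (hl : l ≤ 𝓝 0) : Tendsto (fun P => th (P ^ 2) (P * c)) l (𝓝 1) := by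
  have h := (tendsto_Qf_sq hl (Y := fun P => P * c) (y := 0 * c)
      ((continuous_id.mul continuous_const).continuousAt.tendsto.mono_left hl)).mul
    (tendsto_Qf_sq hl (Y := fun P => P / c) (y := 0 / c)
      ((continuous_id.div_const c).continuousAt.tendsto.mono_left hl))
  simp only [zero_mul, zero_div, sub_zero, mul_one] at h
  refine h.congr fun P => ?_
  rw [th]
  congr 2
  rcases eq_or_ne P 0 with rfl | h
  · simp
  · field_simp

theorem tendsto_th_sq_mul (hc : c ≠ 0) :
    Tendsto (fun P => th (P ^ 2) (P ^ 2 * c)) (𝓝[≠] 0) (𝓝 (1 - 1 / c)) := by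
  have hl : 𝓝[≠] (0:ℂ) ≤ 𝓝 0 := nhdsWithin_le_nhds
  have h := (tendsto_Qf_sq hl (Y := fun P => P ^ 2 * c) (y := 0 ^ 2 * c)
      (((continuous_id.pow 2).mul continuous_const).continuousAt.tendsto.mono_left hl)).mul
    (tendsto_Qf_sq hl (tendsto_const_nhds (x := 1 / c)))
  simp only [ne_eq, OfNat.ofNat_ne_zero, not_false_eq_true, zero_pow, zero_mul, sub_zero, one_mul] at h
  refine h.congr' ?_
  filter_upwards [self_mem_nhdsWithin] with P hP
  have : P ≠ 0 := hP
  rw [th]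
  congr 2
  field_simp

theorem tendsto_mul_br {κ a b : ℂ} (hκ : κ ≠ 0) (ha : a ≠ 0) :
    Tendsto (fun P => P * br (P ^ 2) (P * κ / a) b) (𝓝[≠] 0) (𝓝 (a / κ)) := by
  have h := ((tendsto_th_mul (c := κ * b / a) (nhdsWithin_le_nhds (s := {0}ᶜ))).mul
    (tendsto_th_mul (c := κ / (a * b)) (nhdsWithin_le_nhds (s := {0}ᶜ)))).const_mul (a / κ)
  rw [mul_one, mul_one] at h
  refine h.congr' ?_
  filter_upwards [self_mem_nhdsWithin] with P hP
  have : P ≠ 0 := hP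
  rw [br, show P * κ / a * b = P * (κ * b / a) by ring, show P * κ / a / b = P * (κ / (a * b)) by
    rw [div_div]; ring, inv_div, ← mul_assoc P, show P * (a / (P * κ)) = a / κ by field_simp]

theorem tendsto_mul_br' {κ a b : ℂ} (hκ : κ ≠ 0) (ha : a ≠ 0) (hb : b ≠ 0) :
    Tendsto (fun P => P * br (P ^ 2) (P * κ / a) (P * κ / b)) (𝓝[≠] 0)
      (𝓝 (a / κ * ((1 - a * b / κ ^ 2) * (1 - b / a)))) := by
  have h := ((tendsto_th_sq_mul (c := κ ^ 2 / (a * b))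
      (div_ne_zero (pow_ne_zero 2 hκ) (mul_ne_zero ha hb))).mul
    (tendsto_th_const (c := b / a) (nhdsWithin_le_nhds (s := {0}ᶜ)))).const_mul (a / κ)
  rw [one_div_div] at h
  refine h.congr' ?_
  filter_upwards [self_mem_nhdsWithin] with P hP
  have : P ≠ 0 := hP
  rw [br, show P * κ / a * (P * κ / b) = P ^ 2 * (κ ^ 2 / (a * b)) by field_simp,
    show P * κ / a / (P * κ / b) = b / a by field_simp,
    inv_div, ← mul_assoc P, show P * (a / (P * κ)) = a / κ by field_simp]

theorem tendsto_br {a b : ℂ} :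
    Tendsto (fun P => br (P ^ 2) a b) (𝓝[≠] 0) (𝓝 (a⁻¹ * ((1 - a * b) * (1 - a / b)))) :=
  ((tendsto_th_const (nhdsWithin_le_nhds (s := {0}ᶜ))).mul
    (tendsto_th_const (nhdsWithin_le_nhds (s := {0}ᶜ)))).const_mul _
end

theorem eventually_Dom {M : ℕ} (κ : ℂ) {v a : Fin M → ℂ} (hv : ∀ i, v i ≠ 0 ∧ ‖v i‖ < 1)
    (ha : ∀ i, a i ≠ 0 ∧ ‖a i‖ < 1) : ∀ᶠ P in 𝓝 (0:ℂ), Dom κ P v a := by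
  have h : ∀ c : ℝ, 0 < c → ∀ᶠ P in 𝓝 (0:ℂ), ‖P * κ‖ < c := fun c hc =>
    (continuous_id.mul continuous_const).norm.continuousAt.tendsto.eventually_lt_const
      (by simpa using hc)
  have h1 : ∀ᶠ P in 𝓝 (0:ℂ), ‖P‖ < 1 :=
    continuous_norm.continuousAt.tendsto.eventually_lt_const (by simp)
  filter_upwards [h1, eventually_all.2 fun i => h _ (norm_pos_iff.2 (hv i).1),
    eventually_all.2 fun i => h _ (norm_pos_iff.2 (ha i).1)] with P h1 h2 h3
  exact ⟨h1, fun i => ⟨h2 i, (hv i).2⟩, fun i => ⟨h3 i, (ha i).2⟩⟩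

theorem tendsto_coeff_dual {ι : Type*} {T : Finset ι} {κ a G : ℂ} (hκ : κ ≠ 0) (ha : a ≠ 0)
    (hG : G ≠ 0) {g : ℂ → ℂ} {f : ι → ℂ → ℂ} (hg : Tendsto (fun P => P * g P) (𝓝[≠] 0) (𝓝 G))
    (hf : ∀ x ∈ T, Tendsto (fun P => P * f x P) (𝓝[≠] 0) (𝓝 (a / κ))) :
    Tendsto (fun P => ((P * κ / a) ^ T.card)⁻¹ / (g P * ∏ x ∈ T, f x P) / P) (𝓝[≠] 0) (𝓝 G⁻¹) := by
  have h := (hg.mul (tendsto_finsetProd T hf))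
  rw [Finset.prod_const] at h
  have hd : G * (a / κ) ^ T.card ≠ 0 := mul_ne_zero hG (pow_ne_zero _ (div_ne_zero ha hκ))
  have h2 := (tendsto_const_nhds (x := (a / κ) ^ T.card)).div h hd
  rw [show (a / κ) ^ T.card / (G * (a / κ) ^ T.card) = G⁻¹ by
    rw [mul_comm, div_mul_cancel_left₀ (pow_ne_zero _ (div_ne_zero ha hκ))]] at h2
  refine h2.congr' ?_
  filter_upwards [self_mem_nhdsWithin] with P hP
  have hP : P ≠ 0 := hP
  rw [Pi.div_apply, Finset.prod_mul_distrib, Finset.prod_const, mul_div_assoc, mul_pow, div_pow,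
    div_pow, mul_inv, inv_div]
  simp only [div_eq_mul_inv, mul_inv]
  ring

end

section
open scoped Topology
open Filter

theorem one_sub_mul_ne_zero {a b : ℂ} (h : ‖a * b‖ < 1) : 1 - a * b ≠ 0 := fun h0 => by
  rw [← sub_eq_zero.1 h0, norm_one] at h; exact lt_irrefl _ h

theorem one_sub_div_ne_zero {a b : ℂ} (hb : b ≠ 0) (h : a ≠ b) : 1 - a / b ≠ 0 := fun h0 => by
  have := sub_eq_zero.1 h0
  rw [eq_div_iff hb, one_mul] at this
  exact h this.symm

theorem sum_rc_append_mul_Df (N : ℕ) {κ q P : ℂ} (hκ : κ ^ 2 = q) (hκ0 : κ ≠ 0) (hq : ‖q‖ < 1) (hP : P ≠ 0)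
    {v b : Fin (2 * N + 2) → ℂ} (h : Dom κ P v b) {J T : Finset (Fin (2 * N + 2))}
    (hJ : J.card = 2) (hT : T.card = N) (hbal : q * ∏ i, v i = ∏ i, b i)
    (hJq : ∀ j ∈ J, ‖b j‖ < ‖q‖) (hTq : ∀ x ∈ T, ‖P * κ / v x‖ < ‖q‖)
    (hJd : ∀ j ∈ J, Dom κ P v (Function.update b j (b j / q)))
    (hTd : ∀ x ∈ T, Dom κ P (Function.update v x (q * v x)) b)
    (hne : ∀ r ∈ T.disjSum J, ∀ s ∈ T.disjSum J, r ≠ s → br (P ^ 2)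
      (Sum.elim v (fun i => P * κ / b i) r) (Sum.elim v (fun i => P * κ / b i) s) ≠ 0) :
    (∑ x ∈ T, ((v x ^ N)⁻¹ / ((∏ s ∈ T.erase x, br (P ^ 2) (v x) (v s)) *
        ∏ j ∈ J, br (P ^ 2) (v x) (P * κ / b j))) * Df N κ q P (Function.update v x (q * v x)) b) +
    ∑ j ∈ J, (((P * κ / b j) ^ N)⁻¹ / ((∏ s ∈ T, br (P ^ 2) (P * κ / b j) (v s)) *
        ∏ i ∈ J.erase j, br (P ^ 2) (P * κ / b j) (P * κ / b i))) *
          Df N κ q P v (Function.update b j (b j / q)) = 0 := by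
  have hq0 : q ≠ 0 := by rw [← hκ]; exact pow_ne_zero 2 hκ0
  set w : Fin (2 * N + 2) → ℂ := fun i => P * κ / b i with hw
  set t := Fin.append v w with ht
  have hte : ∀ r, t (finSumFinEquiv r) = Sum.elim v w r := by
    rintro (r | r)
    · rw [finSumFinEquiv_apply_left, ht, Fin.append_left, Sum.elim_inl]
    · rw [finSumFinEquiv_apply_right, ht, Fin.append_right, Sum.elim_inr]
  set S : Finset (Fin (2 * N + 2 + (2 * N + 2))) :=
    (T.disjSum J).map finSumFinEquiv.toEmbedding with hS
  have hSc : S.card = N + 2 := by rw [hS, Finset.card_map, Finset.card_disjSum, hT, hJ]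
  have hb0 : ∀ i, b i ≠ 0 := h.symm.v_ne_zero
  have hrel := sum_rc_mul_defect (n := N) (m := N) (ω := P * κ) (t := t) (S := S)
    h.norm_sq_lt (pow_ne_zero 2 hP) hq hq0 (by rw [mul_pow, hκ]) hSc (by rw [hSc]; ring)
    (fun r => by
      refine Fin.addCases (fun i => ?_) (fun i => ?_) r
      · rw [ht, Fin.append_left]; exact (h.2.1 i).2
      · rw [ht, Fin.append_right]; exact h.symm.norm_div_lt i)
    (fun r => by
      refine Fin.addCases (fun i => ?_) (fun i => ?_) r
      · rw [ht, Fin.append_left]; exact (h.2.1 i).1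
      · rw [ht, Fin.append_right, hw, norm_div, lt_div_iff₀ (norm_pos_iff.2 (hb0 i))]
        exact mul_lt_of_lt_one_right (norm_pos_iff.2 (mul_ne_zero hP hκ0)) (h.2.2 i).2)
    (fun r hr => by
      obtain ⟨r, hr', rfl⟩ := Finset.mem_map.1 hr
      rw [Equiv.coe_toEmbedding, hte]
      rcases Finset.mem_disjSum.1 hr' with ⟨x, hx, rfl⟩ | ⟨x, hx, rfl⟩
      · exact hTq x hx
      · simp only [Sum.elim_inr, w]
        rw [div_div_cancel₀ (mul_ne_zero hP hκ0)]; exact hJq x hx)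
    (by
      rw [Fin.prod_univ_add, hSc]
      simp only [ht, Fin.append_left, Fin.append_right, w]
      simp_rw [div_div_cancel₀ (mul_ne_zero hP hκ0)]
      rw [Finset.prod_div_distrib, ← hbal, Finset.prod_const, Finset.card_univ, Fintype.card_fin,
        ← hκ]
      have : ∏ i, v i ≠ 0 := Finset.prod_ne_zero_iff.2 fun i _ => h.v_ne_zero i
      field_simp
      ring)
    (fun r hr s hs hrs => by
      obtain ⟨r, hr', rfl⟩ := Finset.mem_map.1 hr
      obtain ⟨s, hs', rfl⟩ := Finset.mem_map.1 hs
      rw [Equiv.coe_toEmbedding, hte, hte]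
      exact hne r hr' s hs' fun h => hrs (by rw [h]))
  rw [hS, Finset.sum_map, Finset.sum_disjSum] at hrel
  simp only [Equiv.coe_toEmbedding, rc] at hrel
  rw [← hrel]
  have herase : ∀ r, ∏ s ∈ ((T.disjSum J).map finSumFinEquiv.toEmbedding).erase (finSumFinEquiv r),
      br (P ^ 2) (t (finSumFinEquiv r)) (t s) =
      ∏ s ∈ (T.disjSum J).erase r, br (P ^ 2) (Sum.elim v w r) (Sum.elim v w s) := fun r => by
    rw [← hte, show finSumFinEquiv r = finSumFinEquiv.toEmbedding r from rfl, ← Finset.map_erase,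
      Finset.prod_map]
    simp only [Equiv.coe_toEmbedding, hte]
  congr 1
  · refine Finset.sum_congr rfl fun x hx => ?_
    rw [herase, disjSum_erase_inl, Finset.prod_disjSum, hte]
    simp only [Sum.elim_inl, Sum.elim_inr]
    rw [finSumFinEquiv_apply_left, ht, append_update_left, hw,
      defect_append N hκ hP hκ0 hq (hTd x hx)]
  · refine Finset.sum_congr rfl fun x hx => ?_
    rw [herase, disjSum_erase_inr, Finset.prod_disjSum, hte]
    simp only [Sum.elim_inl, Sum.elim_inr]
    rw [finSumFinEquiv_apply_right, ht, append_update_right, ← defect_append N hκ hP hκ0 hq (hJd x hx)]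
    congr 3
    funext i
    rcases eq_or_ne i x with rfl | hi
    · rw [Function.update_self, Function.update_self]
      simp only [w]
      have := hb0 i
      field_simp
    · rw [Function.update_of_ne hi, Function.update_of_ne hi]

end

section
open scoped Topology
open Filter

theorem eventually_ne_zero_of_tendsto_mul {f : ℂ → ℂ} {c : ℂ} (hc : c ≠ 0)
    (h : Tendsto (fun P => P * f P) (𝓝[≠] 0) (𝓝 c)) : ∀ᶠ P in 𝓝[≠] (0:ℂ), f P ≠ 0 :=
  (h.eventually_ne hc).mono fun P hP h0 => hP (by rw [h0, mul_zero])

theorem tendsto_coeff_primal {c c1 c2 G : ℂ} (hG : G ≠ 0) (h1 : c1 ≠ 0)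
    (h2 : c2 ≠ 0) {f g1 g2 : ℂ → ℂ} (hf : Tendsto f (𝓝[≠] 0) (𝓝 G))
    (hg1 : Tendsto (fun P => P * g1 P) (𝓝[≠] 0) (𝓝 c1))
    (hg2 : Tendsto (fun P => P * g2 P) (𝓝[≠] 0) (𝓝 c2)) :
    Tendsto (fun P => c / (f P * (g1 P * g2 P)) / P) (𝓝[≠] 0) (𝓝 0) := by
  have h := ((tendsto_id.mono_right (nhdsWithin_le_nhds (a := (0:ℂ)) (s := {0}ᶜ))).mul_const c).div
    (hf.mul (hg1.mul hg2)) (mul_ne_zero hG (mul_ne_zero h1 h2))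
  rw [zero_mul, zero_div] at h
  refine h.congr' ?_
  filter_upwards [self_mem_nhdsWithin] with P hP
  have hP : P ≠ 0 := hP
  simp only [Pi.div_apply, id]
  rw [div_div, show f P * (P * g1 P * (P * g2 P)) = P * (f P * (g1 P * g2 P) * P) by ring,
    mul_div_mul_left _ _ hP]

theorem limit_eq_limit (N : ℕ) {κ q : ℂ} (hκ : κ ^ 2 = q) (hκ0 : κ ≠ 0) (hq : ‖q‖ < 1)
    {v b : Fin (2 * N + 2) → ℂ} (hv : ∀ i, v i ≠ 0 ∧ ‖v i‖ < 1) (hb : ∀ i, b i ≠ 0 ∧ ‖b i‖ < 1)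
    {j₁ j₂ : Fin (2 * N + 2)} (hj : j₁ ≠ j₂) (hbj : b j₁ ≠ b j₂)
    (hq1 : ‖b j₁‖ < ‖q‖) (hq2 : ‖b j₂‖ < ‖q‖) {T : Finset (Fin (2 * N + 2))} (hT : T.card = N)
    (hTi : ∀ x ∈ T, ∀ y ∈ T, x ≠ y → v x ≠ v y) (hbal : q * ∏ i, v i = ∏ i, b i)
    (k : ℕ) {c₁ c₂ : ℂ}
    (h1 : Tendsto (fun P => Df N κ q P v (Function.update b j₁ (b j₁ / q)) / P ^ k) (𝓝[≠] 0) (𝓝 c₁))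
    (h2 : Tendsto (fun P => Df N κ q P v (Function.update b j₂ (b j₂ / q)) / P ^ k) (𝓝[≠] 0) (𝓝 c₂))
    (h3 : ∀ x ∈ T, ∃ c, Tendsto (fun P => Df N κ q P (Function.update v x (q * v x)) b / P ^ k)
      (𝓝[≠] 0) (𝓝 c)) : c₁ = c₂ := by
  have hq0 : q ≠ 0 := by rw [← hκ]; exact pow_ne_zero 2 hκ0
  have hqn : 0 < ‖q‖ := norm_pos_iff.2 hq0
  set J : Finset (Fin (2 * N + 2)) := {j₁, j₂} with hJ
  have hJq : ∀ j ∈ J, ‖b j‖ < ‖q‖ := by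
    intro j hjJ
    rcases Finset.mem_insert.1 hjJ with rfl | h
    · exact hq1
    · rw [Finset.mem_singleton.1 h]; exact hq2
  have hpos : ∀ (u : Fin (2 * N + 2) → ℂ) (i : Fin (2 * N + 2)) (c : ℂ), (∀ i, u i ≠ 0 ∧ ‖u i‖ < 1) →
      c ≠ 0 ∧ ‖c‖ < 1 → ∀ j, Function.update u i c j ≠ 0 ∧ ‖Function.update u i c j‖ < 1 :=
    fun u i c hu hc j =>
      ⟨update_ne_zero (fun r => (hu r).1) i hc.1 j, norm_update_lt (fun r => (hu r).2) i hc.2 j⟩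
  have hlb : ∀ i j, i ≠ j → b i ≠ b j → ‖b i‖ < ‖q‖ → ‖b j‖ < ‖q‖ →
      b i / κ * ((1 - b i * b j / κ ^ 2) * (1 - b j / b i)) ≠ 0 := fun i j _ hij hi hj' => by
    refine mul_ne_zero (div_ne_zero (hb i).1 hκ0) (mul_ne_zero ?_ (one_sub_div_ne_zero (hb i).1 hij.symm))
    rw [hκ, mul_div_right_comm]
    refine one_sub_mul_ne_zero (norm_mul_lt_one ?_ (hb j).2)
    rw [norm_div, div_lt_one hqn]; exact hi
  have hlv : ∀ x y, v x ≠ v y → (v x)⁻¹ * ((1 - v x * v y) * (1 - v x / v y)) ≠ 0 := fun x y hxy =>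
    mul_ne_zero (inv_ne_zero (hv x).1) (mul_ne_zero (one_sub_mul_ne_zero (norm_mul_lt_one (hv x).2 (hv y).2))
      (one_sub_div_ne_zero (hv y).1 hxy))
  have hbr : ∀ x j, Tendsto (fun P => P * br (P ^ 2) (v x) (P * κ / b j)) (𝓝[≠] 0) (𝓝 (-(b j / κ))) := by
    intro x j
    refine ((tendsto_mul_br (b := v x) hκ0 (hb j).1).neg).congr' ?_
    filter_upwards [self_mem_nhdsWithin, (eventually_Dom κ hv hb).filter_mono nhdsWithin_le_nhds]
      with P hP hD
    rw [br_antisymm hD.norm_sq_lt (div_ne_zero (mul_ne_zero hP hκ0) (hb j).1) (hv x).1, mul_neg]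
  have hlbr : ∀ j, -(b j / κ) ≠ 0 := fun j => neg_ne_zero.2 (div_ne_zero (hb j).1 hκ0)
  have hne : ∀ᶠ P in 𝓝[≠] (0:ℂ), ∀ r ∈ T.disjSum J, ∀ s ∈ T.disjSum J, r ≠ s → br (P ^ 2)
      (Sum.elim v (fun i => P * κ / b i) r) (Sum.elim v (fun i => P * κ / b i) s) ≠ 0 := by
    refine (Finset.eventually_all _).2 fun r hr => (Finset.eventually_all _).2 fun s hs => ?_
    rcases r with x | i <;> rcases s with y | j
    · simp only [Finset.inl_mem_disjSum] at hr hs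
      by_cases hxy : x = y
      · exact Eventually.of_forall fun P h => absurd (congrArg Sum.inl hxy) h
      · exact (tendsto_br.eventually_ne (hlv x y (hTi x hr y hs hxy))).mono fun P h _ => h
    · exact (eventually_ne_zero_of_tendsto_mul (hlbr j) (hbr x j)).mono fun P h _ => h
    · exact (eventually_ne_zero_of_tendsto_mul (div_ne_zero (hb i).1 hκ0)
        (tendsto_mul_br hκ0 (hb i).1)).mono fun P h _ => h
    · simp only [Finset.inr_mem_disjSum] at hr hs
      by_cases hxy : i = j
      · exact Eventually.of_forall fun P h => absurd (congrArg Sum.inr hxy) h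
      · have hbij : b i ≠ b j := by
          rcases Finset.mem_insert.1 hr with rfl | hr' <;> rcases Finset.mem_insert.1 hs with rfl | hs'
          · exact absurd rfl hxy
          · rw [Finset.mem_singleton.1 hs']; exact hbj
          · rw [Finset.mem_singleton.1 hr']; exact hbj.symm
          · exact absurd ((Finset.mem_singleton.1 hr').trans (Finset.mem_singleton.1 hs').symm) hxy
        exact (eventually_ne_zero_of_tendsto_mul (hlb i j hxy hbij (hJq i hr) (hJq j hs))
          (tendsto_mul_br' hκ0 (hb i).1 (hb j).1)).mono fun P h _ => h
  have hTq : ∀ᶠ P in 𝓝[≠] (0:ℂ), ∀ x ∈ T, ‖P * κ / v x‖ < ‖q‖ :=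
    ((Finset.eventually_all _).2 fun x _ =>
      ((continuous_id.mul continuous_const).div_const _).norm.continuousAt.tendsto.eventually_lt_const
        (by simpa using hqn)).filter_mono nhdsWithin_le_nhds
  have hJd : ∀ᶠ P in 𝓝[≠] (0:ℂ), ∀ j ∈ J, Dom κ P v (Function.update b j (b j / q)) :=
    ((Finset.eventually_all _).2 fun j hjJ => eventually_Dom κ hv
      (hpos b j _ hb ⟨div_ne_zero (hb j).1 hq0, by
        rw [norm_div, div_lt_one hqn]; exact hJq j hjJ⟩)).filter_mono nhdsWithin_le_nhds
  have hTd : ∀ᶠ P in 𝓝[≠] (0:ℂ), ∀ x ∈ T, Dom κ P (Function.update v x (q * v x)) b :=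
    ((Finset.eventually_all _).2 fun x _ => eventually_Dom κ
      (hpos v x _ hv ⟨mul_ne_zero hq0 (hv x).1, norm_mul_lt_one hq (hv x).2⟩) hb).filter_mono
      nhdsWithin_le_nhds
  have hD : ∀ᶠ P in 𝓝[≠] (0:ℂ), Dom κ P v b := (eventually_Dom κ hv hb).filter_mono nhdsWithin_le_nhds
  choose! c hc using h3
  have hlim1 := tendsto_finsetSum T fun x hx => (tendsto_coeff_primal (c := (v x ^ N)⁻¹)
    (Finset.prod_ne_zero_iff.2 fun s hs => hlv x s (hTi x hx s (Finset.mem_of_mem_erase hs)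
      (Finset.ne_of_mem_erase hs).symm)) (hlbr j₁) (hlbr j₂)
    (tendsto_finsetProd (T.erase x) fun s _ => tendsto_br) (hbr x j₁) (hbr x j₂)).mul (hc x hx)
  have hcoef : ∀ i j, i ≠ j → b i ≠ b j → ‖b i‖ < ‖q‖ → ‖b j‖ < ‖q‖ → Tendsto (fun P =>
      ((P * κ / b i) ^ T.card)⁻¹ / (br (P ^ 2) (P * κ / b i) (P * κ / b j) *
        ∏ s ∈ T, br (P ^ 2) (P * κ / b i) (v s)) / P) (𝓝[≠] 0)
      (𝓝 (b i / κ * ((1 - b i * b j / κ ^ 2) * (1 - b j / b i)))⁻¹) := fun i j hij hbij hi hj' =>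
    tendsto_coeff_dual (f := fun s P => br (P ^ 2) (P * κ / b i) (v s)) hκ0 (hb i).1
      (hlb i j hij hbij hi hj')
      (tendsto_mul_br' hκ0 (hb i).1 (hb j).1) fun s _ => tendsto_mul_br hκ0 (hb i).1
  have hlim2 := ((hcoef j₁ j₂ hj hbj hq1 hq2).mul h1).add ((hcoef j₂ j₁ hj.symm hbj.symm hq2 hq1).mul h2)
  have hlim := hlim1.add hlim2
  simp only [zero_mul, Finset.sum_const_zero, zero_add] at hlim
  have hzero := tendsto_nhds_unique (tendsto_const_nhds.congr' ?_) hlim (a := 0)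
  · have hAne := hlb j₁ j₂ hj hbj hq1 hq2
    have hAB : b j₂ / κ * ((1 - b j₂ * b j₁ / κ ^ 2) * (1 - b j₁ / b j₂)) =
        -(b j₁ / κ * ((1 - b j₁ * b j₂ / κ ^ 2) * (1 - b j₂ / b j₁))) := by
      have := (hb j₁).1
      have := (hb j₂).1
      field_simp
      ring
    rw [hAB, inv_neg, neg_mul, ← sub_eq_add_neg, ← mul_sub] at hzero
    have := (mul_eq_zero.1 hzero.symm).resolve_left (inv_ne_zero hAne)
    exact sub_eq_zero.1 this
  · filter_upwards [self_mem_nhdsWithin, hne, hTq, hJd, hTd, hD] with P hP hne hTq hJd hTd hD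
    have hP : P ≠ 0 := hP
    have := sum_rc_append_mul_Df N hκ hκ0 hq hP hD (Finset.card_pair hj) hT hbal hJq hTq hJd hTd hne
    rw [Finset.sum_pair hj, Finset.sum_congr rfl (fun x _ => by rw [Finset.prod_pair hj]),
      Finset.erase_insert (by simpa using hj), Finset.prod_singleton,
      Finset.erase_insert_of_ne hj, Finset.erase_singleton, insert_empty_eq,
      Finset.prod_singleton] at this
    have h0 := congrArg (fun y => y / P / P ^ k) this
    simp only [zero_div, add_div, Finset.sum_div] at h0
    rw [← h0, hT]
    congr 1
    · refine Finset.sum_congr rfl fun x _ => ?_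
      simp only [div_eq_mul_inv, mul_inv]; ring
    · congr 1
      · simp only [div_eq_mul_inv, mul_inv]; ring
      · simp only [div_eq_mul_inv, mul_inv]; ring

end

section
open Filter Topology

section
variable {X : Type*} [TopologicalSpace X] {K : Set X} {M : ℕ} {κ q : ℂ} {P : X → ℂ}
  {v a : X → Fin M → ℂ}

theorem continuousOn_Pf (hq : ‖q‖ < 1) (hP : ContinuousOn P K)
    (hv : ∀ i, ContinuousOn (fun x => v x i) K) (ha : ∀ i, ContinuousOn (fun x => a x i) K)
    (h : ∀ x ∈ K, Dom κ (P x) (v x) (a x)) :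
    ContinuousOn (fun x => Pf κ q (P x) (v x) (a x)) K := by
  have hp := fun x hx => (h x hx).norm_sq_lt
  have hP2 : ContinuousOn (fun x => P x ^ 2) K := hP.pow 2
  have hPk : ContinuousOn (fun x => P x * κ) K := hP.mul continuousOn_const
  have hPq : ContinuousOn (fun x => P x ^ 2 * q) K := hP2.mul continuousOn_const
  have h0 : ∀ i, ∀ x ∈ K, v x i ≠ 0 := fun i x hx => (h x hx).v_ne_zero i
  have h0' : ∀ i, ∀ x ∈ K, a x i ≠ 0 := fun i x hx => (h x hx).symm.v_ne_zero i
  refine ((continuousOn_pairProd fun i j => ?_).mul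
    (continuousOn_finsetProd _ fun i _ => continuousOn_finsetProd _ fun j _ => ?_)).mul
    (continuousOn_pairProd fun i j => ?_)
  · exact continuousOn_Rf hq hP2 (hPq.div ((hv i).mul (hv j)) fun x hx =>
      mul_ne_zero (h0 i x hx) (h0 j x hx)) ((hv i).mul (hv j)) hp fun x hx =>
      norm_mul_lt_one ((h x hx).2.1 i).2 ((h x hx).2.1 j).2
  · exact continuousOn_Rf hq hP2 ((hPk.mul (ha j)).div (hv i) (h0 i))
      ((hv i).mul (hPk.div (ha j) (h0' j))) hp fun x hx =>
      norm_mul_lt_one ((h x hx).2.1 i).2 ((h x hx).symm.norm_div_lt j)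
  · exact continuousOn_Rf hq hP2 ((ha i).mul (ha j))
      ((hPk.div (ha i) (h0' i)).mul (hPk.div (ha j) (h0' j))) hp fun x hx =>
      norm_mul_lt_one ((h x hx).symm.norm_div_lt i) ((h x hx).symm.norm_div_lt j)

variable [FirstCountableTopology X] [LocallyCompactSpace X]

theorem continuousOn_Lf (N : ℕ) (hq : ‖q‖ < 1) (hK : IsOpen K) (hP : ContinuousOn P K)
    (hv : ∀ i, ContinuousOn (fun x => v x i) K) (ha : ∀ i, ContinuousOn (fun x => a x i) K)
    (h : ∀ x ∈ K, Dom κ (P x) (v x) (a x)) :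
    ContinuousOn (fun x => Lf N κ q (P x) (v x) (a x)) K := by
  have hp := fun x hx => (h x hx).norm_sq_lt
  have hP2 : ContinuousOn (fun x => P x ^ 2) K := hP.pow 2
  have hfst : ∀ {f : X → ℂ}, ContinuousOn f K → ContinuousOn
      (fun x : X × (Fin N → ℂ) => f x.1) (K ×ˢ tor N) := fun hf =>
    hf.comp continuousOn_fst fun x hx => hx.1
  refine ContinuousOn.mul ?_ (continuousOn_torusInt hK ?_)
  · unfold nrm
    simp_rw [qPoch_eq]
    exact (((continuousOn_Qf hP2 hP2 hp).mul continuousOn_const).pow N).div_const _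
  · refine continuousOn_Wt hq (hfst hP2) (fun x hx => hp x.1 hx.1) continuousOn_snd
      (fun x hx i => tor_ne_zero hx.2 i) fun i => ?_
    exact continuousOn_gw hq (hfst hP) (fun i => hfst (hv i)) (fun i => hfst (ha i))
      ((continuous_apply i).comp_continuousOn continuousOn_snd) (fun x hx => hx.2 i)
      fun x hx => h x.1 hx.1

theorem continuousOn_Df (N : ℕ) (hq : ‖q‖ < 1) (hK : IsOpen K) (hP : ContinuousOn P K)
    (hv : ∀ i, ContinuousOn (fun x => v x i) K) (ha : ∀ i, ContinuousOn (fun x => a x i) K)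
    (h : ∀ x ∈ K, Dom κ (P x) (v x) (a x)) :
    ContinuousOn (fun x => Df N κ q (P x) (v x) (a x)) K :=
  (continuousOn_Lf N hq hK hP hv ha h).sub
    ((continuousOn_Pf hq hP hv ha h).mul
      (continuousOn_Lf N hq hK hP ha hv fun x hx => (h x hx).symm))
end

theorem tendsto_div_pow_of_le_order {F : ℂ → ℂ} (hF : AnalyticAt ℂ F 0) {k : ℕ}
    (h : (k : ℕ∞) ≤ analyticOrderAt F 0) :
    ∃ c, Tendsto (fun z => F z / z ^ k) (𝓝[≠] 0) (𝓝 c) := by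
  obtain ⟨g, hg, hgF⟩ := (natCast_le_analyticOrderAt hF).1 h
  refine ⟨g 0, (hg.continuousAt.tendsto.mono_left nhdsWithin_le_nhds).congr' ?_⟩
  filter_upwards [hgF.filter_mono nhdsWithin_le_nhds, self_mem_nhdsWithin] with z hz hz0
  rw [hz, sub_zero, smul_eq_mul, mul_div_cancel_left₀ _ (pow_ne_zero k hz0)]

theorem succ_le_order_of_tendsto {F : ℂ → ℂ} (hF : AnalyticAt ℂ F 0) {k : ℕ}
    (h : (k : ℕ∞) ≤ analyticOrderAt F 0)
    (h0 : Tendsto (fun z => F z / z ^ k) (𝓝[≠] 0) (𝓝 0)) :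
    ((k + 1 : ℕ) : ℕ∞) ≤ analyticOrderAt F 0 := by
  obtain ⟨g, hg, hgF⟩ := (natCast_le_analyticOrderAt hF).1 h
  have hg0 : g 0 = 0 := by
    refine tendsto_nhds_unique ((hg.continuousAt.tendsto.mono_left nhdsWithin_le_nhds).congr' ?_) h0
    filter_upwards [hgF.filter_mono nhdsWithin_le_nhds, self_mem_nhdsWithin] with z hz hz0
    rw [hz, sub_zero, smul_eq_mul, mul_div_cancel_left₀ _ (pow_ne_zero k hz0)]
  have h1 : ((1 : ℕ) : ℕ∞) ≤ analyticOrderAt g 0 := by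
    rw [Nat.cast_one]; exact Order.one_le_iff_ne_zero.2 (hg.analyticOrderAt_ne_zero.2 hg0)
  obtain ⟨f, hf, hfg⟩ := (natCast_le_analyticOrderAt hg).1 h1
  refine (natCast_le_analyticOrderAt hF).2 ⟨f, hf, ?_⟩
  filter_upwards [hgF, hfg] with z h2 h3
  rw [h2, h3, pow_one, pow_succ, mul_smul]

variable {M N : ℕ} {κ q : ℂ}

/-- Admissible parameters: nonzero, in the open unit disc. -/
def Adm (v : Fin M → ℂ) : Prop := ∀ i, v i ≠ 0 ∧ ‖v i‖ < 1

theorem analyticAt_Df (N : ℕ) (hq : ‖q‖ < 1) {v a : Fin M → ℂ} (hv : Adm v) (ha : Adm a) :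
    AnalyticAt ℂ (fun P => Df N κ q P v a) 0 := by
  obtain ⟨U, hU, hUo, h0⟩ := eventually_nhds_iff.1 (eventually_Dom κ hv ha)
  have hd : DifferentiableOn ℂ (fun P => Df N κ q P v a) U :=
    differentiableOn_Df (P := fun P => P) (v := fun _ => v) (a := fun _ => a) N hq hUo
      differentiableOn_id (fun i => differentiableOn_const _) (fun i => differentiableOn_const _) hU
  exact hd.analyticAt (hUo.mem_nhds h0)

/-- The defect vanishes to order `k` at `P = 0`. -/
def Van (N k : ℕ) (κ q : ℂ) (v a : Fin M → ℂ) : Prop :=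
  (k : ℕ∞) ≤ analyticOrderAt (fun P => Df N κ q P v a) 0

/-- The `k`-th coefficient of the defect at `P = 0`. -/
noncomputable def lc (N k : ℕ) (κ q : ℂ) (v a : Fin M → ℂ) : ℂ :=
  limUnder (𝓝[≠] 0) fun P => Df N κ q P v a / P ^ k

theorem tendsto_lc (hq : ‖q‖ < 1) {v a : Fin M → ℂ} (hv : Adm v) (ha : Adm a) {k : ℕ}
    (h : Van N k κ q v a) :
    Tendsto (fun P => Df N κ q P v a / P ^ k) (𝓝[≠] 0) (𝓝 (lc N k κ q v a)) :=
  tendsto_nhds_limUnder (tendsto_div_pow_of_le_order (analyticAt_Df N hq hv ha) h)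

theorem Van.succ (hq : ‖q‖ < 1) {v a : Fin M → ℂ} (hv : Adm v) (ha : Adm a) {k : ℕ}
    (h : Van N k κ q v a) (h0 : lc N k κ q v a = 0) : Van N (k + 1) κ q v a :=
  succ_le_order_of_tendsto (analyticAt_Df N hq hv ha) h (h0 ▸ tendsto_lc hq hv ha h)

theorem lc_perm (k : ℕ) (v a : Fin M → ℂ) (σ : Equiv.Perm (Fin M)) :
    lc N k κ q v (a ∘ σ) = lc N k κ q v a := by
  simp_rw [lc, Df_perm]

theorem lc_self (hq : ‖q‖ < 1) (hκ : κ ^ 2 = q) {v : Fin M → ℂ} (hv : Adm v) (k : ℕ) :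
    lc N k κ q v v = 0 := by
  refine Tendsto.limUnder_eq (tendsto_const_nhds.congr' ?_)
  filter_upwards [(eventually_Dom κ hv hv).filter_mono nhdsWithin_le_nhds] with P hP
  rw [Df_self N hq hκ hP, zero_div]

theorem circleIntegral_inv_smul_eq (F : ℂ → ℂ) {r : ℝ} (hr : 0 < r) :
    (∮ z in C(0, r), (z - 0)⁻¹ • F z) =
      (2 * π * Complex.I : ℂ) * torusInt 1 (fun z => F (r * z 0)) := by
  rw [circleIntegral_def_Icc, torusInt_eq, pow_one]
  have h1 : (∫ θ : Fin 1 → ℝ, F (r * cxs θ 0) ∂Measure.pi fun _ => arc) =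
      ∫ θ, F (r * cx θ) ∂arc :=
    (measurePreserving_funUnique arc (Fin 1)).integral_comp' (fun θ => F (r * cx θ))
  rw [h1, ← mul_assoc]
  have h2 : (2 * π * Complex.I : ℂ) * ((1 / (2 * π) : ℝ) : ℂ) = Complex.I := by
    have : (π : ℂ) ≠ 0 := by exact_mod_cast Real.pi_ne_zero
    push_cast; field_simp
  rw [h2, ← integral_const_mul]
  refine integral_congr_ae (Eventually.of_forall fun θ => ?_)
  have hc : circleMap 0 r θ = r * cx θ := by rw [circleMap_zero, cx, mul_comm Complex.I]
  have h0 : (r : ℂ) * cx θ ≠ 0 := mul_ne_zero (by exact_mod_cast hr.ne') (cx_ne_zero θ)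
  simp only [deriv_circleMap, hc, sub_zero, smul_eq_mul]
  rw [mul_comm _ Complex.I, mul_assoc, mul_inv_cancel_left₀ h0]

theorem differentiableOn_lc (k : ℕ) (hq : ‖q‖ < 1) {U : Set ℂ} (hU : IsOpen U)
    {v a : ℂ → Fin M → ℂ} (hv : ∀ i, DifferentiableOn ℂ (fun s => v s i) U)
    (ha : ∀ i, DifferentiableOn ℂ (fun s => a s i) U) (hva : ∀ s ∈ U, Adm (v s))
    (haa : ∀ s ∈ U, Adm (a s)) (h : ∀ s ∈ U, Van N k κ q (v s) (a s)) :
    DifferentiableOn ℂ (fun s => lc N k κ q (v s) (a s)) U := by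
  intro s₀ hs₀
  obtain ⟨c, hc0, hcv, hca⟩ : ∃ c : ℝ, 0 < c ∧ (∀ i, c < ‖v s₀ i‖) ∧ ∀ i, c < ‖a s₀ i‖ := by
    have e1 : ∀ᶠ c in 𝓝[>] (0 : ℝ), (∀ i, c < ‖v s₀ i‖) ∧ ∀ i, c < ‖a s₀ i‖ :=
      Eventually.filter_mono nhdsWithin_le_nhds
        ((eventually_all.2 fun i => eventually_lt_nhds (norm_pos_iff.2 (hva s₀ hs₀ i).1)).and
        (eventually_all.2 fun i => eventually_lt_nhds (norm_pos_iff.2 (haa s₀ hs₀ i).1)))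
    obtain ⟨c, h1, h2⟩ := (e1.and self_mem_nhdsWithin).exists
    exact ⟨c, h2, h1⟩
  have hcont : ∀ {f : ℂ → ℂ}, DifferentiableOn ℂ f U → c < ‖f s₀‖ → ∀ᶠ s in 𝓝 s₀, c < ‖f s‖ :=
    fun hf h => ((hf.continuousOn.continuousAt (hU.mem_nhds hs₀)).norm.eventually
      (lt_mem_nhds h))
  obtain ⟨W, hW, hWo, hsW⟩ := eventually_nhds_iff.1 ((show ∀ᶠ s in 𝓝 s₀, s ∈ U from hU.mem_nhds hs₀).and
    ((eventually_all.2 fun i => hcont (hv i) (hcv i)).and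
      (eventually_all.2 fun i => hcont (ha i) (hca i))))
  obtain ⟨r, hr0, hr1, hrc⟩ : ∃ r : ℝ, 0 < r ∧ 2 * r < 1 ∧ 2 * r * ‖κ‖ < c := by
    have e1 : ∀ᶠ r in 𝓝[>] (0 : ℝ), 2 * r < 1 ∧ 2 * r * ‖κ‖ < c :=
      Eventually.filter_mono nhdsWithin_le_nhds
        (((by fun_prop : Continuous fun r : ℝ => 2 * r).tendsto' 0 0 (by simp)).eventually
          (gt_mem_nhds one_pos) |>.and
        (((by fun_prop : Continuous fun r : ℝ => 2 * r * ‖κ‖).tendsto' 0 0 (by simp)).eventually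
          (gt_mem_nhds hc0)))
    obtain ⟨r, h1, h2⟩ := (e1.and self_mem_nhdsWithin).exists
    exact ⟨r, h2, h1⟩
  have hdom : ∀ s ∈ W, ∀ P ∈ Metric.ball (0 : ℂ) (2 * r), Dom κ P (v s) (a s) := by
    intro s hs P hP
    rw [mem_ball_zero_iff] at hP
    have h1 : ‖P * κ‖ < c := by
      rw [norm_mul]
      exact (mul_le_mul_of_nonneg_right hP.le (norm_nonneg _)).trans_lt hrc
    exact ⟨hP.trans hr1, fun i => ⟨h1.trans ((hW s hs).2.1 i), (hva s (hW s hs).1 i).2⟩,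
      fun i => ⟨h1.trans ((hW s hs).2.2 i), (haa s (hW s hs).1 i).2⟩⟩
  have hWU : W ⊆ U := fun s hs => (hW s hs).1
  have hrep : ∀ s ∈ W, lc N k κ q (v s) (a s) =
      torusInt 1 (fun z => Df N κ q (r * z 0) (v s) (a s) / (r * z 0) ^ k) := by
    intro s hs
    have hd : DifferentiableOn ℂ (fun P => Df N κ q P (v s) (a s)) (Metric.ball 0 (2 * r)) :=
      differentiableOn_Df (P := fun P => P) (v := fun _ => v s) (a := fun _ => a s) N hq
        Metric.isOpen_ball differentiableOn_id (fun i => differentiableOn_const _) (fun i => differentiableOn_const _) (hdom s hs)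
    have hd' : DifferentiableOn ℂ (fun P => Df N κ q P (v s) (a s) / P ^ k)
        (Metric.ball 0 (2 * r) \ {0}) :=
      (hd.mono Set.sdiff_subset).div (differentiableOn_id.pow k) fun P hP => pow_ne_zero k hP.2
    have ho : IsOpen (Metric.ball (0 : ℂ) (2 * r) \ {0}) :=
      Metric.isOpen_ball.sdiff isClosed_singleton
    have hcb : Metric.closedBall (0 : ℂ) r ⊆ Metric.ball 0 (2 * r) :=
      Metric.closedBall_subset_ball (by linarith)
    have := Complex.circleIntegral_sub_center_inv_smul_of_differentiable_on_off_countable_of_tendsto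
      hr0 Set.countable_empty (hd'.continuousOn.mono (Set.sdiff_subset_sdiff_left hcb))
      (fun z hz => hd'.differentiableAt (ho.mem_nhds
        ⟨hcb (Metric.ball_subset_closedBall hz.1.1), hz.1.2⟩))
      (tendsto_lc hq (hva s (hWU hs)) (haa s (hWU hs)) (h s (hWU hs)))
    rw [circleIntegral_inv_smul_eq _ hr0, smul_eq_mul] at this
    exact (mul_left_cancel₀ Complex.two_pi_I_ne_zero this).symm
  have hmain : DifferentiableOn ℂ (fun s => torusInt 1
      (fun z => Df N κ q (r * z 0) (v s) (a s) / (r * z 0) ^ k)) W := by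
    have hz1 : ∀ z ∈ tor 1, (r : ℂ) * z 0 ∈ Metric.ball (0 : ℂ) (2 * r) := fun z hz => by
      rw [mem_ball_zero_iff, norm_mul, hz 0, Complex.norm_real, Real.norm_of_nonneg hr0.le]
      linarith
    have hz0 : ∀ z ∈ tor 1, (r : ℂ) * z 0 ≠ 0 := fun z hz =>
      mul_ne_zero (by exact_mod_cast hr0.ne') (tor_ne_zero hz 0)
    refine differentiableOn_torusInt hWo ?_ fun z hz => ?_
    · refine ContinuousOn.div ?_ (by fun_prop) fun x hx => pow_ne_zero k (hz0 _ hx.2)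
      have := continuousOn_Df (X := ℂ × ℂ) (K := W ×ˢ Metric.ball (0 : ℂ) (2 * r)) (κ := κ)
        (P := fun x => x.2) (v := fun x => v x.1) (a := fun x => a x.1) N hq
        (hWo.prod Metric.isOpen_ball) continuousOn_snd
        (fun i => ((hv i).mono hWU).continuousOn.comp continuousOn_fst fun x hx => hx.1)
        (fun i => ((ha i).mono hWU).continuousOn.comp continuousOn_fst fun x hx => hx.1)
        fun x hx => hdom x.1 hx.1 x.2 hx.2
      exact this.comp (f := fun x : ℂ × (Fin 1 → ℂ) => (x.1, (r : ℂ) * x.2 0)) (by fun_prop)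
        fun x hx => ⟨hx.1, hz1 _ hx.2⟩
    · exact (differentiableOn_Df N hq hWo (differentiableOn_const _)
        (fun i => (hv i).mono hWU) (fun i => (ha i).mono hWU)
        fun s hs => hdom s hs _ (hz1 z hz)).div_const _
  exact (((hmain s₀ hsW).differentiableAt (hWo.mem_nhds hsW)).congr_of_eventuallyEq
    (Filter.eventuallyEq_of_mem (hWo.mem_nhds hsW) hrep)).differentiableWithinAt

end

section
open Filter Topology

theorem isPreconnected_annulus {a : ℝ} (ha : 0 < a) :
    IsPreconnected {x : ℂ | a < ‖x‖ ∧ ‖x‖ < 1} := by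
  have h1 : IsPreconnected {w : ℂ | Real.log a < w.re ∧ w.re < 0} :=
    (((convex_Ioo (Real.log a) 0).is_linear_preimage Complex.reLm.isLinear)).isPreconnected
  convert! h1.image Complex.exp Complex.continuous_exp.continuousOn using 1
  ext x
  constructor
  · rintro ⟨h2, h3⟩
    have hx : 0 < ‖x‖ := ha.trans h2
    refine ⟨Complex.log x, ⟨?_, ?_⟩, Complex.exp_log (norm_pos_iff.1 hx)⟩
    · rw [Complex.log_re]; exact Real.log_lt_log ha h2
    · rw [Complex.log_re]; exact Real.log_neg hx h3
  · rintro ⟨w, ⟨h2, h3⟩, rfl⟩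
    refine ⟨?_, ?_⟩
    · rw [Complex.norm_exp]; exact (Real.log_lt_iff_lt_exp ha).1 h2
    · rw [Complex.norm_exp, ← Real.exp_zero]; exact Real.exp_lt_exp.2 h3

/-- A holomorphic function on an annulus containing a fundamental domain of `x ↦ q x`, and
invariant under this map, is constant. -/
theorem eq_of_q_invariant {q : ℂ} {c : ℝ} (hc0 : 0 < c) (hcq : c < ‖q‖) (hq : ‖q‖ < 1) {f : ℂ → ℂ}
    (hf : DifferentiableOn ℂ f {x | c < ‖x‖ ∧ ‖x‖ < 1})
    (hinv : ∀ x, c / ‖q‖ < ‖x‖ → ‖x‖ < 1 → f (q * x) = f x) {x y : ℂ}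
    (hx : c < ‖x‖ ∧ ‖x‖ < 1) (hy : c < ‖y‖ ∧ ‖y‖ < 1) : f x = f y := by
  have hq0 : 0 < ‖q‖ := hc0.trans hcq
  have hqn : q ≠ 0 := norm_pos_iff.1 hq0
  obtain ⟨ρ, hρ1, hρ2⟩ := exists_between ((div_lt_one hq0).2 hcq)
  have hρ0 : 0 < ρ := (div_pos hc0 hq0).trans hρ1
  rw [div_lt_iff₀ hq0] at hρ1
  set A : Set ℂ := {x | c < ‖x‖ ∧ ‖x‖ < 1} with hA
  have hAo : IsOpen A := (isOpen_lt continuous_const continuous_norm).inter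
    (isOpen_lt continuous_norm continuous_const)
  set K : Set ℂ := {x | ρ * ‖q‖ ≤ ‖x‖ ∧ ‖x‖ ≤ ρ} with hK
  have hKA : K ⊆ A := fun x hx => ⟨hρ1.trans_le hx.1, hx.2.trans_lt hρ2⟩
  have hKc : IsCompact K := by
    refine (isCompact_closedBall (0 : ℂ) ρ).of_isClosed_subset ?_ fun x hx => ?_
    · exact (isClosed_le continuous_const continuous_norm).inter
        (isClosed_le continuous_norm continuous_const)
    · rw [mem_closedBall_zero_iff]; exact hx.2
  have hρK : (ρ : ℂ) ∈ K := by
    have : ‖(ρ : ℂ)‖ = ρ := by rw [Complex.norm_real, Real.norm_of_nonneg hρ0.le]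
    refine ⟨?_, this.le⟩
    rw [this]; nlinarith
  obtain ⟨x₀, hx₀, hmax⟩ := hKc.exists_isMaxOn ⟨_, hρK⟩ (hf.continuousOn.mono hKA).norm
  have hloc : IsLocalMax (norm ∘ f) x₀ := by
    have e1 : ∀ᶠ x in 𝓝 x₀, x ∈ A := hAo.mem_nhds (hKA hx₀)
    have e2 : ∀ᶠ x in 𝓝 x₀, ‖x‖ * ‖q‖ < ρ :=
      (continuous_norm.mul continuous_const).continuousAt.eventually
        (gt_mem_nhds (by change ‖x₀‖ * ‖q‖ < ρ; nlinarith [hx₀.2]))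
    have e3 : ∀ᶠ x in 𝓝 x₀, ρ * ‖q‖ * ‖q‖ < ‖x‖ :=
      continuous_norm.continuousAt.eventually
        (lt_mem_nhds (lt_of_lt_of_le (by nlinarith [mul_pos hρ0 hq0]) hx₀.1))
    filter_upwards [e1, e2, e3] with x h1 h2 h3
    change ‖f x‖ ≤ ‖f x₀‖
    rcases lt_or_ge ρ ‖x‖ with h4 | h4
    · rw [← hinv x ((div_lt_iff₀ hq0).2 (hρ1.trans (by gcongr))) h1.2]
      refine hmax ⟨?_, ?_⟩ <;> rw [norm_mul] <;> nlinarith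
    · rcases lt_or_ge ‖x‖ (ρ * ‖q‖) with h5 | h5
      · have h6 : ‖x / q‖ = ‖x‖ / ‖q‖ := norm_div _ _
        have h7 : ‖x / q‖ < ρ := by rw [h6, div_lt_iff₀ hq0]; exact h5
        rw [show x = q * (x / q) by field_simp, hinv _ ?_ (h7.trans hρ2)]
        · refine hmax ⟨?_, h7.le⟩
          rw [h6, le_div_iff₀ hq0]; exact h3.le
        · rw [h6]; exact div_lt_div_of_pos_right h1.1 hq0
      · exact hmax ⟨h5, h4⟩
  have hd : ∀ᶠ x in 𝓝 x₀, DifferentiableAt ℂ f x := by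
    filter_upwards [hAo.mem_nhds (hKA hx₀)] with x hx using hf.differentiableAt (hAo.mem_nhds hx)
  have hconst : f =ᶠ[𝓝 x₀] fun _ => f x₀ := Complex.eventually_eq_of_isLocalMax_norm hd hloc
  have hall := (hf.analyticOnNhd hAo).eqOn_of_preconnected_of_eventuallyEq
    (analyticOnNhd_const (v := f x₀)) (isPreconnected_annulus hc0) (hKA hx₀) hconst
  exact (hall hx).trans (hall hy).symm

variable {M N : ℕ} {κ q : ℂ}

/-- The defect vanishes to order `k` for all admissible balanced parameters. -/
def VanAll (N k : ℕ) (κ q : ℂ) : Prop :=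
  ∀ v a : Fin (2 * N + 2) → ℂ, Adm v → Adm a → ∏ i, v i = ∏ i, a i → Van N k κ q v a

theorem Adm.update {v : Fin M → ℂ} (hv : Adm v) (i : Fin M) {x : ℂ} (hx : x ≠ 0) (hx1 : ‖x‖ < 1) :
    Adm (Function.update v i x) := by
  intro j
  rcases eq_or_ne j i with rfl | h
  · simpa using ⟨hx, hx1⟩
  · simpa [h] using hv j

theorem prod_update_mul (v : Fin M → ℂ) (i : Fin M) (x : ℂ) :
    ∏ j, Function.update v i (x * v i) j = x * ∏ j, v j := by
  rw [Finset.prod_update_of_mem (Finset.mem_univ i), ← Finset.mul_prod_erase _ v (Finset.mem_univ i),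
    Finset.sdiff_singleton_eq_erase, mul_assoc]

theorem lc_update_eq (hκ : κ ^ 2 = q) (hκ0 : κ ≠ 0) (hq : ‖q‖ < 1) {k : ℕ}
    (hV : VanAll N k κ q) {v b : Fin (2 * N + 2) → ℂ} (hv : Adm v) (hb : Adm b)
    (hvi : Function.Injective v) {j₁ j₂ : Fin (2 * N + 2)} (hj : j₁ ≠ j₂)
    (hq1 : ‖b j₁‖ < ‖q‖) (hq2 : ‖b j₂‖ < ‖q‖) (hbal : q * ∏ i, v i = ∏ i, b i) :
    lc N k κ q v (Function.update b j₁ (b j₁ / q)) =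
      lc N k κ q v (Function.update b j₂ (b j₂ / q)) := by
  have hq0 : q ≠ 0 := by rw [← hκ]; exact pow_ne_zero 2 hκ0
  have hqn : 0 < ‖q‖ := norm_pos_iff.2 hq0
  rcases eq_or_ne (b j₁) (b j₂) with hbj | hbj
  · rw [← lc_perm k v (Function.update b j₂ (b j₂ / q)) (Equiv.swap j₁ j₂)]
    congr 1
    funext i
    simp only [Function.comp, Function.update_apply]
    rcases eq_or_ne i j₁ with rfl | h1
    · simp [hbj]
    · rcases eq_or_ne i j₂ with rfl | h2
      · simp [h1, hj, hbj]
      · rw [Equiv.swap_apply_of_ne_of_ne h1 h2]; simp [h1, h2]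
  obtain ⟨T, -, hT⟩ := Finset.exists_subset_card_eq
    (show N ≤ (Finset.univ : Finset (Fin (2 * N + 2))).card by simp; omega)
  have key : ∀ j, ‖b j‖ < ‖q‖ → Tendsto
      (fun P => Df N κ q P v (Function.update b j (b j / q)) / P ^ k) (𝓝[≠] 0)
      (𝓝 (lc N k κ q v (Function.update b j (b j / q)))) := by
    intro j hjq
    have ha : Adm (Function.update b j (b j / q)) :=
      hb.update j (div_ne_zero (hb j).1 hq0) (by rwa [norm_div, div_lt_one hqn])
    refine tendsto_lc hq hv ha (hV _ _ hv ha ?_)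
    rw [div_eq_inv_mul, prod_update_mul, ← hbal, inv_mul_cancel_left₀ hq0]
  refine limit_eq_limit N hκ hκ0 hq hv hb hj hbj hq1 hq2 hT (fun x _ y _ h => hvi.ne h) hbal k
    (key j₁ hq1) (key j₂ hq2) fun x _ => ?_
  have hv' : Adm (Function.update v x (q * v x)) :=
    hv.update x (mul_ne_zero hq0 (hv x).1) (norm_mul_lt_one hq (hv x).2)
  exact ⟨_, tendsto_lc hq hv' hb (hV _ _ hv' hb (by rw [prod_update_mul, hbal]))⟩

theorem prod_update_update (a : Fin M → ℂ) {j₁ j₂ : Fin M} (hj : j₁ ≠ j₂) {x y r : ℂ}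
    (h : x * y = r * (a j₁ * a j₂)) :
    ∏ i, Function.update (Function.update a j₁ x) j₂ y i = r * ∏ i, a i := by
  have e : ∀ f : Fin M → ℂ, ∏ i, f i = f j₁ * f j₂ * ∏ i ∈ (Finset.univ.erase j₁).erase j₂, f i := by
    intro f
    rw [← Finset.mul_prod_erase _ f (Finset.mem_univ j₁), mul_assoc,
      ← Finset.mul_prod_erase (Finset.univ.erase j₁) f (Finset.mem_erase.2 ⟨hj.symm, Finset.mem_univ _⟩)]
  rw [e, e a]
  have e2 : ∏ i ∈ (Finset.univ.erase j₁).erase j₂, Function.update (Function.update a j₁ x) j₂ y i =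
      ∏ i ∈ (Finset.univ.erase j₁).erase j₂, a i := by
    refine Finset.prod_congr rfl fun i hi => ?_
    simp only [Finset.mem_erase] at hi
    simp [hi.1, hi.2.1]
  rw [e2]
  simp only [Function.update_self, Function.update_of_ne hj]
  rw [h, mul_assoc]

theorem lc_update_update (hκ : κ ^ 2 = q) (hκ0 : κ ≠ 0) (hq : ‖q‖ < 1) {k : ℕ}
    (hV : VanAll N k κ q) {v a : Fin (2 * N + 2) → ℂ} (hv : Adm v) (ha : Adm a)
    (hvi : Function.Injective v) {j₁ j₂ : Fin (2 * N + 2)} (hj : j₁ ≠ j₂)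
    (hbal : ∏ i, v i = ∏ i, a i) (hc : ‖a j₁ * a j₂‖ < ‖q‖) {x : ℂ}
    (hx : ‖a j₁ * a j₂‖ < ‖x‖ ∧ ‖x‖ < 1) :
    lc N k κ q v (Function.update (Function.update a j₁ x) j₂ (a j₁ * a j₂ / x)) =
      lc N k κ q v a := by
  have hq0 : q ≠ 0 := by rw [← hκ]; exact pow_ne_zero 2 hκ0
  have hqn : 0 < ‖q‖ := norm_pos_iff.2 hq0
  set c := a j₁ * a j₂ with hcdef
  have hc0 : c ≠ 0 := mul_ne_zero (ha j₁).1 (ha j₂).1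
  have hcn : 0 < ‖c‖ := norm_pos_iff.2 hc0
  set w : ℂ → Fin (2 * N + 2) → ℂ := fun x =>
    Function.update (Function.update a j₁ x) j₂ (c / x) with hw
  have hx0 : ∀ x : ℂ, ‖c‖ < ‖x‖ → x ≠ 0 := fun x h => norm_pos_iff.1 (hcn.trans h)
  have hwa : w (a j₁) = a := by
    rw [hw]
    simp only [Function.update_eq_self]
    rw [hcdef, mul_div_cancel_left₀ _ (ha j₁).1, Function.update_eq_self]
  have hAdm : ∀ x : ℂ, ‖c‖ < ‖x‖ → ‖x‖ < 1 → Adm (w x) := fun x h1 h2 =>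
    (ha.update j₁ (hx0 x h1) h2).update j₂ (div_ne_zero hc0 (hx0 x h1)) (by
      rw [norm_div, div_lt_one (hcn.trans h1)]; exact h1)
  have hprod : ∀ x : ℂ, x ≠ 0 → ∏ i, w x i = ∏ i, a i := fun x h => by
    rw [hw, prod_update_update a hj (r := 1) (by rw [one_mul, mul_div_cancel₀ _ h]), one_mul]
  have hAo : IsOpen {x : ℂ | ‖c‖ < ‖x‖ ∧ ‖x‖ < 1} :=
    (isOpen_lt continuous_const continuous_norm).inter (isOpen_lt continuous_norm continuous_const)
  have hd : DifferentiableOn ℂ (fun x => lc N k κ q v (w x)) {x | ‖c‖ < ‖x‖ ∧ ‖x‖ < 1} := by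
    refine differentiableOn_lc k hq hAo (v := fun _ => v) (fun i => differentiableOn_const _)
      (fun i => ?_) (fun _ _ => hv) (fun x hx => hAdm x hx.1 hx.2)
      fun x hx => hV _ _ hv (hAdm x hx.1 hx.2) (hbal.trans (hprod x (hx0 x hx.1)).symm)
    simp only [hw, Function.update_apply]
    split_ifs
    · exact (differentiableOn_const _).div differentiableOn_id fun x hx => hx0 x hx.1
    · exact differentiableOn_id
    · exact differentiableOn_const _
  have ha1 : ‖c‖ < ‖a j₁‖ := by
    rw [hcdef, norm_mul]
    exact mul_lt_of_lt_one_right (norm_pos_iff.2 (ha j₁).1) (ha j₂).2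
  have := eq_of_q_invariant hcn hc hq hd (fun x h1 h2 => ?_) hx ⟨ha1, (ha j₁).2⟩
  · rw [hwa] at this; exact this
  have h1' : ‖c‖ / ‖x‖ < ‖q‖ := by
    rw [div_lt_iff₀ hqn] at h1
    rw [div_lt_iff₀ (lt_of_le_of_ne (norm_nonneg _) fun h => by
      rw [← h, zero_mul] at h1; exact hcn.not_gt h1), mul_comm]
    exact h1
  have hxn : x ≠ 0 := fun h => by
    rw [h, norm_zero] at h1; exact (div_nonneg hcn.le hqn.le).not_gt h1
  have hb : Adm (Function.update (Function.update a j₁ (q * x)) j₂ (c / x)) :=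
    (ha.update j₁ (mul_ne_zero hq0 hxn) (norm_mul_lt_one hq h2)).update j₂
      (div_ne_zero hc0 hxn) (by rw [norm_div]; exact h1'.trans hq)
  have := lc_update_eq hκ hκ0 hq hV hv hb hvi hj ?_ ?_ ?_
  · simp only [Function.update_self, Function.update_of_ne hj] at this
    change lc N k κ q v (Function.update (Function.update a j₁ (q * x)) j₂ (c / (q * x))) =
      lc N k κ q v (Function.update (Function.update a j₁ x) j₂ (c / x))
    convert! this.symm using 2
    · rw [Function.update_idem, div_div, mul_comm x]
    · rw [Function.update_comm hj, Function.update_comm hj, Function.update_idem,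
        mul_div_cancel_left₀ _ hq0]
  · simp only [Function.update_self, Function.update_of_ne hj]
    rw [norm_mul]; exact mul_lt_of_lt_one_right hqn h2
  · simp only [Function.update_self]
    rw [norm_div]; exact h1'
  · rw [hbal, prod_update_update a hj (r := q)]
    rw [← hcdef]; field_simp

end

section
open Filter Topology
variable {M N : ℕ} {κ q : ℂ}

theorem lc_eq_zero_of_small (hκ : κ ^ 2 = q) (hκ0 : κ ≠ 0) (hq : ‖q‖ < 1) {k : ℕ}
    (hV : VanAll N k κ q) {v a : Fin (2 * N + 2) → ℂ} (hv : Adm v) (ha : Adm a)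
    (hvi : Function.Injective v) (hbal : ∏ i, v i = ∏ i, a i) (haq : ∀ i, ‖a i‖ < ‖q‖)
    (l : Fin (2 * N + 2)) (hS : ∀ S : Finset (Fin (2 * N + 2)), ‖a l * ∏ i ∈ S, a i / v i‖ < 1) :
    lc N k κ q v a = 0 := by
  set w : Finset (Fin (2 * N + 2)) → Fin (2 * N + 2) → ℂ := fun S =>
    Function.update (fun i => if i ∈ S then v i else a i) l (a l * ∏ i ∈ S, a i / v i) with hw
  have hAdm : ∀ S, Adm (w S) := fun S => by
    refine Adm.update (fun i => ?_) l (mul_ne_zero (ha l).1 (Finset.prod_ne_zero_iff.2 fun i _ =>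
      div_ne_zero (ha i).1 (hv i).1)) (hS S)
    split_ifs
    · exact hv i
    · exact ha i
  have key : ∀ S : Finset (Fin (2 * N + 2)), l ∉ S →
      (∏ i, w S i = ∏ i, v i) ∧ lc N k κ q v (w S) = lc N k κ q v a := by
    intro S
    induction S using Finset.induction_on with
    | empty =>
      intro _
      have : w ∅ = a := by simp [hw]
      rw [this]; exact ⟨hbal.symm, rfl⟩
    | insert j S hj ih =>
      intro hl
      rw [Finset.mem_insert, not_or] at hl
      obtain ⟨ih1, ih2⟩ := ih hl.2
      have hwj : w S j = a j := by simp [hw, Ne.symm hl.1, hj]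
      have hwl : w S l = a l * ∏ i ∈ S, a i / v i := by simp [hw]
      have hc : w S j * w S l / v j = a l * ∏ i ∈ insert j S, a i / v i := by
        rw [Finset.prod_insert hj, hwj, hwl]; ring
      have hnew : w (insert j S) =
          Function.update (Function.update (w S) j (v j)) l (w S j * w S l / v j) := by
        rw [hc, hw]
        funext i
        simp only [Function.update_apply, Finset.mem_insert]
        split_ifs <;> simp_all
      have h1 : ‖w S j * w S l‖ < ‖v j‖ := by
        have := hS (insert j S)
        rwa [← hc, norm_div, div_lt_one (norm_pos_iff.2 (hv j).1)] at this
      have h2 : ‖w S j * w S l‖ < ‖q‖ := by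
        rw [norm_mul, hwj]
        exact (mul_le_of_le_one_right (norm_nonneg _) (hAdm S l).2.le).trans_lt (haq j)
      refine ⟨?_, ?_⟩
      · rw [hnew, prod_update_update (w S) (Ne.symm hl.1) (r := 1), one_mul, ih1]
        rw [one_mul, mul_div_cancel₀ _ (hv j).1]
      · rw [hnew, ← ih2]
        exact lc_update_update hκ hκ0 hq hV hv (hAdm S) hvi (Ne.symm hl.1) ih1.symm h2
          ⟨h1, (hv j).2⟩
  obtain ⟨h1, h2⟩ := key (Finset.univ.erase l) (Finset.notMem_erase _ _)
  have hwv : w (Finset.univ.erase l) = v := by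
    have h3 : ∀ i ≠ l, w (Finset.univ.erase l) i = v i := fun i hi => by simp [hw, hi]
    funext i
    by_cases hi : i = l
    · subst hi
      rw [← Finset.mul_prod_erase _ _ (Finset.mem_univ i),
        ← Finset.mul_prod_erase _ v (Finset.mem_univ i),
        Finset.prod_congr rfl fun j hj => h3 j (Finset.ne_of_mem_erase hj)] at h1
      exact mul_right_cancel₀ (Finset.prod_ne_zero_iff.2 fun j _ => (hv j).1) h1
    · exact h3 i hi
  rw [← h2, hwv, lc_self hq hκ hv]

theorem convex_norm_mul_exp_lt {x : ℂ} (hx : x ≠ 0) (μ : ℂ) :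
    Convex ℝ {s : ℂ | ‖x * Complex.exp (s * μ)‖ < 1} := by
  have : {s : ℂ | ‖x * Complex.exp (s * μ)‖ < 1} =
      (Complex.reLm ∘ₗ LinearMap.mulRight ℝ μ) ⁻¹' Set.Iio (-Real.log ‖x‖) := by
    ext s
    have hx' : 0 < ‖x‖ := norm_pos_iff.2 hx
    change ‖x * Complex.exp (s * μ)‖ < 1 ↔ (s * μ).re < -Real.log ‖x‖
    rw [norm_mul, Complex.norm_exp, ← Real.log_inv, Real.lt_log_iff_exp_lt (inv_pos.2 hx'),
      ← div_eq_one_iff_eq one_ne_zero |>.2 rfl, lt_inv_comm₀ (Real.exp_pos _) hx',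
      ← one_div, lt_div_iff₀ (Real.exp_pos _)]
    simp
  rw [this]
  exact (convex_Iio _).linear_preimage _

theorem exists_log_path {v a w : Fin (M + 1) → ℂ} (hv : ∀ i, v i ≠ 0) (ha : ∀ i, a i ≠ 0)
    (hw : ∀ i, w i ≠ 0) (hbal : ∏ i, v i = ∏ i, a i) :
    ∃ μ ν : Fin (M + 1) → ℂ, (∀ i, v i * Complex.exp (μ i) = w i) ∧
      (∀ i, a i * Complex.exp (ν i) = w i) ∧ ∑ i, μ i = ∑ i, ν i := by
  have h1 : ∀ i, v i * Complex.exp (Complex.log (w i / v i)) = w i := fun i => by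
    rw [Complex.exp_log (div_ne_zero (hw i) (hv i)), mul_div_cancel₀ _ (hv i)]
  have h2 : ∀ i, a i * Complex.exp (Complex.log (w i / a i)) = w i := fun i => by
    rw [Complex.exp_log (div_ne_zero (hw i) (ha i)), mul_div_cancel₀ _ (ha i)]
  have h3 : Complex.exp (∑ i, Complex.log (w i / v i)) = Complex.exp (∑ i, Complex.log (w i / a i)) := by
    have e1 := Finset.prod_congr rfl fun i (_ : i ∈ Finset.univ) => (h1 i).trans (h2 i).symm
    rw [Finset.prod_mul_distrib, Finset.prod_mul_distrib, hbal, ← Complex.exp_sum,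
      ← Complex.exp_sum] at e1
    exact mul_left_cancel₀ (Finset.prod_ne_zero_iff.2 fun i _ => ha i) e1
  obtain ⟨n, hn⟩ := Complex.exp_eq_exp_iff_exists_int.1 h3
  refine ⟨fun i => Complex.log (w i / v i), fun i => Complex.log (w i / a i) +
    if i = 0 then n * (2 * π * Complex.I) else 0, h1, fun i => ?_, ?_⟩
  · dsimp only
    split_ifs
    · rw [Complex.exp_add, Complex.exp_int_mul_two_pi_mul_I, mul_one, h2]
    · rw [add_zero, h2]
  · rw [hn, Finset.sum_add_distrib, Finset.sum_ite_eq' Finset.univ (0 : Fin (M + 1)),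
      if_pos (Finset.mem_univ _)]

theorem lc_eq_zero (hκ : κ ^ 2 = q) (hκ0 : κ ≠ 0) (hq : ‖q‖ < 1) {k : ℕ}
    (hV : VanAll N k κ q) {v a : Fin (2 * N + 2) → ℂ} (hv : Adm v) (ha : Adm a)
    (hbal : ∏ i, v i = ∏ i, a i) : lc N k κ q v a = 0 := by
  have hq0 : q ≠ 0 := by rw [← hκ]; exact pow_ne_zero 2 hκ0
  have hqn : 0 < ‖q‖ := norm_pos_iff.2 hq0
  set w : Fin (2 * N + 2) → ℂ := fun i => q / ((i : ℕ) + 2 : ℕ) with hw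
  have hw0 : ∀ i, w i ≠ 0 := fun i => div_ne_zero hq0 (by norm_cast)
  have hwq : ∀ i, ‖w i‖ < ‖q‖ := fun i => by
    rw [hw, norm_div, Complex.norm_natCast]
    refine div_lt_self hqn ?_
    norm_cast; omega
  have hwi : Function.Injective w := fun i j h => by
    have h1 : ((((i : ℕ) + 2 : ℕ) : ℂ)) = (((j : ℕ) + 2 : ℕ) : ℂ) := by
      have := div_eq_div_iff (by norm_cast) (by norm_cast) |>.1 h
      exact (mul_left_cancel₀ hq0 this).symm
    have h2 : (i : ℕ) + 2 = j + 2 := by exact_mod_cast h1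
    exact Fin.ext (by omega)
  obtain ⟨μ, ν, hμ, hν, hμν⟩ := exists_log_path (fun i => (hv i).1) (fun i => (ha i).1) hw0 hbal
  set V : ℂ → Fin (2 * N + 2) → ℂ := fun s i => v i * Complex.exp (s * μ i) with hVdef
  set A : ℂ → Fin (2 * N + 2) → ℂ := fun s i => a i * Complex.exp (s * ν i) with hAdef
  have hVd : ∀ i, Differentiable ℂ fun s => V s i := fun i => by simp only [hVdef]; fun_prop
  have hAd : ∀ i, Differentiable ℂ fun s => A s i := fun i => by simp only [hAdef]; fun_prop
  have hV0 : ∀ s i, V s i ≠ 0 := fun s i => mul_ne_zero (hv i).1 (Complex.exp_ne_zero _)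
  have hA0 : ∀ s i, A s i ≠ 0 := fun s i => mul_ne_zero (ha i).1 (Complex.exp_ne_zero _)
  have hVA : ∀ s, ∏ i, V s i = ∏ i, A s i := fun s => by
    simp only [hVdef, hAdef, Finset.prod_mul_distrib, ← Complex.exp_sum, ← Finset.mul_sum]
    rw [hbal, hμν]
  have hV1 : V 1 = w := by funext i; simp only [hVdef, one_mul, hμ]
  have hA1 : A 1 = w := by funext i; simp only [hAdef, one_mul, hν]
  have hVz : V 0 = v := by funext i; simp [hVdef]
  have hAz : A 0 = a := by funext i; simp [hAdef]
  set U : Set ℂ := (⋂ i, {s | ‖V s i‖ < 1}) ∩ ⋂ i, {s | ‖A s i‖ < 1} with hU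
  have hUm : ∀ s, s ∈ U ↔ (∀ i, ‖V s i‖ < 1) ∧ ∀ i, ‖A s i‖ < 1 := fun s => by
    rw [hU, Set.mem_inter_iff, Set.mem_iInter, Set.mem_iInter]; rfl
  have hUo : IsOpen U :=
    (isOpen_iInter_of_finite fun i => isOpen_lt (hVd i).continuous.norm continuous_const).inter
      (isOpen_iInter_of_finite fun i => isOpen_lt (hAd i).continuous.norm continuous_const)
  have hUc : IsPreconnected U :=
    ((convex_iInter fun i => convex_norm_mul_exp_lt (hv i).1 (μ i)).inter
      (convex_iInter fun i => convex_norm_mul_exp_lt (ha i).1 (ν i))).isPreconnected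
  have hVa : ∀ s ∈ U, Adm (V s) := fun s hs i => ⟨hV0 s i, ((hUm s).1 hs).1 i⟩
  have hAa : ∀ s ∈ U, Adm (A s) := fun s hs i => ⟨hA0 s i, ((hUm s).1 hs).2 i⟩
  have hf : DifferentiableOn ℂ (fun s => lc N k κ q (V s) (A s)) U :=
    differentiableOn_lc k hq hUo (fun i => (hVd i).differentiableOn)
      (fun i => (hAd i).differentiableOn) hVa hAa
      fun s hs => hV _ _ (hVa s hs) (hAa s hs) (hVA s)
  have h0U : (0 : ℂ) ∈ U := (hUm 0).2 ⟨fun i => by rw [hVz]; exact (hv i).2, fun i => by rw [hAz]; exact (ha i).2⟩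
  have h1U : (1 : ℂ) ∈ U := (hUm 1).2
    ⟨fun i => by rw [hV1]; exact (hwq i).trans hq, fun i => by rw [hA1]; exact (hwq i).trans hq⟩
  have hev : (fun s => lc N k κ q (V s) (A s)) =ᶠ[𝓝 1] fun _ => 0 := by
    have e1 : ∀ᶠ s in 𝓝 (1 : ℂ), s ∈ U := hUo.mem_nhds h1U
    have e2 : ∀ᶠ s in 𝓝 (1 : ℂ), ∀ i, ‖A s i‖ < ‖q‖ := eventually_all.2 fun i =>
      (hAd i).continuous.norm.continuousAt.eventually
        (gt_mem_nhds (by change ‖A 1 i‖ < _; rw [hA1]; exact hwq i))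
    have e3 : ∀ᶠ s in 𝓝 (1 : ℂ), ∀ i j, i ≠ j → V s i ≠ V s j :=
      eventually_all.2 fun i => eventually_all.2 fun j => eventually_imp_distrib_left.2 fun hij =>
        ((hVd i).continuous.continuousAt.ne_iff_eventually_ne (hVd j).continuous.continuousAt).1
          (by rw [hV1]; exact hwi.ne hij)
    have e4 : ∀ᶠ s in 𝓝 (1 : ℂ), ∀ S : Finset (Fin (2 * N + 2)),
        ‖A s 0 * ∏ i ∈ S, A s i / V s i‖ < 1 := by
      refine eventually_all.2 fun S => ?_
      have hc : Continuous fun s => ‖A s 0 * ∏ i ∈ S, A s i / V s i‖ :=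
        ((hAd 0).continuous.mul (continuous_finsetProd _ fun i _ =>
          (hAd i).continuous.div (hVd i).continuous fun s => hV0 s i)).norm
      refine hc.continuousAt.eventually (gt_mem_nhds ?_)
      change ‖A 1 0 * ∏ i ∈ S, A 1 i / V 1 i‖ < 1
      rw [hA1, hV1, Finset.prod_eq_one fun i _ => div_self (hw0 i), mul_one]
      exact (hwq 0).trans hq
    filter_upwards [e1, e2, e3, e4] with s h1 h2 h3 h4
    exact lc_eq_zero_of_small hκ hκ0 hq hV (hVa s h1) (hAa s h1)
      (fun i j hij => by_contra fun h => h3 i j h hij) (hVA s) h2 0 h4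
  have := (hf.analyticOnNhd hUo).eqOn_of_preconnected_of_eventuallyEq
    (analyticOnNhd_const (v := (0 : ℂ))) hUc h1U hev h0U
  simpa only [hVz, hAz] using this

theorem vanAll (hκ : κ ^ 2 = q) (hκ0 : κ ≠ 0) (hq : ‖q‖ < 1) (k : ℕ) : VanAll N k κ q := by
  induction k with
  | zero => intro v a _ _ _; simp [Van]
  | succ k ih =>
    exact fun v a hv ha hbal => (ih v a hv ha hbal).succ hq hv ha (lc_eq_zero hκ hκ0 hq ih hv ha hbal)

theorem Dom.of_norm_le {P P' : ℂ} {v a : Fin M → ℂ} (h : Dom κ P v a) (hP : ‖P'‖ ≤ ‖P‖) :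
    Dom κ P' v a := by
  have h1 : ‖P' * κ‖ ≤ ‖P * κ‖ := by
    rw [norm_mul, norm_mul]; exact mul_le_mul_of_nonneg_right hP (norm_nonneg _)
  exact ⟨hP.trans_lt h.1, fun i => ⟨h1.trans_lt (h.2.1 i).1, (h.2.1 i).2⟩,
    fun i => ⟨h1.trans_lt (h.2.2 i).1, (h.2.2 i).2⟩⟩

theorem convex_Dom (v a : Fin M → ℂ) : Convex ℝ {P | Dom κ P v a} := by
  intro x hx y hy s t hs ht hst
  have h1 : ‖s • x + t • y‖ ≤ s * ‖x‖ + t * ‖y‖ := by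
    refine (norm_add_le _ _).trans_eq ?_
    rw [norm_smul, norm_smul, Real.norm_of_nonneg hs, Real.norm_of_nonneg ht]
  rcases le_total ‖x‖ ‖y‖ with h | h
  · refine Dom.of_norm_le (P := y) hy (h1.trans ?_)
    calc s * ‖x‖ + t * ‖y‖ ≤ s * ‖y‖ + t * ‖y‖ := by gcongr
      _ = ‖y‖ := by rw [← add_mul, hst, one_mul]
  · refine Dom.of_norm_le (P := x) hx (h1.trans ?_)
    calc s * ‖x‖ + t * ‖y‖ ≤ s * ‖x‖ + t * ‖x‖ := by gcongr
      _ = ‖x‖ := by rw [← add_mul, hst, one_mul]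

theorem isOpen_Dom (v a : Fin M → ℂ) : IsOpen {P | Dom κ P v a} := by
  refine isOpen_iff_eventually.2 fun P hP => ?_
  have h1 : ∀ c : ℝ, ‖P * κ‖ < c → ∀ᶠ P in 𝓝 P, ‖P * κ‖ < c := fun c hc =>
    (by fun_prop : Continuous fun P : ℂ => ‖P * κ‖).continuousAt.eventually (gt_mem_nhds hc)
  filter_upwards [continuous_norm.continuousAt.eventually (gt_mem_nhds hP.1),
    eventually_all.2 fun i => h1 _ (hP.2.1 i).1, eventually_all.2 fun i => h1 _ (hP.2.2 i).1]
    with P' e1 e2 e3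
  exact ⟨e1, fun i => ⟨e2 i, (hP.2.1 i).2⟩, fun i => ⟨e3 i, (hP.2.2 i).2⟩⟩

theorem Df_eq_zero (hκ : κ ^ 2 = q) (hκ0 : κ ≠ 0) (hq : ‖q‖ < 1) {P : ℂ}
    {v a : Fin (2 * N + 2) → ℂ} (h : Dom κ P v a) (hbal : ∏ i, v i = ∏ i, a i) :
    Df N κ q P v a = 0 := by
  have hv : Adm v := fun i => ⟨h.v_ne_zero i, (h.2.1 i).2⟩
  have ha : Adm a := fun i => ⟨h.symm.v_ne_zero i, (h.2.2 i).2⟩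
  have htop : analyticOrderAt (fun P => Df N κ q P v a) 0 = ⊤ :=
    ENat.eq_top_iff_forall_ge.2 fun k => vanAll hκ hκ0 hq k v a hv ha hbal
  have hd : DifferentiableOn ℂ (fun P => Df N κ q P v a) {P | Dom κ P v a} :=
    differentiableOn_Df (P := fun P => P) (v := fun _ => v) (a := fun _ => a) N hq (isOpen_Dom v a)
      differentiableOn_id (fun i => differentiableOn_const _) (fun i => differentiableOn_const _)
      fun P hP => hP
  exact (hd.analyticOnNhd (isOpen_Dom v a)).eqOn_of_preconnected_of_eventuallyEq
    (analyticOnNhd_const (v := (0 : ℂ))) (convex_Dom v a).isPreconnected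
    (h.of_norm_le (by simp) : Dom κ 0 v a) (analyticOrderAt_eq_top.1 htop) h

/-- The `BC_n`-`BC_m` transformation. -/
def BCId (n m : ℕ) : Prop :=
  ∀ (p q ω : ℂ), 0 < ‖p‖ → ‖p‖ < 1 → 0 < ‖q‖ → ‖q‖ < 1 → ω ^ 2 = p * q →
    ∀ (d : ℕ), d = 2 * m + 2 * n + 4 → ∀ t : Fin d → ℂ, (∀ r, ‖ω‖ < ‖t r‖ ∧ ‖t r‖ < 1) →
      ∏ r, t r = (p * q) ^ (m + 1) →
      I_BC n d t p q = pref p q t * I_BC m d (fun r => ω / t r) p q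

theorem bcId_self (N : ℕ) : BCId N N := by
  intro p q ω hp0 hp1 hq0 hq1 hω d hd t ht hbal
  obtain rfl : d = (2 * N + 2) + (2 * N + 2) := by omega
  obtain ⟨κ, hκ⟩ : ∃ κ : ℂ, κ ^ 2 = q := IsAlgClosed.exists_pow_nat_eq q two_pos
  have hκ0 : κ ≠ 0 := by
    rintro rfl
    rw [← hκ] at hq0; simp at hq0
  have hq0' : q ≠ 0 := norm_pos_iff.1 hq0
  have hp0' : p ≠ 0 := norm_pos_iff.1 hp0
  have hω0 : ω ≠ 0 := by
    rintro rfl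
    exact mul_ne_zero hp0' hq0' (by rw [← hω]; simp)
  obtain ⟨P, hP⟩ : ∃ P, P * κ = ω := ⟨ω / κ, div_mul_cancel₀ _ hκ0⟩
  have hPp : P ^ 2 = p := by
    rw [← hP, mul_pow, hκ] at hω; exact mul_right_cancel₀ hq0' hω
  have hP0 : P ≠ 0 := by rintro rfl; exact hp0' (by rw [← hPp]; simp)
  have ht0 : ∀ r, t r ≠ 0 := fun r => norm_pos_iff.1 ((norm_nonneg _).trans_lt (ht r).1)
  set v : Fin (2 * N + 2) → ℂ := fun i => t (Fin.castAdd _ i) with hv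
  set a : Fin (2 * N + 2) → ℂ := fun i => ω / t (Fin.natAdd _ i) with ha
  have hωn : 0 < ‖ω‖ := norm_pos_iff.2 hω0
  have hdom : Dom κ P v a := by
    rw [Dom, hP]
    refine ⟨?_, fun i => ht _, fun i => ?_⟩
    · rw [← hPp, norm_pow] at hp1
      exact (sq_lt_one_iff₀ (norm_nonneg _)).1 hp1
    · have h1 := ht (Fin.natAdd (2 * N + 2) i)
      have h2 : 0 < ‖t (Fin.natAdd (2 * N + 2) i)‖ := norm_pos_iff.2 (ht0 _)
      rw [ha, norm_div]
      exact ⟨(lt_div_iff₀ h2).2 (mul_lt_of_lt_one_right hωn h1.2), (div_lt_one h2).2 h1.1⟩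
  have htv : t = Fin.append v fun i => P * κ / a i := by
    funext r
    refine Fin.addCases (fun i => ?_) (fun i => ?_) r
    · rw [Fin.append_left]
    · rw [Fin.append_right, hP, ha, div_div_cancel₀ hω0]
  have hvabal : ∏ i, v i = ∏ i, a i := by
    rw [Fin.prod_univ_add] at hbal
    rw [ha, Finset.prod_div_distrib, eq_div_iff (Finset.prod_ne_zero_iff.2 fun i _ => ht0 _), hbal,
      ← hω, Finset.prod_const, Finset.card_univ, Fintype.card_fin, ← pow_mul]
    ring_nf
  have h0 := defect_append N hκ hP0 hκ0 hq1 hdom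
  rw [Df_eq_zero hκ hκ0 hq1 hdom hvabal, ← htv, hPp, hP, defect, sub_eq_zero] at h0
  exact h0

end

section
variable {p q : ℂ}

/-- The non-vanishing part of `th p x * th q (1 / x)`. -/
noncomputable def Rr (p q x : ℂ) : ℂ := Qf p (p * x) * Qf p (p / x) * (Qf q (q * x) * Qf q (q / x))

/-- The coordinate `(1 + z)(1 + 1/z)`, invariant under inversion. -/
noncomputable def Yf (z : ℂ) : ℂ := (1 + z) * (1 + z⁻¹)

/-- The interaction left over after symmetrisation. -/
noncomputable def Kh (p q z₀ z : ℂ) : ℂ :=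
  Yf z * (Yf z - Yf z₀) * (Rr p q (z₀ * z) * Rr p q (z₀ / z))

theorem th_mul_th_inv (hp : ‖p‖ < 1) (hq : ‖q‖ < 1) (x : ℂ) :
    th p x * th q (1 / x) = (1 - x) * (1 - x⁻¹) * Rr p q x := by
  unfold th Rr
  rw [Qf_shift hp x, Qf_shift hq (1 / x), div_div_eq_mul_div, div_one, mul_one_div, one_div]
  ring

theorem ef_eq (hp : ‖p‖ < 1) (hq : ‖q‖ < 1) (z : ℂ) :
    ef p q z = (1 - z ^ 2) * (1 - (z ^ 2)⁻¹) * Rr p q (z ^ 2) := th_mul_th_inv hp hq _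

theorem Yf_sub {z w : ℂ} (hz : z ≠ 0) (hw : w ≠ 0) :
    Yf z - Yf w = (z - w) * (1 - (z * w)⁻¹) := by
  unfold Yf; field_simp; ring

theorem Kf_eq (hp : ‖p‖ < 1) (hq : ‖q‖ < 1) {z w : ℂ} (hz : z ≠ 0) (hw : w ≠ 0) :
    Kf p q z w = (Yf w - Yf z) ^ 2 * (Rr p q (z * w) * Rr p q (z / w)) := by
  rw [Kf, th_mul_th_inv hp hq, ← one_div_div z w, th_mul_th_inv hp hq, Yf_sub hw hz]
  field_simp
  ring

theorem Yf_sub_ne_zero {z w : ℂ} (hz : z ≠ 0) (hw : w ≠ 0) (h : z ≠ w) (h' : z * w ≠ 1) :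
    Yf z - Yf w ≠ 0 := by
  rw [Yf_sub hz hw]
  refine mul_ne_zero (sub_ne_zero.2 h) (sub_ne_zero.2 fun e => h' ?_)
  rw [← inv_inv (z * w), ← e, inv_one]

theorem sum_prod_div_sub {n : ℕ} {y : Fin (n + 1) → ℂ} (hy : Function.Injective y) :
    ∑ i, ∏ j ∈ Finset.univ.erase i, y j / (y j - y i) = 1 := by
  have h := congrArg (Polynomial.eval 0) (Lagrange.sum_basis (s := Finset.univ) (v := y)
    hy.injOn Finset.univ_nonempty)
  rw [Polynomial.eval_finsetSum, Polynomial.eval_one] at h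
  rw [← h]
  refine Finset.sum_congr rfl fun i _ => ?_
  rw [Lagrange.basis, Polynomial.eval_prod]
  refine Finset.prod_congr rfl fun j _ => ?_
  rw [Lagrange.basisDivisor]
  simp only [Polynomial.eval_mul, Polynomial.eval_C, Polynomial.eval_sub, Polynomial.eval_X]
  rw [zero_sub, ← div_eq_inv_mul, ← neg_sub (y j), neg_div_neg_eq]

/-- One term of the symmetrised `BC_{n+1}` integrand. -/
noncomputable def Th (n : ℕ) (p q : ℂ) (g : ℂ → ℂ) (z₀ : ℂ) (z : Fin n → ℂ) : ℂ :=
  g z₀ * ef p q z₀ * (∏ j, Kh p q z₀ (z j)) * Wt n p q g z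

theorem Th_eq {n : ℕ} (hp : ‖p‖ < 1) (hq : ‖q‖ < 1) (g : ℂ → ℂ) {z₀ : ℂ} {z : Fin n → ℂ}
    (hz₀ : z₀ ≠ 0) (hz : ∀ i, z i ≠ 0) (hne : ∀ i, Yf (z i) - Yf z₀ ≠ 0) :
    Th n p q g z₀ z =
      (∏ j, Yf (z j) / (Yf (z j) - Yf z₀)) * Wt (n + 1) p q g (Fin.cons z₀ z) := by
  have h : ∏ j, Kh p q z₀ (z j) =
      (∏ j, Yf (z j) / (Yf (z j) - Yf z₀)) * ∏ j, Kf p q z₀ (z j) := by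
    rw [← Finset.prod_mul_distrib]
    refine Finset.prod_congr rfl fun j _ => ?_
    have := hne j
    rw [Kf_eq hp hq hz₀ (hz j), Kh]
    field_simp
  rw [Wt_cons, Th, h]
  ring

theorem prod_succ_swap {n : ℕ} (f : Fin (n + 1) → ℂ) (i : Fin (n + 1)) :
    ∏ j : Fin n, f (Equiv.swap 0 i j.succ) = ∏ j ∈ Finset.univ.erase i, f j := by
  have h : ∏ j : Fin n, f (Equiv.swap 0 i j.succ) =
      ∏ k ∈ Finset.univ.erase 0, f (Equiv.swap 0 i k) := by
    rw [← Finset.sdiff_singleton_eq_erase, ← Finset.compl_eq_univ_sdiff, ← Fin.image_succ_univ,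
      Finset.prod_image fun _ _ _ _ h => Fin.succ_injective _ h]
  rw [h]
  refine Finset.prod_equiv (Equiv.swap 0 i) (fun k => ?_) fun _ _ => rfl
  simp only [Finset.mem_erase, Finset.mem_univ, and_true, ne_eq]
  rw [Equiv.swap_apply_eq_iff, Equiv.swap_apply_right]

theorem Wt_eq_sum {n : ℕ} (hp : ‖p‖ < 1) (hq : ‖q‖ < 1) (g : ℂ → ℂ) {z : Fin (n + 1) → ℂ}
    (hz : z ∈ tor (n + 1)) (hg : Generic z) :
    Wt (n + 1) p q g z =
      ∑ i, Th n p q g (z (Equiv.swap 0 i 0)) fun j => z (Equiv.swap 0 i j.succ) := by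
  have hinj : Function.Injective fun i => Yf (z i) := fun i j hij => by
    by_contra hne
    exact Yf_sub_ne_zero (tor_ne_zero hz i) (tor_ne_zero hz j) (hg.2 i j hne).1 (hg.2 i j hne).2
      (sub_eq_zero.2 hij)
  rw [← one_mul (Wt _ _ _ _ z), ← sum_prod_div_sub hinj, Finset.sum_mul]
  refine Finset.sum_congr rfl fun i _ => ?_
  rw [Th_eq hp hq g (tor_ne_zero hz _) (fun j => tor_ne_zero hz _) fun j => ?_]
  · have h1 : (Fin.cons (z (Equiv.swap 0 i 0)) fun j : Fin n => z (Equiv.swap 0 i j.succ)) =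
        z ∘ Equiv.swap 0 i := Fin.cons_self_tail (z ∘ Equiv.swap 0 i)
    rw [h1, Wt_perm hp hq g fun j => tor_ne_zero hz j, Equiv.swap_apply_left,
      prod_succ_swap (fun j => Yf (z j) / (Yf (z j) - Yf (z i))) i]
  · exact sub_ne_zero.2 (hinj.ne ((Equiv.swap 0 i).injective.ne (Fin.succ_ne_zero j)))

theorem continuousOn_Rr {X : Type*} [TopologicalSpace X] {K : Set X} {Y : X → ℂ} (hp : ‖p‖ < 1)
    (hq : ‖q‖ < 1) (hY : ContinuousOn Y K) (h0 : ∀ x ∈ K, Y x ≠ 0) :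
    ContinuousOn (fun x => Rr p q (Y x)) K := by
  have hc : ∀ c : ℂ, ContinuousOn (fun _ : X => c) K := fun c => continuousOn_const
  exact ((continuousOn_Qf (hc p) ((hc p).mul hY) fun _ _ => hp).mul
    (continuousOn_Qf (hc p) ((hc p).div hY h0) fun _ _ => hp)).mul
    ((continuousOn_Qf (hc q) ((hc q).mul hY) fun _ _ => hq).mul
    (continuousOn_Qf (hc q) ((hc q).div hY h0) fun _ _ => hq))

theorem continuousOn_Yf {X : Type*} [TopologicalSpace X] {K : Set X} {Y : X → ℂ}
    (hY : ContinuousOn Y K) (h0 : ∀ x ∈ K, Y x ≠ 0) : ContinuousOn (fun x => Yf (Y x)) K :=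
  (continuousOn_const.add hY).mul (continuousOn_const.add (hY.inv₀ h0))

theorem continuousOn_Kh {X : Type*} [TopologicalSpace X] {K : Set X} {Y Z : X → ℂ} (hp : ‖p‖ < 1)
    (hq : ‖q‖ < 1) (hY : ContinuousOn Y K) (h0 : ∀ x ∈ K, Y x ≠ 0) (hZ : ContinuousOn Z K)
    (h1 : ∀ x ∈ K, Z x ≠ 0) : ContinuousOn (fun x => Kh p q (Y x) (Z x)) K :=
  ((continuousOn_Yf hZ h1).mul ((continuousOn_Yf hZ h1).sub (continuousOn_Yf hY h0))).mul
    ((continuousOn_Rr hp hq (hY.mul hZ) fun x hx => mul_ne_zero (h0 x hx) (h1 x hx)).mul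
    (continuousOn_Rr hp hq (hY.div hZ h1) fun x hx => div_ne_zero (h0 x hx) (h1 x hx)))

theorem continuousOn_Th {n : ℕ} (hp : ‖p‖ < 1) (hq : ‖q‖ < 1) {g : ℂ → ℂ}
    (hg : ContinuousOn g (Metric.sphere 0 1)) :
    ContinuousOn (fun z : Fin (n + 1) → ℂ => Th n p q g (z 0) fun j => z j.succ) (tor (n + 1)) := by
  have ci : ∀ i, ContinuousOn (fun z : Fin (n + 1) → ℂ => z i) (tor (n + 1)) := fun i => by fun_prop
  have h0 : ∀ i, ∀ z ∈ tor (n + 1), z i ≠ 0 := fun i z hz => tor_ne_zero hz i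
  have cg : ∀ i, ContinuousOn (fun z : Fin (n + 1) → ℂ => g (z i)) (tor (n + 1)) := fun i =>
    hg.comp (ci i) fun z hz => by rw [mem_sphere_zero_iff_norm]; exact hz i
  have h1 := continuousOn_ef (P := fun _ => p) hq continuousOn_const (ci 0) (fun _ _ => hp) (h0 0)
  have h2 : ContinuousOn (fun z : Fin (n + 1) → ℂ => ∏ j : Fin n, Kh p q (z 0) (z j.succ))
      (tor (n + 1)) :=
    continuousOn_finsetProd _ fun j _ => continuousOn_Kh hp hq (ci 0) (h0 0) (ci _) (h0 _)
  have h3 := continuousOn_Wt (P := fun _ => p) (g := fun _ => g)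
    (z := fun (z : Fin (n + 1) → ℂ) (j : Fin n) => z j.succ) hq
    continuousOn_const (fun _ _ => hp) (continuousOn_pi.2 fun j => ci _)
    (fun z hz j => h0 _ z hz) fun i => cg _
  unfold Th
  exact (((cg 0).mul h1).mul h2).mul h3

theorem torusInt_Wt_succ {n : ℕ} (hp : ‖p‖ < 1) (hq : ‖q‖ < 1) {g : ℂ → ℂ}
    (hg : ContinuousOn g (Metric.sphere 0 1)) :
    torusInt (n + 1) (Wt (n + 1) p q g) = (n + 1) * (((1 / (2 * π) : ℝ) : ℂ) *
      ∫ φ in (0 : ℝ)..2 * π, torusInt n (Th n p q g (cx φ))) := by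
  set T : (Fin (n + 1) → ℂ) → ℂ := fun z => Th n p q g (z 0) fun j => z j.succ with hT
  have hTc : ContinuousOn T (tor (n + 1)) := continuousOn_Th hp hq hg
  have e1 : torusInt (n + 1) (Wt (n + 1) p q g) =
      torusInt (n + 1) fun z => ∑ i, T (z ∘ Equiv.swap 0 i) :=
    torusInt_congr_generic fun z hz hgz => Wt_eq_sum hp hq g hz hgz
  rw [e1, torusInt_sum Finset.univ (fun i z => T (z ∘ Equiv.swap 0 i)) fun i _ =>
    hTc.comp (by fun_prop) fun z hz => tor_perm hz _]
  simp_rw [torusInt_perm]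
  rw [Finset.sum_const, Finset.card_univ, Fintype.card_fin, nsmul_eq_mul, torusInt_succ' hTc]
  simp only [hT, Fin.cons_zero, Fin.cons_succ, Nat.cast_add, Nat.cast_one]

end

section
open Filter Topology

/-- The kernel concentrating at `-1` as `r → 1`. -/
noncomputable def kap (r : ℝ) (z : ℂ) : ℝ := (1 - r ^ 2) * (‖1 - z ^ 2‖ ^ 2 / ‖1 + r * z‖ ^ 4)

theorem one_add_mul_ne_zero {r : ℝ} (hr0 : 0 < r) (hr1 : r < 1) {z : ℂ} (hz : ‖z‖ ≤ 1) :
    1 + r * z ≠ 0 := fun h => by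
  have h1 : ‖(r : ℂ) * z‖ = 1 := by rw [eq_neg_of_add_eq_zero_right h, norm_neg, norm_one]
  rw [norm_mul, Complex.norm_real, Real.norm_of_nonneg hr0.le] at h1
  nlinarith [norm_nonneg z]

theorem kap_eq {r : ℝ} {z : ℂ} (hz : ‖z‖ = 1) :
    (kap r z : ℂ) =
      (1 - r ^ 2) * ((1 - z ^ 2) * (1 - (z ^ 2)⁻¹)) / ((1 + r * z) * (1 + r / z)) ^ 2 := by
  have h1 : (starRingEnd ℂ) z = z⁻¹ := (Complex.inv_eq_conj hz).symm
  have h2 : ((‖1 - z ^ 2‖ : ℂ)) ^ 2 = (1 - z ^ 2) * (1 - (z ^ 2)⁻¹) := by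
    rw [← Complex.mul_conj', map_sub, map_one, map_pow, h1, inv_pow]
  have h3 : ((‖1 + r * z‖ : ℂ)) ^ 2 = (1 + r * z) * (1 + r / z) := by
    rw [← Complex.mul_conj', map_add, map_one, map_mul, h1, Complex.conj_ofReal, div_eq_mul_inv]
  unfold kap
  push_cast
  rw [show ((‖1 + r * z‖ : ℂ)) ^ 4 = (‖1 + r * z‖ ^ 2) ^ 2 by ring, h2, h3]
  ring

theorem kap_nonneg {r : ℝ} (hr0 : 0 < r) (hr1 : r < 1) (z : ℂ) : 0 ≤ kap r z :=
  mul_nonneg (by nlinarith) (by positivity)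

theorem continuous_kap_cx {r : ℝ} (hr0 : 0 < r) (hr1 : r < 1) :
    Continuous fun φ => kap r (cx φ) := by
  have := continuous_cx
  refine continuous_const.mul (Continuous.div (by fun_prop) (by fun_prop) fun φ => ?_)
  exact pow_ne_zero _ (norm_ne_zero_iff.2 (one_add_mul_ne_zero hr0 hr1 (norm_cx φ).le))

theorem integral_inv_pow {r : ℝ} (hr0 : 0 < r) (hr1 : r < 1) (k : ℕ) :
    ∫ φ in (0 : ℝ)..2 * π, ((1 + r * cx φ)⁻¹ : ℂ) ^ k = 2 * π := by
  have hne : ∀ z ∈ Metric.closedBall (0 : ℂ) |1|, 1 + r * z ≠ 0 := fun z hz =>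
    one_add_mul_ne_zero hr0 hr1 (by simpa using hz)
  have h := circleAverage_of_differentiable_on_off_countable (c := 0) (R := 1) (s := ∅)
    (f := fun z : ℂ => ((1 + r * z)⁻¹) ^ k) Set.countable_empty
    (ContinuousOn.pow (ContinuousOn.inv₀ (by fun_prop) hne) k) fun z hz =>
    ((show DifferentiableAt ℂ (fun z : ℂ => 1 + r * z) z by fun_prop).inv (hne z (Metric.ball_subset_closedBall hz.1))).pow k
  have hc : ∀ θ, circleMap 0 1 θ = cx θ := fun θ => by
    rw [circleMap, cx, mul_comm Complex.I]; simp
  rw [Real.circleAverage_def] at h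
  simp only [hc, mul_zero, add_zero, inv_one, one_pow] at h
  have hpi : (2 * π : ℝ) ≠ 0 := by positivity
  rw [inv_smul_eq_iff₀ hpi] at h
  rw [h]
  simp

theorem kap_partial_fractions {r : ℝ} (hr0 : 0 < r) (hr1 : r < 1) {z : ℂ} (hz : ‖z‖ = 1) :
    (kap r z : ℂ) * (r ^ 2) = (1 - r ^ 2) * (-2 - ((1 + r * z)⁻¹) ^ 2 - ((1 + r * z⁻¹)⁻¹) ^ 2 +
      2 * (1 + r * z)⁻¹ + 2 * (1 + r * z⁻¹)⁻¹) +
      2 * r ^ 2 * ((1 + r * z)⁻¹ + (1 + r * z⁻¹)⁻¹ - 1) := by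
  have h0 : z ≠ 0 := norm_ne_zero_iff.1 (by rw [hz]; exact one_ne_zero)
  have h1 := one_add_mul_ne_zero hr0 hr1 hz.le
  have h2 := one_add_mul_ne_zero hr0 hr1 (z := z⁻¹) (by rw [norm_inv, hz, inv_one])
  have h3 : z + r ≠ 0 := by
    have : z + r = z * (1 + r * z⁻¹) := by field_simp
    rw [this]; exact mul_ne_zero h0 h2
  rw [kap_eq hz]
  have e : (1 + (r : ℂ) / z) = (z + r) / z := by field_simp
  have e' : (1 + (r : ℂ) * z⁻¹) = (z + r) / z := by field_simp
  rw [e, e']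
  field_simp
  ring

theorem integral_kap {r : ℝ} (hr0 : 0 < r) (hr1 : r < 1) :
    ∫ φ in (0 : ℝ)..2 * π, kap r (cx φ) = 4 * π := by
  have hr : (r : ℂ) ≠ 0 := by exact_mod_cast hr0.ne'
  have key : (∫ φ in (0 : ℝ)..2 * π, (kap r (cx φ) : ℂ) * (r ^ 2)) = 4 * π * r ^ 2 := by
    simp_rw [kap_partial_fractions hr0 hr1 (norm_cx _)]
    have hcx := continuous_cx
    have n1 : ∀ φ, 1 + r * cx φ ≠ 0 := fun φ => one_add_mul_ne_zero hr0 hr1 (norm_cx φ).le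
    have n2 : ∀ φ, 1 + r * (cx φ)⁻¹ ≠ 0 := fun φ =>
      one_add_mul_ne_zero hr0 hr1 (by rw [norm_inv, norm_cx, inv_one])
    have c1 : Continuous fun φ => ((1 + r * cx φ)⁻¹ : ℂ) := Continuous.inv₀ (by fun_prop) n1
    have c2 : Continuous fun φ => ((1 + r * (cx φ)⁻¹)⁻¹ : ℂ) :=
      Continuous.inv₀ (continuous_const.add (continuous_const.mul (hcx.inv₀ cx_ne_zero))) n2
    have i1 := integral_inv_pow hr0 hr1 1
    have i2 := integral_inv_pow hr0 hr1 2
    have j1 := integral_cx_inv fun z => ((1 + r * z)⁻¹ : ℂ) ^ 1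
    have j2 := integral_cx_inv fun z => ((1 + r * z)⁻¹ : ℂ) ^ 2
    rw [i1] at j1
    rw [i2] at j2
    simp only [pow_one] at i1 j1
    have I1 := fun a b => c1.intervalIntegrable (μ := volume) a b
    have I2 := fun a b => c2.intervalIntegrable (μ := volume) a b
    have I3 := fun a b => (c1.pow 2).intervalIntegrable (μ := volume) a b
    have I4 := fun a b => (c2.pow 2).intervalIntegrable (μ := volume) a b
    have e : ∀ φ, (1 - (r : ℂ) ^ 2) * (-2 - ((1 + r * cx φ)⁻¹) ^ 2 - ((1 + r * (cx φ)⁻¹)⁻¹) ^ 2 +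
      2 * (1 + r * cx φ)⁻¹ + 2 * (1 + r * (cx φ)⁻¹)⁻¹) +
      2 * r ^ 2 * ((1 + r * cx φ)⁻¹ + (1 + r * (cx φ)⁻¹)⁻¹ - 1) =
      2 * (1 + r * cx φ)⁻¹ + (2 * (1 + r * (cx φ)⁻¹)⁻¹ + ((r ^ 2 - 1) * ((1 + r * cx φ)⁻¹) ^ 2 +
      ((r ^ 2 - 1) * ((1 + r * (cx φ)⁻¹)⁻¹) ^ 2 + -2))) := fun φ => by ring
    simp_rw [e]
    rw [intervalIntegral.integral_add, intervalIntegral.integral_add,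
      intervalIntegral.integral_add, intervalIntegral.integral_add]
    · simp_rw [intervalIntegral.integral_const_mul]
      rw [i1, i2, j1, j2, intervalIntegral.integral_const, sub_zero, Complex.real_smul]
      push_cast
      ring
    all_goals refine Continuous.intervalIntegrable ?_ _ _; fun_prop
  rw [intervalIntegral.integral_mul_const, intervalIntegral.integral_ofReal] at key
  have := mul_right_cancel₀ (pow_ne_zero 2 hr) key
  exact_mod_cast this

theorem norm_one_add_le {r : ℝ} (hr0 : 0 < r) (hr1 : r < 1) {z : ℂ} (hz : ‖z‖ = 1) :
    ‖1 + z‖ ≤ 2 * ‖1 + r * z‖ := by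
  have h1 : 1 - r ≤ ‖1 + r * z‖ := by
    have := norm_sub_norm_le 1 (-(r * z))
    rw [norm_neg, norm_mul, hz, Complex.norm_real, Real.norm_of_nonneg hr0.le, norm_one,
      sub_neg_eq_add] at this
    linarith
  have h2 : ‖1 + z‖ ≤ ‖1 + r * z‖ + (1 - r) := by
    have := norm_add_le (1 + r * z) ((1 - r : ℝ) * z)
    rw [norm_mul, hz, Complex.norm_real, Real.norm_of_nonneg (sub_pos.2 hr1).le] at this
    convert! this using 2
    · push_cast; ring
    · ring
  linarith

theorem kap_le {r δ : ℝ} (hr0 : 0 < r) (hr1 : r < 1) (hδ : 0 < δ) {z : ℂ} (hz : ‖z‖ = 1)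
    (h : δ ≤ ‖1 + z‖) : kap r z ≤ (1 - r ^ 2) * (64 / δ ^ 4) := by
  have h3 : δ / 2 ≤ ‖1 + r * z‖ := by linarith [norm_one_add_le hr0 hr1 hz]
  have h4 : ‖1 - z ^ 2‖ ≤ 2 := by
    have := norm_sub_le 1 (z ^ 2)
    rw [norm_pow, hz, norm_one] at this
    linarith
  refine mul_le_mul_of_nonneg_left ?_ (by nlinarith)
  calc ‖1 - z ^ 2‖ ^ 2 / ‖1 + r * z‖ ^ 4 ≤ 2 ^ 2 / (δ / 2) ^ 4 := by gcongr
    _ = 64 / δ ^ 4 := by field_simp; norm_num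

theorem tendsto_integral_kap {G : ℝ → ℂ → ℂ} {B : ℝ} {L : ℂ}
    (hG : ∀ᶠ r in 𝓝[<] (1 : ℝ), Continuous fun φ => G r (cx φ))
    (hB : ∀ᶠ r in 𝓝[<] (1 : ℝ), ∀ z : ℂ, ‖z‖ = 1 → ‖G r z‖ ≤ B)
    (hL : ∀ ε > 0, ∃ δ > 0, ∀ᶠ r in 𝓝[<] (1 : ℝ), ∀ z : ℂ, ‖z‖ = 1 → ‖1 + z‖ < δ →
      ‖G r z - L‖ ≤ ε) :
    Tendsto (fun r => ∫ φ in (0 : ℝ)..2 * π, (kap r (cx φ) : ℂ) * G r (cx φ)) (𝓝[<] 1)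
      (𝓝 (4 * π * L)) := by
  have hpi := Real.pi_pos
  rw [Metric.tendsto_nhds]
  intro ε hε
  obtain ⟨δ, hδ, hev⟩ := hL (ε / (8 * π)) (by positivity)
  set C : ℝ := (64 / δ ^ 4) * (B + ‖L‖) with hC
  have hsmall : ∀ᶠ r in 𝓝[<] (1 : ℝ), 2 * π * ((1 - r ^ 2) * C) < ε / 2 := by
    have : Tendsto (fun r : ℝ => 2 * π * ((1 - r ^ 2) * C)) (𝓝[<] 1)
        (𝓝 (2 * π * ((1 - 1 ^ 2) * C))) :=
      (Continuous.tendsto (by fun_prop) 1).mono_left nhdsWithin_le_nhds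
    refine this.eventually (gt_mem_nhds ?_)
    simp only [one_pow, sub_self, zero_mul, mul_zero]
    positivity
  have hr0 : ∀ᶠ r in 𝓝[<] (1 : ℝ), 0 < r :=
    (lt_mem_nhds one_pos).filter_mono nhdsWithin_le_nhds
  filter_upwards [hG, hB, hev, hsmall, hr0, self_mem_nhdsWithin] with r hG hB hev hs hr0 hr1
  have hr1 : r < 1 := hr1
  have ck := continuous_kap_cx hr0 hr1
  have ck' : Continuous fun φ => (kap r (cx φ) : ℂ) := Complex.continuous_ofReal.comp ck
  have e : (4 * π * L : ℂ) = ∫ φ in (0 : ℝ)..2 * π, (kap r (cx φ) : ℂ) * L := by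
    rw [intervalIntegral.integral_mul_const, intervalIntegral.integral_ofReal,
      integral_kap hr0 hr1]
    push_cast; ring
  have i1 : IntervalIntegrable (fun φ => (kap r (cx φ) : ℂ) * G r (cx φ)) volume 0 (2 * π) :=
    (ck'.mul hG).intervalIntegrable _ _
  have i2 : IntervalIntegrable (fun φ => (kap r (cx φ) : ℂ) * L) volume 0 (2 * π) :=
    (ck'.mul continuous_const).intervalIntegrable _ _
  rw [dist_eq_norm, e, ← intervalIntegral.integral_sub i1 i2]
  have hb : ∀ φ : ℝ, ‖(kap r (cx φ) : ℂ) * G r (cx φ) - kap r (cx φ) * L‖ ≤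
      ε / (8 * π) * kap r (cx φ) + (1 - r ^ 2) * C := by
    intro φ
    have hk := kap_nonneg hr0 hr1 (cx φ)
    have hC0 : 0 ≤ (1 - r ^ 2) * C := by
      have := (norm_nonneg _).trans (hB _ (norm_cx φ))
      exact mul_nonneg (by nlinarith) (by positivity)
    rw [← mul_sub, norm_mul, Complex.norm_real, Real.norm_of_nonneg hk]
    rcases lt_or_ge ‖1 + cx φ‖ δ with h | h
    · have := mul_le_mul_of_nonneg_left (hev _ (norm_cx φ) h) hk
      linarith
    · have h1 := kap_le hr0 hr1 hδ (norm_cx φ) h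
      have h2 : ‖G r (cx φ) - L‖ ≤ B + ‖L‖ :=
        (norm_sub_le _ _).trans (add_le_add_left (hB _ (norm_cx φ)) _)
      have h3 := mul_le_mul h1 h2 (norm_nonneg _) (hk.trans h1)
      have h4 : 0 ≤ ε / (8 * π) * kap r (cx φ) := by positivity
      rw [hC]
      linarith
  calc _ ≤ ∫ φ in (0 : ℝ)..2 * π, ε / (8 * π) * kap r (cx φ) + (1 - r ^ 2) * C :=
        intervalIntegral.norm_integral_le_of_norm_le (by positivity)
          (Eventually.of_forall fun φ _ => hb φ)
          (Continuous.intervalIntegrable (by fun_prop) _ _)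
    _ = ε / 2 + 2 * π * ((1 - r ^ 2) * C) := by
        rw [intervalIntegral.integral_add (Continuous.intervalIntegrable (by fun_prop) _ _)
          (Continuous.intervalIntegrable (by fun_prop) _ _), intervalIntegral.integral_const_mul,
          integral_kap hr0 hr1, intervalIntegral.integral_const, smul_eq_mul, sub_zero]
        field_simp
        ring
    _ < ε := by linarith

end

section
open Filter Topology
variable {p q : ℂ}

theorem tendsto_torusInt {ι : Type*} {l : Filter ι} [l.IsCountablyGenerated] {N : ℕ}
    {F : ι → (Fin N → ℂ) → ℂ} {f : (Fin N → ℂ) → ℂ} {M : ℝ}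
    (hF : ∀ᶠ i in l, ContinuousOn (F i) (tor N)) (hB : ∀ᶠ i in l, ∀ z ∈ tor N, ‖F i z‖ ≤ M)
    (hlim : ∀ z ∈ tor N, Generic z → Tendsto (fun i => F i z) l (𝓝 (f z))) :
    Tendsto (fun i => torusInt N (F i)) l (𝓝 (torusInt N f)) := by
  simp_rw [torusInt_eq]
  refine Tendsto.const_mul _ (tendsto_integral_filter_of_dominated_convergence (fun _ => M)
    ?_ ?_ (integrable_const _) ?_)
  · filter_upwards [hF] with i hi using (integrable_cxs hi).aestronglyMeasurable
  · filter_upwards [hB] with i hi using Eventually.of_forall fun θ => hi _ (cxs_mem θ)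
  · filter_upwards [ae_generic N] with θ hθ using hlim _ (cxs_mem θ) hθ

theorem norm_torusInt_le {N : ℕ} {f : (Fin N → ℂ) → ℂ} {M : ℝ} (h : ∀ z ∈ tor N, ‖f z‖ ≤ M) :
    ‖torusInt N f‖ ≤ ‖((1 / (2 * π) : ℝ) : ℂ) ^ N‖ *
      (M * (Measure.pi fun _ : Fin N => arc).real Set.univ) := by
  rw [torusInt_eq, norm_mul]
  exact mul_le_mul_of_nonneg_left (norm_integral_le_of_norm_le_const
    (Eventually.of_forall fun θ => h _ (cxs_mem θ))) (norm_nonneg _)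

theorem isCompact_tor (N : ℕ) : IsCompact (tor N) := by
  have : tor N = Set.univ.pi fun _ => Metric.sphere (0 : ℂ) 1 := by
    ext z; simp [tor]
  rw [this]
  exact isCompact_univ_pi fun _ => isCompact_sphere _ _

/-- The elliptic Gamma function with its pole at `1` removed. -/
noncomputable def rg (p q x : ℂ) : ℂ := Ef p q (p * q / x) / (Qf p (p * x) * Ef p q (q * x))

theorem ellGamma_eq_rg (hp : ‖p‖ < 1) (hq : ‖q‖ < 1) (x : ℂ) :
    ellGamma x p q = rg p q x / (1 - x) := by
  rw [ellGamma_eq hp hq, rg, Ef_shift_right hp hq x, Qf_shift hp x, div_div]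
  congr 1
  ring

theorem norm_mul_lt_one_of_le {a x : ℂ} (ha : ‖a‖ < 1) (hx : ‖x‖ ≤ 1) : ‖a * x‖ < 1 := by
  rw [norm_mul]
  exact (mul_le_of_le_one_right (norm_nonneg _) hx).trans_lt ha

theorem rg_mul_rg (hp : ‖p‖ < 1) (hq : ‖q‖ < 1) {x : ℂ} (hx : ‖x‖ = 1) :
    rg p q x * rg p q x⁻¹ * Rr p q x = 1 := by
  have hx' : ‖x⁻¹‖ = 1 := by rw [norm_inv, hx, inv_one]
  have hpq : ‖p * q‖ < 1 := norm_mul_lt_one hp hq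
  have a1 := Qf_ne_zero_of_norm_lt hp (norm_mul_lt_one_of_le hp hx.le)
  have a2 := Qf_ne_zero_of_norm_lt hp (norm_mul_lt_one_of_le hp hx'.le)
  have b1 := Qf_ne_zero_of_norm_lt hq (norm_mul_lt_one_of_le hq hx.le)
  have b2 := Qf_ne_zero_of_norm_lt hq (norm_mul_lt_one_of_le hq hx'.le)
  have c1 := Ef_ne_zero_of_norm_lt hp hq (norm_mul_lt_one_of_le hpq hx.le)
  have c2 := Ef_ne_zero_of_norm_lt hp hq (norm_mul_lt_one_of_le hpq hx'.le)
  unfold rg Rr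
  simp only [div_inv_eq_mul, div_eq_mul_inv (p * q) x, div_eq_mul_inv p x, div_eq_mul_inv q x]
  rw [Ef_shift_left hp hq (q * x), Ef_shift_left hp hq (q * x⁻¹), ← mul_assoc p q x,
    ← mul_assoc p q x⁻¹]
  field_simp
  rw [← div_eq_mul_inv] at a2 b2 c2
  exact div_self (mul_ne_zero (mul_ne_zero c2 a2) b2)

theorem Rr_inv (p q x : ℂ) : Rr p q x⁻¹ = Rr p q x := by
  unfold Rr
  rw [div_inv_eq_mul, div_inv_eq_mul, ← div_eq_mul_inv, ← div_eq_mul_inv]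
  ring

theorem continuousOn_rg {X : Type*} [TopologicalSpace X] {K : Set X} {Y : X → ℂ} (hp : ‖p‖ < 1)
    (hq : ‖q‖ < 1) (hY : ContinuousOn Y K) (h0 : ∀ x ∈ K, Y x ≠ 0) (h1 : ∀ x ∈ K, ‖Y x‖ ≤ 1) :
    ContinuousOn (fun x => rg p q (Y x)) K := by
  have hc : ∀ c : ℂ, ContinuousOn (fun _ : X => c) K := fun c => continuousOn_const
  exact (continuousOn_Ef hq (hc p) ((hc _).div hY h0) fun _ _ => hp).div
    ((continuousOn_Qf (hc p) ((hc p).mul hY) fun _ _ => hp).mul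
      (continuousOn_Ef hq (hc p) ((hc q).mul hY) fun _ _ => hp)) fun x hx =>
    mul_ne_zero (Qf_ne_zero_of_norm_lt hp (norm_mul_lt_one_of_le hp (h1 x hx)))
      (Ef_ne_zero_of_norm_lt hp hq (norm_mul_lt_one_of_le hq (h1 x hx)))

/-- The product `Γ(-rz)Γ(-r/z)`. -/
noncomputable def Gm (p q : ℂ) (r : ℝ) (z : ℂ) : ℂ :=
  ellGamma (-r * z) p q * ellGamma (-r / z) p q

/-- The regular part of `Γ(-rz)Γ(-r/z)`. -/
noncomputable def Gr (p q : ℂ) (r : ℝ) (z : ℂ) : ℂ := rg p q (-r * z) * rg p q (-r / z)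

theorem Gm_eq (hp : ‖p‖ < 1) (hq : ‖q‖ < 1) (r : ℝ) (z : ℂ) :
    Gm p q r z = Gr p q r z / ((1 + r * z) * (1 + r / z)) := by
  rw [Gm, Gr, ellGamma_eq_rg hp hq, ellGamma_eq_rg hp hq, div_mul_div_comm]
  congr 2 <;> ring

theorem Gr_one_mul (hp : ‖p‖ < 1) (hq : ‖q‖ < 1) {z : ℂ} (hz : ‖z‖ = 1) :
    Gr p q 1 z * Rr p q (-z) = 1 := by
  have := rg_mul_rg hp hq (x := -z) (by rw [norm_neg, hz])
  rw [Gr]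
  convert! this using 4
  · push_cast; ring
  · push_cast; rw [inv_neg, neg_div, one_div]

theorem continuousOn_Gr {X : Type*} [TopologicalSpace X] {K : Set X} {R : X → ℝ} {Y : X → ℂ}
    (hp : ‖p‖ < 1) (hq : ‖q‖ < 1) (hR : ContinuousOn R K) (hR0 : ∀ x ∈ K, 0 < R x)
    (hR1 : ∀ x ∈ K, R x ≤ 1) (hY : ContinuousOn Y K) (h1 : ∀ x ∈ K, ‖Y x‖ = 1) :
    ContinuousOn (fun x => Gr p q (R x) (Y x)) K := by
  have h0 : ∀ x ∈ K, Y x ≠ 0 := fun x hx => norm_ne_zero_iff.1 (by rw [h1 x hx]; exact one_ne_zero)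
  have hRc : ContinuousOn (fun x => -(R x : ℂ)) K :=
    (Complex.continuous_ofReal.comp_continuousOn hR).neg
  have hRn : ∀ x ∈ K, -(R x : ℂ) ≠ 0 := fun x hx => neg_ne_zero.2 (by exact_mod_cast (hR0 x hx).ne')
  have hRm : ∀ x ∈ K, ‖-(R x : ℂ)‖ ≤ 1 := fun x hx => by
    rw [norm_neg, Complex.norm_real, Real.norm_of_nonneg (hR0 x hx).le]; exact hR1 x hx
  exact (continuousOn_rg hp hq (hRc.mul hY) (fun x hx => mul_ne_zero (hRn x hx) (h0 x hx))
    fun x hx => by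
      change ‖-(R x : ℂ) * Y x‖ ≤ 1
      rw [norm_mul, h1 x hx, mul_one]; exact hRm x hx).mul
    (continuousOn_rg hp hq (hRc.div hY h0) (fun x hx => div_ne_zero (hRn x hx) (h0 x hx))
    fun x hx => by rw [norm_div, h1 x hx, div_one]; exact hRm x hx)

end

section
open Filter Topology
variable {p q : ℂ} {h : ℝ → ℂ → ℂ}

/-- The factor tending boundedly to `1` in the pinching limit. -/
noncomputable def rho (r : ℝ) (z : ℂ) : ℂ := Yf z / ((1 + r * z) * (1 + r / z))

/-- The regular one-body factor in the pinching limit. -/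
noncomputable def Ph (p q : ℂ) (h : ℝ → ℂ → ℂ) (r : ℝ) (z₀ z : ℂ) : ℂ :=
  Gr p q r z ^ 2 * h r z * ((1 - z) * (1 - z⁻¹) * Rr p q (z ^ 2)) *
    ((Yf z - Yf z₀) * (Rr p q (z₀ * z) * Rr p q (z₀ / z)))

/-- The regular part of the integrand in the pinching limit. -/
noncomputable def Fi (n : ℕ) (p q : ℂ) (h : ℝ → ℂ → ℂ) (r : ℝ) (z₀ : ℂ) (z : Fin n → ℂ) : ℂ :=
  (pairProd fun i j => Kf p q (z i) (z j)) * ∏ j, Ph p q h r z₀ (z j)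

/-- The one-body weight containing a pair of nearly pinching parameters. -/
noncomputable def gpin (p q : ℂ) (h : ℝ → ℂ → ℂ) (r : ℝ) (z : ℂ) : ℂ := Gm p q r z ^ 2 * h r z

theorem gpin_mul_Kh (hp : ‖p‖ < 1) (hq : ‖q‖ < 1) (r : ℝ) (z₀ : ℂ) {z : ℂ} (hz : z ≠ 0) :
    gpin p q h r z * ef p q z * Kh p q z₀ z = rho r z ^ 2 * Ph p q h r z₀ z := by
  have e : (1 - z ^ 2) * (1 - (z ^ 2)⁻¹) = (1 - z) * (1 - z⁻¹) * Yf z := by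
    unfold Yf; field_simp; ring
  rw [gpin, Gm_eq hp hq, ef_eq hp hq, Kh, rho, Ph, e]
  ring

theorem prod_Kh_mul_Wt (hp : ‖p‖ < 1) (hq : ‖q‖ < 1) {n : ℕ} (r : ℝ) (z₀ : ℂ) {z : Fin n → ℂ}
    (hz : ∀ i, z i ≠ 0) : (∏ j, Kh p q z₀ (z j)) * Wt n p q (gpin p q h r) z =
      Fi n p q h r z₀ z * ∏ j, rho r (z j) ^ 2 := by
  have e : ∏ j, (gpin p q h r (z j) * ef p q (z j) * Kh p q z₀ (z j)) =
      ∏ j, (rho r (z j) ^ 2 * Ph p q h r z₀ (z j)) :=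
    Finset.prod_congr rfl fun j _ => gpin_mul_Kh hp hq r z₀ (hz j)
  simp only [Finset.prod_mul_distrib] at e
  rw [Wt, Fi]
  linear_combination (pairProd fun i j => Kf p q (z i) (z j)) * e

theorem Ph_limit (hp : ‖p‖ < 1) (hq : ‖q‖ < 1) {z : ℂ} (hz : ‖z‖ = 1) :
    Ph p q h 1 (-1) z = h 1 z * ef p q z := by
  have h0 : z ≠ 0 := norm_ne_zero_iff.1 (by rw [hz]; exact one_ne_zero)
  have e : (1 - z ^ 2) * (1 - (z ^ 2)⁻¹) = (1 - z) * (1 - z⁻¹) * Yf z := by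
    unfold Yf; field_simp; ring
  have hY : Yf (-1) = 0 := by simp [Yf]
  have h1 := Gr_one_mul hp hq hz
  have e1 : -1 / z = (-z)⁻¹ := by rw [neg_div, one_div, inv_neg]
  rw [Ph, ef_eq hp hq, e, hY, sub_zero, e1, Rr_inv, neg_one_mul]
  linear_combination (Gr p q 1 z * Rr p q (-z) + 1) * (h 1 z * ((1 - z) * (1 - z⁻¹) *
    Rr p q (z ^ 2)) * Yf z) * h1

theorem Fi_limit (hp : ‖p‖ < 1) (hq : ‖q‖ < 1) {n : ℕ} {z : Fin n → ℂ} (hz : z ∈ tor n) :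
    Fi n p q h 1 (-1) z = Wt n p q (h 1) z := by
  rw [Fi, Finset.prod_congr rfl fun j _ => Ph_limit hp hq (hz j), Finset.prod_mul_distrib, Wt]
  ring

theorem kap_mul (hp : ‖p‖ < 1) (hq : ‖q‖ < 1) (r : ℝ) {z : ℂ} (hz : ‖z‖ = 1) :
    (1 - (r : ℂ) ^ 2) * (gpin p q h r z * ef p q z) =
      kap r z * (Gr p q r z ^ 2 * h r z * Rr p q (z ^ 2)) := by
  rw [gpin, Gm_eq hp hq, ef_eq hp hq, kap_eq hz]
  generalize (1 + (r : ℂ) * z) * (1 + r / z) = D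
  ring

theorem norm_rho_le {r : ℝ} (hr0 : 0 < r) (hr1 : r < 1) {z : ℂ} (hz : ‖z‖ = 1) :
    ‖rho r z‖ ≤ 4 := by
  have hz' : ‖z⁻¹‖ = 1 := by rw [norm_inv, hz, inv_one]
  have h1 := norm_one_add_le hr0 hr1 hz
  have h2 := norm_one_add_le hr0 hr1 hz'
  have n1 := norm_pos_iff.2 (one_add_mul_ne_zero hr0 hr1 hz.le)
  have n2 := norm_pos_iff.2 (one_add_mul_ne_zero hr0 hr1 hz'.le)
  rw [rho, Yf, div_eq_mul_inv (r : ℂ) z, norm_div, norm_mul, norm_mul, div_le_iff₀ (by positivity)]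
  calc _ ≤ (2 * ‖1 + r * z‖) * (2 * ‖1 + r * z⁻¹‖) := by gcongr
    _ = _ := by ring

theorem continuousOn_rho {X : Type*} [TopologicalSpace X] {K : Set X} {Y : X → ℂ} {r : ℝ}
    (hr0 : 0 < r) (hr1 : r < 1) (hY : ContinuousOn Y K) (h1 : ∀ x ∈ K, ‖Y x‖ = 1) :
    ContinuousOn (fun x => rho r (Y x)) K := by
  have h0 : ∀ x ∈ K, Y x ≠ 0 := fun x hx => norm_ne_zero_iff.1 (by rw [h1 x hx]; exact one_ne_zero)
  have hc : ∀ c : ℂ, ContinuousOn (fun _ : X => c) K := fun c => continuousOn_const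
  refine (continuousOn_Yf hY h0).div (((hc 1).add ((hc r).mul hY)).mul
    ((hc 1).add ((hc r).div hY h0))) fun x hx => mul_ne_zero ?_ ?_
  · exact one_add_mul_ne_zero hr0 hr1 (h1 x hx).le
  · change 1 + (r : ℂ) / Y x ≠ 0
    rw [div_eq_mul_inv]
    exact one_add_mul_ne_zero hr0 hr1 (by rw [norm_inv, h1 x hx, inv_one])

theorem tendsto_rho {z : ℂ} (hz : z ≠ 0) (h1 : z ≠ -1) :
    Tendsto (fun r : ℝ => rho r z) (𝓝 1) (𝓝 1) := by
  have e : rho 1 z = 1 := by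
    have h2 : 1 + z ≠ 0 := fun h => h1 (eq_neg_of_add_eq_zero_right h)
    have h3 : 1 + z⁻¹ ≠ 0 := fun h => h2 (by
      have : 1 + z = z * (1 + z⁻¹) := by field_simp; ring
      rw [this, h, mul_zero])
    rw [rho, Complex.ofReal_one, one_mul, one_div]
    exact div_self (mul_ne_zero h2 h3)
  rw [← e]
  refine ContinuousAt.div continuousAt_const (by fun_prop) fun h => ?_
  simp only [Complex.ofReal_one, one_mul] at h
  rw [rho, Complex.ofReal_one, one_mul, h, div_zero] at e
  exact zero_ne_one e

/-- The parameter domain of the pinching limit. -/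
def dom (r₁ : ℝ) (n : ℕ) : Set (ℝ × ℂ × (Fin n → ℂ)) :=
  Set.Icc r₁ 1 ×ˢ (Metric.sphere 0 1 ×ˢ tor n)

theorem continuousOn_Fi (hp : ‖p‖ < 1) (hq : ‖q‖ < 1) {r₁ : ℝ} (hr : 0 < r₁)
    (hh : ContinuousOn (fun x : ℝ × ℂ => h x.1 x.2) (Set.Icc r₁ 1 ×ˢ Metric.sphere 0 1)) (n : ℕ) :
    ContinuousOn (fun x : ℝ × ℂ × (Fin n → ℂ) => Fi n p q h x.1 x.2.1 x.2.2) (dom r₁ n) := by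
  have cr : ContinuousOn (fun x : ℝ × ℂ × (Fin n → ℂ) => x.1) (dom r₁ n) := by fun_prop
  have c0 : ContinuousOn (fun x : ℝ × ℂ × (Fin n → ℂ) => x.2.1) (dom r₁ n) := by fun_prop
  have ci : ∀ i, ContinuousOn (fun x : ℝ × ℂ × (Fin n → ℂ) => x.2.2 i) (dom r₁ n) := fun i => by
    fun_prop
  have n0 : ∀ x ∈ dom r₁ n, ‖x.2.1‖ = 1 := fun x hx => mem_sphere_zero_iff_norm.1 hx.2.1
  have ni : ∀ i, ∀ x ∈ dom r₁ n, ‖x.2.2 i‖ = 1 := fun i x hx => hx.2.2 i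
  have z0 : ∀ x ∈ dom r₁ n, x.2.1 ≠ 0 := fun x hx =>
    norm_ne_zero_iff.1 (by rw [n0 x hx]; exact one_ne_zero)
  have zi : ∀ i, ∀ x ∈ dom r₁ n, x.2.2 i ≠ 0 := fun i x hx => tor_ne_zero hx.2.2 i
  have h1 := continuousOn_pairProd (F := fun (x : ℝ × ℂ × (Fin n → ℂ)) i j =>
    Kf p q (x.2.2 i) (x.2.2 j)) (K := dom r₁ n) fun i j => continuousOn_Kf (P := fun _ => p) hq
      continuousOn_const (ci i) (ci j) (fun _ _ => hp) (zi i) (zi j)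
  refine h1.mul (continuousOn_finsetProd _ fun j _ => ?_)
  have a1 := continuousOn_Gr hp hq cr (fun x hx => hr.trans_le hx.1.1) (fun x hx => hx.1.2) (ci j)
    (ni j)
  have a2 : ContinuousOn (fun x : ℝ × ℂ × (Fin n → ℂ) => h x.1 (x.2.2 j)) (dom r₁ n) :=
    hh.comp (cr.prodMk (ci j)) fun x hx => ⟨hx.1, mem_sphere_zero_iff_norm.2 (ni j x hx)⟩
  have a3 := continuousOn_Rr hp hq ((ci j).pow 2) fun x hx => pow_ne_zero 2 (zi j x hx)
  have a4 := continuousOn_Yf (ci j) (zi j)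
  have a5 := continuousOn_Yf c0 z0
  have a6 := continuousOn_Rr hp hq (c0.mul (ci j)) fun x hx => mul_ne_zero (z0 x hx) (zi j x hx)
  have a7 := continuousOn_Rr hp hq (c0.div (ci j) (zi j)) fun x hx =>
    div_ne_zero (z0 x hx) (zi j x hx)
  have a8 := (ci j).inv₀ (zi j)
  have hc : ContinuousOn (fun _ : ℝ × ℂ × (Fin n → ℂ) => (1 : ℂ)) (dom r₁ n) := continuousOn_const
  exact (((a1.pow 2).mul a2).mul (((hc.sub (ci j)).mul (hc.sub a8)).mul a3)).mul
    ((a4.sub a5).mul (a6.mul a7))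

end

section
open Filter Topology
variable {p q : ℂ} {h : ℝ → ℂ → ℂ} {r₁ : ℝ} {n : ℕ}

/-- The integrand of the inner integral in the pinching limit. -/
noncomputable def Jf (n : ℕ) (p q : ℂ) (h : ℝ → ℂ → ℂ) (r : ℝ) (z₀ : ℂ) (z : Fin n → ℂ) : ℂ :=
  Fi n p q h r z₀ z * ∏ j, rho r (z j) ^ 2

/-- The factor multiplying the inner integral in the pinching limit. -/
noncomputable def pinF (p q : ℂ) (h : ℝ → ℂ → ℂ) (r : ℝ) (z : ℂ) : ℂ :=
  Gr p q r z ^ 2 * h r z * Rr p q (z ^ 2)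

theorem continuousOn_gpin (hp : ‖p‖ < 1) (hq : ‖q‖ < 1) (hr : 0 < r₁) {r : ℝ} (h1 : r₁ ≤ r)
    (h2 : r < 1)
    (hh : ContinuousOn (fun x : ℝ × ℂ => h x.1 x.2) (Set.Icc r₁ 1 ×ˢ Metric.sphere 0 1)) :
    ContinuousOn (gpin p q h r) (Metric.sphere 0 1) := by
  have h0 : 0 < r := hr.trans_le h1
  have n1 : ∀ z ∈ Metric.sphere (0 : ℂ) 1, ‖z‖ = 1 := fun z hz => mem_sphere_zero_iff_norm.1 hz
  have n0 : ∀ z ∈ Metric.sphere (0 : ℂ) 1, z ≠ 0 := fun z hz =>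
    norm_ne_zero_iff.1 (by rw [n1 z hz]; exact one_ne_zero)
  have hrn : -(r : ℂ) ≠ 0 := neg_ne_zero.2 (by exact_mod_cast h0.ne')
  have hrm : ‖-(r : ℂ)‖ < 1 := by rwa [norm_neg, Complex.norm_real, Real.norm_of_nonneg h0.le]
  have a1 := continuousOn_ellGamma (K := Metric.sphere (0 : ℂ) 1) (Y := fun z => -(r : ℂ) * z) hp hq
    (by fun_prop) (fun z hz => mul_ne_zero hrn (n0 z hz)) fun z hz => by
      rw [norm_mul, n1 z hz, mul_one]; exact hrm
  have a2 := continuousOn_ellGamma (K := Metric.sphere (0 : ℂ) 1) (Y := fun z => -(r : ℂ) / z) hp hq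
    (continuousOn_const.div continuousOn_id n0) (fun z hz => div_ne_zero hrn (n0 z hz))
    fun z hz => by rw [norm_div, n1 z hz, div_one]; exact hrm
  have a3 : ContinuousOn (h r) (Metric.sphere 0 1) :=
    hh.comp (continuousOn_const.prodMk continuousOn_id) fun z hz => ⟨⟨h1, h2.le⟩, hz⟩
  exact ((a1.mul a2).pow 2).mul a3

theorem mul_torusInt_Th (hp : ‖p‖ < 1) (hq : ‖q‖ < 1) (r : ℝ) {z₀ : ℂ} (hz : ‖z₀‖ = 1) :
    (1 - (r : ℂ) ^ 2) * torusInt n (Th n p q (gpin p q h r) z₀) =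
      kap r z₀ * (pinF p q h r z₀ * torusInt n (Jf n p q h r z₀)) := by
  have e : torusInt n (Th n p q (gpin p q h r) z₀) =
      torusInt n fun z => (gpin p q h r z₀ * ef p q z₀) * Jf n p q h r z₀ z :=
    torusInt_congr fun z hz => by
      rw [Th, Jf, ← prod_Kh_mul_Wt hp hq r z₀ fun i => tor_ne_zero hz i]; ring
  rw [e, torusInt_const_mul, ← mul_assoc, kap_mul hp hq r hz, pinF]
  ring

theorem mul_torusInt_gpin (hp : ‖p‖ < 1) (hq : ‖q‖ < 1) (hr : 0 < r₁) {r : ℝ} (h1 : r₁ ≤ r)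
    (h2 : r < 1)
    (hh : ContinuousOn (fun x : ℝ × ℂ => h x.1 x.2) (Set.Icc r₁ 1 ×ˢ Metric.sphere 0 1)) :
    (1 - (r : ℂ) ^ 2) * torusInt (n + 1) (Wt (n + 1) p q (gpin p q h r)) =
      (n + 1) * (((1 / (2 * π) : ℝ) : ℂ) * ∫ φ in (0 : ℝ)..2 * π,
        (kap r (cx φ) : ℂ) * (pinF p q h r (cx φ) * torusInt n (Jf n p q h r (cx φ)))) := by
  rw [torusInt_Wt_succ hp hq (continuousOn_gpin hp hq hr h1 h2 hh), mul_left_comm,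
    mul_left_comm (1 - (r : ℂ) ^ 2), ← intervalIntegral.integral_const_mul]
  simp_rw [mul_torusInt_Th hp hq r (norm_cx _)]

theorem continuousOn_pinF (hp : ‖p‖ < 1) (hq : ‖q‖ < 1) (hr : 0 < r₁)
    (hh : ContinuousOn (fun x : ℝ × ℂ => h x.1 x.2) (Set.Icc r₁ 1 ×ˢ Metric.sphere 0 1)) :
    ContinuousOn (fun x : ℝ × ℂ => pinF p q h x.1 x.2) (Set.Icc r₁ 1 ×ˢ Metric.sphere 0 1) := by
  have n1 : ∀ x ∈ Set.Icc r₁ 1 ×ˢ Metric.sphere (0 : ℂ) 1, ‖x.2‖ = 1 := fun x hx =>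
    mem_sphere_zero_iff_norm.1 hx.2
  have c1 : ContinuousOn (fun x : ℝ × ℂ => x.1) (Set.Icc r₁ 1 ×ˢ Metric.sphere (0 : ℂ) 1) := by
    fun_prop
  have c2 : ContinuousOn (fun x : ℝ × ℂ => x.2) (Set.Icc r₁ 1 ×ˢ Metric.sphere (0 : ℂ) 1) := by
    fun_prop
  exact (((continuousOn_Gr hp hq c1 (fun x hx => hr.trans_le hx.1.1) (fun x hx => hx.1.2) c2
    n1).pow 2).mul hh).mul (continuousOn_Rr hp hq (c2.pow 2) fun x hx =>
      pow_ne_zero 2 (norm_ne_zero_iff.1 (by rw [n1 x hx]; exact one_ne_zero)))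

theorem exists_norm_Jf_le (hp : ‖p‖ < 1) (hq : ‖q‖ < 1) (hr : 0 < r₁)
    (hh : ContinuousOn (fun x : ℝ × ℂ => h x.1 x.2) (Set.Icc r₁ 1 ×ˢ Metric.sphere 0 1)) (n : ℕ) :
    ∃ M, ∀ r, r₁ ≤ r → r < 1 → ∀ z₀ : ℂ, ‖z₀‖ = 1 → ∀ z ∈ tor n, ‖Jf n p q h r z₀ z‖ ≤ M := by
  obtain ⟨M, hM⟩ := ((isCompact_Icc (a := r₁) (b := 1)).prod
    ((isCompact_sphere (0 : ℂ) 1).prod (isCompact_tor n))).exists_bound_of_continuousOn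
    (continuousOn_Fi hp hq hr hh n)
  refine ⟨M * ∏ _j : Fin n, (4 : ℝ) ^ 2, fun r h1 h2 z₀ hz₀ z hz => ?_⟩
  rw [Jf, norm_mul, norm_prod]
  refine mul_le_mul (hM (r, z₀, z) ⟨⟨h1, h2.le⟩, mem_sphere_zero_iff_norm.2 hz₀, hz⟩)
    (Finset.prod_le_prod (fun j _ => norm_nonneg _) fun j _ => ?_)
    (Finset.prod_nonneg fun j _ => norm_nonneg _)
    ((norm_nonneg _).trans (hM (r, z₀, z) ⟨⟨h1, h2.le⟩, mem_sphere_zero_iff_norm.2 hz₀, hz⟩))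
  rw [norm_pow]
  have := norm_rho_le (hr.trans_le h1) h2 (hz j)
  gcongr

theorem continuousOn_Jf (hp : ‖p‖ < 1) (hq : ‖q‖ < 1) (hr : 0 < r₁) {r : ℝ} (h1 : r₁ ≤ r)
    (h2 : r < 1)
    (hh : ContinuousOn (fun x : ℝ × ℂ => h x.1 x.2) (Set.Icc r₁ 1 ×ˢ Metric.sphere 0 1)) :
    ContinuousOn (fun x : ℂ × (Fin n → ℂ) => Jf n p q h r x.1 x.2)
      (Metric.sphere 0 1 ×ˢ tor n) := by
  refine ContinuousOn.mul ((continuousOn_Fi hp hq hr hh n).comp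
    (f := fun x : ℂ × (Fin n → ℂ) => (r, x)) (by fun_prop) fun x hx => ⟨⟨h1, h2.le⟩, hx⟩)
    (continuousOn_finsetProd _ fun j _ => (continuousOn_rho (hr.trans_le h1) h2
      (Y := fun x : ℂ × (Fin n → ℂ) => x.2 j) (by fun_prop) fun x hx => hx.2 j).pow 2)

theorem continuous_pinF_mul (hp : ‖p‖ < 1) (hq : ‖q‖ < 1) (hr : 0 < r₁) {r : ℝ} (h1 : r₁ ≤ r)
    (h2 : r < 1)
    (hh : ContinuousOn (fun x : ℝ × ℂ => h x.1 x.2) (Set.Icc r₁ 1 ×ˢ Metric.sphere 0 1)) :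
    Continuous fun φ => pinF p q h r (cx φ) * torusInt n (Jf n p q h r (cx φ)) := by
  have hs : ∀ φ : ℝ, cx φ ∈ Metric.sphere (0 : ℂ) 1 := fun φ => mem_sphere_zero_iff_norm.2 (norm_cx φ)
  rw [← continuousOn_univ]
  refine ContinuousOn.mul ((continuousOn_pinF hp hq hr hh).comp (f := fun φ : ℝ => (r, cx φ))
    (continuousOn_const.prodMk continuous_cx.continuousOn) fun φ _ => ⟨⟨h1, h2.le⟩, hs φ⟩) ?_
  refine continuousOn_torusInt (f := fun φ : ℝ => Jf n p q h r (cx φ)) isOpen_univ ?_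
  exact (continuousOn_Jf hp hq hr h1 h2 hh).comp
    (f := fun x : ℝ × (Fin n → ℂ) => (cx x.1, x.2))
    ((continuous_cx.comp continuous_fst).prodMk continuous_snd).continuousOn
    fun x hx => ⟨hs _, hx.2⟩

theorem tendsto_torusInt_Jf (hp : ‖p‖ < 1) (hq : ‖q‖ < 1) (hr : 0 < r₁) (hr1 : r₁ < 1)
    (hh : ContinuousOn (fun x : ℝ × ℂ => h x.1 x.2) (Set.Icc r₁ 1 ×ˢ Metric.sphere 0 1)) :
    Tendsto (fun x : ℝ × ℂ => torusInt n (Jf n p q h x.1 x.2))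
      (𝓝[<] 1 ×ˢ 𝓝[Metric.sphere 0 1] (-1)) (𝓝 (torusInt n (Wt n p q (h 1)))) := by
  obtain ⟨M, hM⟩ := exists_norm_Jf_le hp hq hr hh n
  have hev : ∀ᶠ x : ℝ × ℂ in 𝓝[<] 1 ×ˢ 𝓝[Metric.sphere 0 1] (-1),
      (r₁ ≤ x.1 ∧ x.1 < 1) ∧ x.2 ∈ Metric.sphere (0 : ℂ) 1 :=
    (show ∀ᶠ r : ℝ in 𝓝[<] 1, r₁ ≤ r ∧ r < 1 from
      (Ico_mem_nhdsLT hr1)).prod_mk self_mem_nhdsWithin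
  refine tendsto_torusInt (M := M) ?_ ?_ ?_
  · filter_upwards [hev] with x hx
    exact (continuousOn_Jf hp hq hr hx.1.1 hx.1.2 hh).comp
      (f := fun z : Fin n → ℂ => (x.2, z)) (by fun_prop) fun z hz => ⟨hx.2, hz⟩
  · filter_upwards [hev] with x hx z hz
    exact hM _ hx.1.1 hx.1.2 _ (mem_sphere_zero_iff_norm.1 hx.2) z hz
  · intro z hz hg
    have hm : ((1 : ℝ), (-1 : ℂ), z) ∈ dom r₁ n :=
      ⟨⟨hr1.le, le_rfl⟩, by simp, hz⟩
    have h1 : Tendsto (fun x : ℝ × ℂ => Fi n p q h x.1 x.2 z)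
        (𝓝[<] 1 ×ˢ 𝓝[Metric.sphere 0 1] (-1)) (𝓝 (Wt n p q (h 1) z)) := by
      rw [← Fi_limit hp hq hz]
      refine Tendsto.comp (continuousOn_Fi hp hq hr hh n _ hm)
        (f := fun x : ℝ × ℂ => (x.1, x.2, z)) ?_
      refine tendsto_nhdsWithin_iff.2 ⟨?_, ?_⟩
      · exact (tendsto_fst.mono_right nhdsWithin_le_nhds).prodMk_nhds
          ((tendsto_snd.mono_right nhdsWithin_le_nhds).prodMk_nhds tendsto_const_nhds)
      · filter_upwards [hev] with x hx using ⟨⟨hx.1.1, hx.1.2.le⟩, hx.2, hz⟩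
    have h2 : Tendsto (fun x : ℝ × ℂ => ∏ j, rho x.1 (z j) ^ 2)
        (𝓝[<] 1 ×ˢ 𝓝[Metric.sphere 0 1] (-1)) (𝓝 (∏ _j : Fin n, (1 : ℂ) ^ 2)) :=
      tendsto_finsetProd _ fun j _ => ((tendsto_rho (tor_ne_zero hz j) fun hj =>
        hg.1 j (by rw [hj]; norm_num)).comp
        (tendsto_fst.mono_right nhdsWithin_le_nhds)).pow 2
    have := h1.mul h2
    simp only [one_pow, Finset.prod_const_one, mul_one] at this
    exact this

theorem prod_nhdsLT_le (hr1 : r₁ < 1) :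
    𝓝[<] (1 : ℝ) ×ˢ 𝓝[Metric.sphere 0 1] (-1 : ℂ) ≤
      𝓝[Set.Icc r₁ 1 ×ˢ Metric.sphere (0 : ℂ) 1] ((1 : ℝ), (-1 : ℂ)) := by
  rw [nhdsWithin_prod_eq]
  exact Filter.prod_mono (nhdsWithin_le_of_mem (mem_of_superset (Ico_mem_nhdsLT hr1)
    Set.Ico_subset_Icc_self)) le_rfl

theorem tendsto_pinF (hp : ‖p‖ < 1) (hq : ‖q‖ < 1) (hr : 0 < r₁) (hr1 : r₁ < 1)
    (hh : ContinuousOn (fun x : ℝ × ℂ => h x.1 x.2) (Set.Icc r₁ 1 ×ˢ Metric.sphere 0 1)) :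
    Tendsto (fun x : ℝ × ℂ => pinF p q h x.1 x.2)
      (𝓝[<] 1 ×ˢ 𝓝[Metric.sphere 0 1] (-1)) (𝓝 (pinF p q h 1 (-1))) := by
  have hm : ((1 : ℝ), (-1 : ℂ)) ∈ Set.Icc r₁ 1 ×ˢ Metric.sphere (0 : ℂ) 1 :=
    ⟨⟨hr1.le, le_rfl⟩, by simp⟩
  have := continuousOn_pinF hp hq hr hh _ hm
  exact Tendsto.mono_left this (prod_nhdsLT_le hr1)

theorem tendsto_pinF_mul (hp : ‖p‖ < 1) (hq : ‖q‖ < 1) (hr : 0 < r₁) (hr1 : r₁ < 1)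
    (hh : ContinuousOn (fun x : ℝ × ℂ => h x.1 x.2) (Set.Icc r₁ 1 ×ˢ Metric.sphere 0 1)) :
    Tendsto (fun x : ℝ × ℂ => pinF p q h x.1 x.2 * torusInt n (Jf n p q h x.1 x.2))
      (𝓝[<] 1 ×ˢ 𝓝[Metric.sphere 0 1] (-1))
      (𝓝 (pinF p q h 1 (-1) * torusInt n (Wt n p q (h 1)))) := by
  exact (tendsto_pinF hp hq hr hr1 hh).mul (tendsto_torusInt_Jf hp hq hr hr1 hh)

theorem exists_norm_pinF_le (hp : ‖p‖ < 1) (hq : ‖q‖ < 1) (hr : 0 < r₁)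
    (hh : ContinuousOn (fun x : ℝ × ℂ => h x.1 x.2) (Set.Icc r₁ 1 ×ˢ Metric.sphere 0 1)) :
    ∃ A, ∀ r, r₁ ≤ r → r < 1 → ∀ z : ℂ, ‖z‖ = 1 → ‖pinF p q h r z‖ ≤ A := by
  obtain ⟨A, hA⟩ := ((isCompact_Icc (a := r₁) (b := 1)).prod
    (isCompact_sphere (0 : ℂ) 1)).exists_bound_of_continuousOn (continuousOn_pinF hp hq hr hh)
  exact ⟨A, fun r h1 h2 z hz => hA (r, z) ⟨⟨h1, h2.le⟩, mem_sphere_zero_iff_norm.2 hz⟩⟩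

theorem tendsto_integral_pinch (hp : ‖p‖ < 1) (hq : ‖q‖ < 1) (hr : 0 < r₁) (hr1 : r₁ < 1)
    (hh : ContinuousOn (fun x : ℝ × ℂ => h x.1 x.2) (Set.Icc r₁ 1 ×ˢ Metric.sphere 0 1)) :
    Tendsto (fun r : ℝ => ∫ φ in (0 : ℝ)..2 * π,
        (kap r (cx φ) : ℂ) * (pinF p q h r (cx φ) * torusInt n (Jf n p q h r (cx φ)))) (𝓝[<] 1)
      (𝓝 (4 * π * (pinF p q h 1 (-1) * torusInt n (Wt n p q (h 1))))) := by
  have hev : ∀ᶠ r : ℝ in 𝓝[<] 1, r₁ ≤ r ∧ r < 1 := Ico_mem_nhdsLT hr1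
  obtain ⟨M, hM⟩ := exists_norm_Jf_le hp hq hr hh n
  obtain ⟨A, hA⟩ := exists_norm_pinF_le hp hq hr hh
  refine tendsto_integral_kap
    (G := fun r z => pinF p q h r z * torusInt n (Jf n p q h r z))
    (B := A * (‖((1 / (2 * π) : ℝ) : ℂ) ^ n‖ *
      (M * (Measure.pi fun _ : Fin n => arc).real Set.univ)))
    (L := pinF p q h 1 (-1) * torusInt n (Wt n p q (h 1))) ?_ ?_ ?_
  · filter_upwards [hev] with r h using continuous_pinF_mul hp hq hr h.1 h.2 hh
  · filter_upwards [hev] with r hr2 z hz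
    rw [norm_mul]
    exact mul_le_mul (hA r hr2.1 hr2.2 z hz) (norm_torusInt_le (hM r hr2.1 hr2.2 z hz)) (norm_nonneg _)
      ((norm_nonneg _).trans (hA r hr2.1 hr2.2 z hz))
  · intro ε hε
    have ht := (tendsto_pinF_mul (n := n) hp hq hr hr1 hh).eventually (Metric.closedBall_mem_nhds _ hε)
    obtain ⟨P, hP, Q, hQ, hPQ⟩ := eventually_prod_iff.1 ht
    obtain ⟨δ, hδ, hb⟩ := Metric.mem_nhdsWithin_iff.1 hQ
    refine ⟨δ, hδ, ?_⟩
    filter_upwards [hP] with r hr z hz hzδ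
    have := hPQ hr (hb ⟨by rw [Metric.mem_ball, dist_eq_norm, sub_neg_eq_add, add_comm]; exact hzδ,
      mem_sphere_zero_iff_norm.2 hz⟩)
    rwa [dist_eq_norm] at this

theorem tendsto_pinch (hp : ‖p‖ < 1) (hq : ‖q‖ < 1) (hr : 0 < r₁) (hr1 : r₁ < 1)
    (hh : ContinuousOn (fun x : ℝ × ℂ => h x.1 x.2) (Set.Icc r₁ 1 ×ˢ Metric.sphere 0 1)) :
    Tendsto (fun r : ℝ => (1 - (r : ℂ) ^ 2) *
      torusInt (n + 1) (Wt (n + 1) p q (gpin p q h r))) (𝓝[<] 1)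
      (𝓝 (2 * (n + 1) * (pinF p q h 1 (-1) * torusInt n (Wt n p q (h 1))))) := by
  have key := tendsto_integral_pinch (n := n) hp hq hr hr1 hh
  have hev : ∀ᶠ r : ℝ in 𝓝[<] 1, r₁ ≤ r ∧ r < 1 := Ico_mem_nhdsLT hr1
  have ht := (key.const_mul ((1 / (2 * π) : ℝ) : ℂ)).const_mul ((n : ℂ) + 1)
  have hpi : (π : ℂ) ≠ 0 := by exact_mod_cast Real.pi_ne_zero
  have e : ∀ L : ℂ, ((n : ℂ) + 1) * (((1 / (2 * π) : ℝ) : ℂ) * (4 * π * L)) = 2 * (n + 1) * L :=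
    fun L => by push_cast; field_simp; ring
  rw [e] at ht
  refine ht.congr' ?_
  filter_upwards [hev] with r h2
  exact (mul_torusInt_gpin hp hq hr h2.1 h2.2 hh).symm

end

section
open Filter Topology
variable {p q : ℂ}

theorem gam_cons {d : ℕ} (a : ℂ) (s : Fin d → ℂ) (z : ℂ) :
    gam p q (Fin.cons a s : Fin (d + 1) → ℂ) z =
      ellGamma (a * z) p q * ellGamma (a / z) p q * gam p q s z := by
  unfold gam
  rw [Fin.prod_univ_succ]
  simp only [Fin.cons_zero, Fin.cons_succ]

theorem pref_cons {d : ℕ} (a : ℂ) (s : Fin d → ℂ) :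
    pref p q (Fin.cons a s : Fin (d + 1) → ℂ) = (∏ j, ellGamma (a * s j) p q) * pref p q s := by
  unfold pref
  rw [pairProd_succ]
  simp only [Fin.cons_zero, Fin.cons_succ]

theorem div_cons {d : ℕ} (ω a : ℂ) (s : Fin d → ℂ) :
    (fun i => ω / (Fin.cons a s : Fin (d + 1) → ℂ) i) = Fin.cons (ω / a) fun i => ω / s i := by
  ext i
  refine Fin.cases ?_ (fun j => ?_) i <;> simp

theorem continuousOn_gam_param {X : Type*} [TopologicalSpace X] {d : ℕ} {S : X → Fin d → ℂ}
    {Z : X → ℂ} {K : Set X} (hp : ‖p‖ < 1) (hq : ‖q‖ < 1)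
    (hS : ∀ i, ContinuousOn (fun x => S x i) K) (h0 : ∀ x ∈ K, ∀ i, S x i ≠ 0)
    (h1 : ∀ x ∈ K, ∀ i, ‖S x i‖ < 1) (hZ : ContinuousOn Z K) (hZ1 : ∀ x ∈ K, ‖Z x‖ = 1) :
    ContinuousOn (fun x => gam p q (S x) (Z x)) K := by
  have hZ0 : ∀ x ∈ K, Z x ≠ 0 := fun x hx => norm_ne_zero_iff.1 (by rw [hZ1 x hx]; exact one_ne_zero)
  refine continuousOn_finsetProd _ fun i _ => ContinuousOn.mul
    (continuousOn_ellGamma hp hq ((hS i).mul hZ) (fun x hx => mul_ne_zero (h0 x hx i) (hZ0 x hx))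
      fun x hx => ?_)
    (continuousOn_ellGamma hp hq ((hS i).div hZ hZ0)
      (fun x hx => div_ne_zero (h0 x hx i) (hZ0 x hx)) fun x hx => ?_)
  · rw [norm_mul, hZ1 x hx, mul_one]; exact h1 x hx i
  · rw [norm_div, hZ1 x hx, div_one]; exact h1 x hx i

theorem continuousOn_torusInt_gam {N d : ℕ} {S : ℝ → Fin d → ℂ} {U : Set ℝ} (hp : ‖p‖ < 1)
    (hq : ‖q‖ < 1) (hU : IsOpen U)
    (hS : ∀ i, ContinuousOn (fun x => S x i) U) (h0 : ∀ x ∈ U, ∀ i, S x i ≠ 0)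
    (h1 : ∀ x ∈ U, ∀ i, ‖S x i‖ < 1) :
    ContinuousOn (fun r => torusInt N (Wt N p q (gam p q (S r)))) U := by
  refine continuousOn_torusInt (f := fun r => Wt N p q (gam p q (S r))) hU ?_
  refine continuousOn_Wt (P := fun _ => p) (g := fun x : ℝ × (Fin N → ℂ) => gam p q (S x.1))
    (z := fun x => x.2) hq continuousOn_const (fun _ _ => hp) continuousOn_snd
    (fun x hx i => tor_ne_zero hx.2 i) fun i => ?_
  exact continuousOn_gam_param (S := fun x : ℝ × (Fin N → ℂ) => S x.1) hp hq
    (fun j => (hS j).comp continuousOn_fst fun x hx => hx.1) (fun x hx => h0 _ hx.1)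
    (fun x hx => h1 _ hx.1) (by fun_prop) fun x hx => hx.2 i

theorem continuousOn_pref_param {X : Type*} [TopologicalSpace X] {d : ℕ} {S : X → Fin d → ℂ}
    {K : Set X} (hp : ‖p‖ < 1) (hq : ‖q‖ < 1)
    (hS : ∀ i, ContinuousOn (fun x => S x i) K) (h0 : ∀ x ∈ K, ∀ i, S x i ≠ 0)
    (h1 : ∀ x ∈ K, ∀ i, ‖S x i‖ < 1) : ContinuousOn (fun x => pref p q (S x)) K := by
  refine continuousOn_pairProd (F := fun x i j => ellGamma (S x i * S x j) p q) fun i j =>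
    continuousOn_ellGamma hp hq ((hS i).mul (hS j))
    (fun x hx => mul_ne_zero (h0 x hx i) (h0 x hx j)) fun x hx => ?_
  exact norm_mul_lt_one (h1 x hx i) (h1 x hx j)

theorem rg_one (hp : ‖p‖ < 1) (hq : ‖q‖ < 1) : rg p q 1 * (qPoch p * qPoch q) = 1 := by
  have hpq : ‖p * q‖ < 1 := norm_mul_lt_one hp hq
  have a := Qf_ne_zero_of_norm_lt hp hp
  have b := Qf_ne_zero_of_norm_lt hq hq
  have c := Ef_ne_zero_of_norm_lt hp hq hpq
  rw [rg, div_one, mul_one, mul_one, Ef_shift_left hp hq q, qPoch_eq, qPoch_eq]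
  field_simp

theorem rg_one_sq_mul (hp : ‖p‖ < 1) (hq : ‖q‖ < 1) : rg p q 1 ^ 2 * Rr p q 1 = 1 := by
  have := rg_mul_rg hp hq (x := 1) (by simp)
  rw [inv_one] at this
  rw [sq, this]

theorem nrm_succ (n : ℕ) (p q : ℂ) :
    nrm (n + 1) p q * (2 * (n + 1)) = nrm n p q * (qPoch p * qPoch q) := by
  have h1 : ((n : ℂ) + 1) ≠ 0 := by exact_mod_cast n.succ_ne_zero
  have h2 : (n.factorial : ℂ) ≠ 0 := by exact_mod_cast n.factorial_ne_zero
  unfold nrm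
  rw [Nat.factorial_succ]
  push_cast
  field_simp
  ring

theorem gam_neg_one {d : ℕ} (t : Fin d → ℂ) :
    gam p q t (-1) = (∏ j, ellGamma (-1 * t j) p q) ^ 2 := by
  unfold gam
  rw [sq, ← Finset.prod_mul_distrib]
  refine Finset.prod_congr rfl fun j _ => ?_
  rw [div_neg, div_one, mul_comm (t j), neg_one_mul]

theorem nrm_mul_pinF {d : ℕ} (hp : ‖p‖ < 1) (hq : ‖q‖ < 1) (n : ℕ) {h : ℝ → ℂ → ℂ}
    {t : Fin d → ℂ} (ht : h 1 (-1) = gam p q t (-1)) (T : ℂ) :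
    nrm (n + 1) p q * (2 * (n + 1) * (pinF p q h 1 (-1) * T)) =
      rg p q 1 * (∏ j, ellGamma (-1 * t j) p q) ^ 2 * (nrm n p q * T) := by
  have e : Gr p q 1 (-1) = rg p q 1 ^ 2 := by
    rw [Gr, sq]; congr 2 <;> simp
  have e1 : ((-1 : ℂ)) ^ 2 = 1 := by norm_num
  rw [pinF, e, e1, ht, gam_neg_one]
  have h1 := rg_one hp hq
  have h2 := rg_one_sq_mul hp hq
  have h3 := nrm_succ n p q
  set P := (∏ j, ellGamma (-1 * t j) p q) ^ 2
  linear_combination (rg p q 1 ^ 4 * P * Rr p q 1 * T) * h3 +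
    (nrm n p q * (qPoch p * qPoch q) * rg p q 1 ^ 2 * P * T) * h2 +
    (nrm n p q * rg p q 1 * P * T) * h1

theorem ellGamma_mul_neg (hp : ‖p‖ < 1) (hq : ‖q‖ < 1) {ω : ℂ} (hω : ω ^ 2 = p * q) (hω0 : ω ≠ 0)
    {z : ℂ} (hz : ‖z‖ = 1) :
    ellGamma (-ω * z) p q * ellGamma (-ω / z) p q = 1 := by
  have hz0 : z ≠ 0 := norm_ne_zero_iff.1 (by rw [hz]; exact one_ne_zero)
  have hω1 : ‖ω‖ < 1 := by
    have : ‖ω‖ ^ 2 < 1 := by rw [← norm_pow, hω]; exact norm_mul_lt_one hp hq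
    nlinarith [norm_nonneg ω]
  have e : -ω / z = p * q / (-ω * z) := by rw [← hω]; field_simp
  have hpq : p * q ≠ 0 := by rw [← hω]; exact pow_ne_zero 2 hω0
  rw [e]
  refine ellGamma_mul_reflect hp hq hpq (Ef_ne_zero_of_norm_lt hp hq ?_)
    (Ef_ne_zero_of_norm_lt hp hq ?_)
  · rwa [norm_mul, hz, mul_one, norm_neg]
  · rwa [← e, norm_div, hz, div_one, norm_neg]

end

section
open Filter Topology
variable {p q ω : ℂ} {d : ℕ} {t : Fin d → ℂ} {i₀ : Fin d}

/-- The parameters with the `i₀`-th one rescaled by `r⁻²`. -/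
noncomputable def tpar (t : Fin d → ℂ) (i₀ : Fin d) (r : ℝ) : Fin d → ℂ :=
  Function.update t i₀ (((r : ℂ) ^ 2)⁻¹ * t i₀)

/-- The rescaled parameters together with two copies of `-r`. -/
noncomputable def spar (t : Fin d → ℂ) (i₀ : Fin d) (r : ℝ) : Fin (d + 1 + 1) → ℂ :=
  Fin.cons (-r) (Fin.cons (-r : ℂ) (tpar t i₀ r) : Fin (d + 1) → ℂ)

theorem tpar_one : tpar t i₀ 1 = t := by simp [tpar]

theorem prod_spar {r : ℝ} (hr : r ≠ 0) : ∏ i, spar t i₀ r i = ∏ i, t i := by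
  have h : (r : ℂ) ≠ 0 := by exact_mod_cast hr
  rw [spar, Fin.prod_cons, Fin.prod_cons, tpar, prod_update_mul]
  field_simp

theorem gam_spar (r : ℝ) : gam p q (spar t i₀ r) = gpin p q (fun r => gam p q (tpar t i₀ r)) r := by
  ext z
  rw [spar, gam_cons, gam_cons, gpin, Gm]
  ring

theorem pref_spar (r : ℝ) : pref p q (spar t i₀ r) =
    ellGamma ((r : ℂ) ^ 2) p q * ((∏ j, ellGamma (-r * tpar t i₀ r j) p q) ^ 2 *
      pref p q (tpar t i₀ r)) := by
  rw [spar, pref_cons, pref_cons, Fin.prod_univ_succ, Fin.cons_zero, neg_mul_neg, ← sq]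
  simp only [Fin.cons_succ]
  ring

theorem continuousOn_tpar (j : Fin d) : ContinuousOn (fun r => tpar t i₀ r j) (Set.Ioi 0) := by
  unfold tpar
  by_cases h : j = i₀
  · subst h
    simp only [Function.update_self]
    refine ContinuousOn.mul (ContinuousOn.inv₀ (by fun_prop) fun r hr => ?_) continuousOn_const
    exact pow_ne_zero 2 (by exact_mod_cast (show (0 : ℝ) < r from hr).ne')
  · simp only [Function.update_of_ne h]
    exact continuousOn_const

/-- The open conditions on `r` under which the rescaled parameters are admissible. -/
def admis (ω : ℂ) (t : Fin d → ℂ) (i₀ : Fin d) (r : ℝ) : Prop :=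
  0 < r ∧ ‖ω‖ < r ∧ ∀ j, ‖ω‖ < ‖tpar t i₀ r j‖ ∧ ‖tpar t i₀ r j‖ < 1 ∧
    ‖(-r : ℂ) * tpar t i₀ r j‖ < 1

theorem eventually_admis (hω : ‖ω‖ < 1) (ht : ∀ r, ‖ω‖ < ‖t r‖ ∧ ‖t r‖ < 1) :
    ∀ᶠ r in 𝓝 (1 : ℝ), admis ω t i₀ r := by
  have hc : ∀ j, ContinuousAt (fun r => tpar t i₀ r j) 1 := fun j =>
    (continuousOn_tpar j).continuousAt (Ioi_mem_nhds one_pos)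
  have hid : ContinuousAt (fun r : ℝ => r) 1 := continuousAt_id
  refine (hid.eventually_const_lt one_pos).and ((hid.eventually_const_lt hω).and
    (eventually_all.2 fun j => ?_))
  have e : tpar t i₀ 1 j = t j := by rw [tpar_one]
  have hr : ContinuousAt (fun r : ℝ => (-r : ℂ)) 1 := by fun_prop
  have h1 := (hc j).norm.tendsto
  have h2 : Tendsto (fun r : ℝ => ‖(-r : ℂ) * tpar t i₀ r j‖) (𝓝 1)
      (𝓝 ‖(-(1 : ℝ) : ℂ) * tpar t i₀ 1 j‖) := (hr.mul (hc j)).norm.tendsto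
  rw [e] at h1
  rw [e, Complex.ofReal_one, norm_mul, norm_neg, norm_one, one_mul] at h2
  exact (h1.eventually_const_lt (ht j).1).and
    ((h1.eventually_lt_const (ht j).2).and (h2.eventually_lt_const (ht j).2))

theorem admis.spar_lt {r : ℝ} (h : admis ω t i₀ r) (hr : r < 1) (i : Fin (d + 1 + 1)) :
    ‖ω‖ < ‖spar t i₀ r i‖ ∧ ‖spar t i₀ r i‖ < 1 := by
  have h1 : ‖(-r : ℂ)‖ = r := by rw [norm_neg, Complex.norm_real, Real.norm_of_nonneg h.1.le]
  refine Fin.cases ?_ (fun i => Fin.cases ?_ (fun i => ?_) i) i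
  · simp only [spar, Fin.cons_zero, h1]; exact ⟨h.2.1, hr⟩
  · simp only [spar, Fin.cons_zero, Fin.cons_succ, h1]; exact ⟨h.2.1, hr⟩
  · simp only [spar, Fin.cons_succ]; exact ⟨(h.2.2 i).1, (h.2.2 i).2.1⟩

theorem admis.norm_lt_spar {r : ℝ} (h : admis ω t i₀ r) (i : Fin (d + 1 + 1)) :
    ‖ω‖ < ‖spar t i₀ r i‖ := by
  have h1 : ‖(-r : ℂ)‖ = r := by rw [norm_neg, Complex.norm_real, Real.norm_of_nonneg h.1.le]
  refine Fin.cases ?_ (fun i => Fin.cases ?_ (fun i => ?_) i) i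
  · simp only [spar, Fin.cons_zero, h1]; exact h.2.1
  · simp only [spar, Fin.cons_zero, Fin.cons_succ, h1]; exact h.2.1
  · simp only [spar, Fin.cons_succ]; exact (h.2.2 i).1

theorem continuousOn_spar (i : Fin (d + 1 + 1)) :
    ContinuousOn (fun r => spar t i₀ r i) (Set.Ioi 0) := by
  have h0 : ContinuousOn (fun r : ℝ => (-r : ℂ)) (Set.Ioi 0) := by fun_prop
  refine Fin.cases ?_ (fun i => Fin.cases ?_ (fun i => ?_) i) i
  · simpa only [spar, Fin.cons_zero] using h0
  · simpa only [spar, Fin.cons_zero, Fin.cons_succ] using h0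
  · simpa only [spar, Fin.cons_succ] using continuousOn_tpar i

/-- The regular part of the right-hand side of the transformation in the pinching limit. -/
noncomputable def rhsF (m : ℕ) (p q ω : ℂ) (t : Fin d → ℂ) (i₀ : Fin d) (r : ℝ) : ℂ :=
  (∏ j, ellGamma (-r * tpar t i₀ r j) p q) ^ 2 * pref p q (tpar t i₀ r) *
    (nrm m p q * torusInt m (Wt m p q (gam p q fun i => ω / spar t i₀ r i)))

theorem continuousOn_rhsF (hp : ‖p‖ < 1) (hq : ‖q‖ < 1) (hω : ω ≠ 0) {m : ℕ} {U : Set ℝ}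
    (hU : IsOpen U) (h : ∀ r ∈ U, admis ω t i₀ r) : ContinuousOn (rhsF m p q ω t i₀) U := by
  have hp0 : U ⊆ Set.Ioi 0 := fun r hr => (h r hr).1
  have ht0 : ∀ r ∈ U, ∀ j, tpar t i₀ r j ≠ 0 := fun r hr j =>
    norm_pos_iff.1 ((norm_nonneg ω).trans_lt ((h r hr).2.2 j).1)
  have hs0 : ∀ r ∈ U, ∀ j, spar t i₀ r j ≠ 0 := fun r hr j =>
    norm_pos_iff.1 ((norm_nonneg ω).trans_lt ((h r hr).norm_lt_spar j))
  have hr0 : ∀ r ∈ U, (-r : ℂ) ≠ 0 := fun r hr => neg_ne_zero.2 (by exact_mod_cast (h r hr).1.ne')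
  have ht : ∀ j, ContinuousOn (fun r => tpar t i₀ r j) U := fun j => (continuousOn_tpar j).mono hp0
  have a1 : ContinuousOn (fun r : ℝ => ∏ j, ellGamma (-r * tpar t i₀ r j) p q) U :=
    continuousOn_finsetProd _ fun j _ => continuousOn_ellGamma hp hq
      (ContinuousOn.mul (by fun_prop) (ht j)) (fun r hr => mul_ne_zero (hr0 r hr) (ht0 r hr j))
      fun r hr => ((h r hr).2.2 j).2.2
  have a2 := continuousOn_pref_param hp hq ht ht0 fun r hr j => ((h r hr).2.2 j).2.1
  have a3 := continuousOn_torusInt_gam (N := m) (S := fun r i => ω / spar t i₀ r i) hp hq hU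
    (fun j => continuousOn_const.div ((continuousOn_spar j).mono hp0) fun r hr => hs0 r hr j)
    (fun r hr j => div_ne_zero hω (hs0 r hr j)) fun r hr j => by
      rw [norm_div]; exact (div_lt_one (norm_pos_iff.2 (hs0 r hr j))).2 ((h r hr).norm_lt_spar j)
  exact ((a1.pow 2).mul a2).mul (continuousOn_const.mul a3)

theorem rhsF_one (hp : ‖p‖ < 1) (hq : ‖q‖ < 1) (hω : ω ^ 2 = p * q) (hω0 : ω ≠ 0) (m : ℕ) :
    rhsF m p q ω t i₀ 1 = (∏ j, ellGamma (-1 * t j) p q) ^ 2 *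
      (pref p q t * I_BC m d (fun i => ω / t i) p q) := by
  have e : torusInt m (Wt m p q (gam p q fun i => ω / spar t i₀ 1 i)) =
      torusInt m (Wt m p q (gam p q fun i => ω / t i)) := torusInt_congr fun z hz =>
    Wt_congr fun j => by
      have := ellGamma_mul_neg hp hq hω hω0 (hz j)
      rw [spar, div_cons, div_cons, gam_cons, gam_cons, tpar_one, Complex.ofReal_one, div_neg,
        div_one, this, one_mul, one_mul]
  rw [rhsF, e, I_BC_eq hp hq, tpar_one, Complex.ofReal_one]
  ring

theorem tendsto_rhs (hp : ‖p‖ < 1) (hq : ‖q‖ < 1) (hω : ω ^ 2 = p * q) (hω0 : ω ≠ 0) (hω1 : ‖ω‖ < 1)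
    (ht : ∀ r, ‖ω‖ < ‖t r‖ ∧ ‖t r‖ < 1) (m : ℕ) :
    Tendsto (fun r : ℝ => rg p q ((r : ℂ) ^ 2) * rhsF m p q ω t i₀ r) (𝓝[<] 1)
      (𝓝 (rg p q 1 * ((∏ j, ellGamma (-1 * t j) p q) ^ 2 *
        (pref p q t * I_BC m d (fun i => ω / t i) p q)))) := by
  obtain ⟨U, hUa, hU, h1U⟩ := mem_nhds_iff.1 (eventually_admis (i₀ := i₀) hω1 ht)
  have h1 := ((continuousOn_rhsF (m := m) hp hq hω0 hU hUa).continuousAt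
    (hU.mem_nhds h1U)).tendsto.mono_left (nhdsWithin_le_nhds (s := Set.Iio 1))
  rw [rhsF_one hp hq hω hω0] at h1
  refine Tendsto.mul ?_ h1
  have h2 : ContinuousOn (fun r : ℝ => rg p q ((r : ℂ) ^ 2)) (Set.Ioc 0 1) :=
    continuousOn_rg hp hq (by fun_prop)
      (fun r hr => pow_ne_zero 2 (by exact_mod_cast hr.1.ne')) fun r hr => by
        rw [norm_pow, Complex.norm_real, Real.norm_of_nonneg hr.1.le]
        exact pow_le_one₀ hr.1.le hr.2
  have h3 := (h2 1 ⟨one_pos, le_rfl⟩).tendsto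
  rw [Complex.ofReal_one, one_pow] at h3
  exact h3.mono_left (nhdsWithin_le_of_mem (mem_of_superset (Ioo_mem_nhdsLT one_pos)
    Set.Ioo_subset_Ioc_self))

theorem exists_Icc_admis (hω1 : ‖ω‖ < 1) (ht : ∀ r, ‖ω‖ < ‖t r‖ ∧ ‖t r‖ < 1) :
    ∃ r₁ : ℝ, 0 < r₁ ∧ r₁ < 1 ∧ ∀ r ∈ Set.Icc r₁ 1, admis ω t i₀ r := by
  obtain ⟨l, hl, hlU⟩ := exists_Ioc_subset_of_mem_nhds (eventually_admis (i₀ := i₀) hω1 ht)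
    ⟨0, one_pos⟩
  refine ⟨max ((l + 1) / 2) (1 / 2), by positivity, max_lt (by linarith) (by norm_num),
    fun r hr => hlU ⟨?_, hr.2⟩⟩
  have := (le_max_left _ _).trans hr.1
  linarith [show l < 1 from hl]

theorem tendsto_lhs (hp : ‖p‖ < 1) (hq : ‖q‖ < 1) (hω1 : ‖ω‖ < 1)
    (ht : ∀ r, ‖ω‖ < ‖t r‖ ∧ ‖t r‖ < 1) (n : ℕ) :
    Tendsto (fun r : ℝ => (1 - (r : ℂ) ^ 2) * I_BC (n + 1) (d + 1 + 1) (spar t i₀ r) p q) (𝓝[<] 1)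
      (𝓝 (rg p q 1 * (∏ j, ellGamma (-1 * t j) p q) ^ 2 * I_BC n d t p q)) := by
  obtain ⟨r₁, hr0, hr1, ha⟩ := exists_Icc_admis (i₀ := i₀) hω1 ht
  have hh : ContinuousOn (fun x : ℝ × ℂ => gam p q (tpar t i₀ x.1) x.2)
      (Set.Icc r₁ 1 ×ˢ Metric.sphere 0 1) :=
    continuousOn_gam_param (S := fun x : ℝ × ℂ => tpar t i₀ x.1) hp hq
      (fun j => (continuousOn_tpar j).comp continuousOn_fst fun x hx => hr0.trans_le hx.1.1)
      (fun x hx j => norm_pos_iff.1 ((norm_nonneg ω).trans_lt ((ha _ hx.1).2.2 j).1))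
      (fun x hx j => ((ha _ hx.1).2.2 j).2.1) continuousOn_snd
      fun x hx => mem_sphere_zero_iff_norm.1 hx.2
  have key := (tendsto_pinch (h := fun r => gam p q (tpar t i₀ r)) (n := n) hp hq hr0 hr1
    hh).const_mul (nrm (n + 1) p q)
  rw [nrm_mul_pinF (t := t) hp hq n (by rw [tpar_one]), tpar_one, ← I_BC_eq hp hq] at key
  refine key.congr fun r => ?_
  rw [I_BC_eq hp hq, gam_spar]
  ring

theorem bcId_of_succ {n m : ℕ} (H : BCId (n + 1) m) : BCId n m := by
  intro p q ω hp0 hp hq0 hq hω d hd t ht hbal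
  have hpq : ‖p * q‖ < 1 := norm_mul_lt_one hp hq
  have hω0 : ω ≠ 0 := fun h => mul_ne_zero (norm_pos_iff.1 hp0) (norm_pos_iff.1 hq0) (by
    rw [← hω, h]; ring)
  have hω1 : ‖ω‖ < 1 := by
    have : ‖ω‖ ^ 2 < 1 := by rwa [← norm_pow, hω]
    nlinarith [norm_nonneg ω]
  have i₀ : Fin d := ⟨0, by omega⟩
  obtain ⟨r₁, hr0, hr1, ha⟩ := exists_Icc_admis (i₀ := i₀) hω1 ht
  have hne : rg p q 1 * (∏ j, ellGamma (-1 * t j) p q) ^ 2 ≠ 0 := by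
    refine mul_ne_zero (fun h => ?_) (pow_ne_zero 2 (Finset.prod_ne_zero_iff.2 fun j _ => ?_))
    · have := rg_one hp hq
      rw [h, zero_mul] at this
      exact zero_ne_one this
    · have h0 : 0 < ‖t j‖ := (norm_nonneg ω).trans_lt (ht j).1
      rw [ellGamma_eq hp hq]
      refine div_ne_zero (Ef_ne_zero_of_norm_lt hp hq ?_) (Ef_ne_zero_of_norm_lt hp hq ?_)
      · rw [← hω, norm_div, norm_pow, neg_one_mul, norm_neg, div_lt_one h0]
        nlinarith [norm_nonneg ω, (ht j).1]
      · rw [neg_one_mul, norm_neg]; exact (ht j).2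
  refine mul_left_cancel₀ hne (tendsto_nhds_unique (tendsto_lhs (i₀ := i₀) hp hq hω1 ht n) ?_)
  rw [mul_assoc]
  refine (tendsto_rhs (i₀ := i₀) hp hq hω hω0 hω1 ht m).congr' ?_
  filter_upwards [show ∀ᶠ r : ℝ in 𝓝[<] 1, r₁ ≤ r ∧ r < 1 from Ico_mem_nhdsLT hr1] with r hr
  have hA := ha r ⟨hr.1, hr.2.le⟩
  rw [H p q ω hp0 hp hq0 hq hω (d + 1 + 1) (by omega) (spar t i₀ r) (hA.spar_lt hr.2)
    (by rw [prod_spar hA.1.ne', hbal]), pref_spar, ellGamma_eq_rg hp hq ((r : ℂ) ^ 2),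
    I_BC_eq hp hq, rhsF]
  have h1 : (1 : ℂ) - (r : ℂ) ^ 2 ≠ 0 := by
    have : (1 : ℝ) - r ^ 2 ≠ 0 := by nlinarith [hr.2, hA.1]
    exact_mod_cast this
  generalize (∏ j, ellGamma (-r * tpar t i₀ r j) p q) ^ 2 = A
  generalize torusInt m _ = B
  field_simp

end

theorem bcId_of_le {n m : ℕ} (h : n ≤ m) : BCId n m := by
  induction h using Nat.decreasingInduction with
  | self => exact bcId_self m
  | of_succ k _ ih => exact bcId_of_succ ih

theorem pref_mul_pref {p q ω : ℂ} {d : ℕ} {t : Fin d → ℂ} (hp : ‖p‖ < 1) (hq : ‖q‖ < 1)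
    (hω : ω ^ 2 = p * q) (hpq : p * q ≠ 0) (ht : ∀ r, ‖ω‖ < ‖t r‖ ∧ ‖t r‖ < 1) :
    pref p q t * pref p q (fun r => ω / t r) = 1 := by
  have h0 : ∀ r, 0 < ‖t r‖ := fun r => (norm_nonneg ω).trans_lt (ht r).1
  have hd : ∀ r, ‖ω / t r‖ < 1 := fun r => by rw [norm_div, div_lt_one (h0 r)]; exact (ht r).1
  unfold pref
  rw [← pairProd_mul, pairProd_congr (K' := fun _ _ => 1)]
  · simp [pairProd]
  · intro i j _
    have e : ω / t i * (ω / t j) = p * q / (t i * t j) := by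
      rw [div_mul_div_comm, ← sq, hω]
    rw [e]
    exact ellGamma_mul_reflect hp hq hpq
      (Ef_ne_zero_of_norm_lt hp hq (norm_mul_lt_one (ht i).2 (ht j).2))
      (Ef_ne_zero_of_norm_lt hp hq (e ▸ norm_mul_lt_one (hd i) (hd j)))

theorem bcId_symm {n m : ℕ} (H : BCId n m) : BCId m n := by
  intro p q ω hp0 hp hq0 hq hω d hd t ht hbal
  have hpq : p * q ≠ 0 := mul_ne_zero (norm_pos_iff.1 hp0) (norm_pos_iff.1 hq0)
  have hω0 : ω ≠ 0 := fun h => hpq (by rw [← hω, h]; ring)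
  have hn : 0 < ‖ω‖ := norm_pos_iff.2 hω0
  have h0 : ∀ r, 0 < ‖t r‖ := fun r => (norm_nonneg ω).trans_lt (ht r).1
  have e : (fun r => ω / (ω / t r)) = t := funext fun r => div_div_cancel₀ hω0
  have hb : ∏ r, ω / t r = (p * q) ^ (m + 1) := by
    rw [Finset.prod_div_distrib, hbal, Finset.prod_const, Finset.card_univ, Fintype.card_fin, hd,
      show 2 * n + 2 * m + 4 = 2 * ((m + 1) + (n + 1)) by ring, pow_mul, hω, pow_add]
    exact mul_div_cancel_right₀ _ (pow_ne_zero _ hpq)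
  have key := H p q ω hp0 hp hq0 hq hω d (by omega) (fun r => ω / t r) (fun r => ⟨by
    rw [norm_div, lt_div_iff₀ (h0 r)]; exact mul_lt_of_lt_one_right hn (ht r).2, by
    rw [norm_div, div_lt_one (h0 r)]; exact (ht r).1⟩) hb
  rw [e] at key
  rw [key, ← mul_assoc, pref_mul_pref hp hq hω hpq ht, one_mul]

theorem bcId (n m : ℕ) : BCId n m :=
  (le_total n m).elim bcId_of_le fun h => bcId_symm (bcId_of_le h)

end EllipticBC

/-- Theorem (the `BC_n ↔ BC_m` transformation). -/
theorem bc_transformation (m n : ℕ) (p q ω : ℂ)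
    (hp0 : 0 < ‖p‖) (hp1 : ‖p‖ < 1)
    (hq0 : 0 < ‖q‖) (hq1 : ‖q‖ < 1)
    (hω : ω ^ 2 = p * q)
    (t : Fin (2 * m + 2 * n + 4) → ℂ)
    (ht : ∀ r, ‖ω‖ < ‖t r‖ ∧ ‖t r‖ < 1)
    (hbal : ∏ r, t r = (p * q) ^ (m + 1)) :
    I_BC n (2 * m + 2 * n + 4) t p q =
      (∏ r, ∏ s, if r < s then ellGamma (t r * t s) p q else 1) *
        I_BC m (2 * m + 2 * n + 4) (fun r => ω / t r) p q :=
  EllipticBC.bcId n m p q ω hp0 hp1 hq0 hq1 hω _ rfl t ht hbal
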